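/- Suppose k ∈ ℕ, 1 ≤ p < ∞ and s ∈ ℝ with s ∉ {-k, ..., -1}. Define k_s := k if s > -1, k_s := ⌊s+k+1⌋ (integer part) if s ∈ (-k,-1), and k_s := 0 if s < -k. If u ∈ W^{k,p,p}_s, then ∇^{k-j}u ∈ (L^q_{s+j})^{ν(k-j,N)} for every 1 ≤ j ≤ k and every q ∈ I_{j,p}, and there is a constant C > 0 independent of u such that ||\,|∇^{k-j}u|\,||_{L^q_{s+j}} ≤ C ||\,|∇^k u|\,||_{L^p_s} whenever 1 ≤ j ≤ k - k_s, and ||\,|∇^{k-j}u|\,||_{L^q_{s+j}} ≤ C (||u||_{L^p_{s+k}} + ||\,|∇^k u|\,||_{L^p_s}) whenever 1 ≤ j ≤ k. -/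

import Mathlib

open MeasureTheory Metric Filter Topology ENNReal

noncomputable section

/-- Euclidean space `ℝ^N`. -/
abbrev Euc (N : ℕ) := EuclideanSpace ℝ (Fin N)

/-- Iterated classical partial derivative along a list of coordinate directions. -/
def pderivList {N : ℕ} : List (Fin N) → (Euc N → ℝ) → Euc N → ℝ
  | [], φ => φ
  | i :: l, φ => pderivList l fun x => fderiv ℝ φ x (EuclideanSpace.single i 1)

/-- `g` is the weak (distributional) partial derivative of `u` of order given by the
list `l` of coordinate directions, i.e. `g = ∂_{l₁} ⋯ ∂_{l_r} u` in `D'(ℝ^N)`. -/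
def IsWeakDerivList {N : ℕ} (l : List (Fin N)) (u g : Euc N → ℝ) : Prop :=
  LocallyIntegrable u volume ∧ LocallyIntegrable g volume ∧
    ∀ φ : Euc N → ℝ, ContDiff ℝ (⊤ : ℕ∞) φ → HasCompactSupport φ →
      ∫ x, u x * pderivList l φ x = (-1 : ℝ) ^ l.length * ∫ x, g x * φ x

/-- `g` is the weak partial derivative `∂ᵢ u`. -/
def IsWeakPartialDeriv {N : ℕ} (i : Fin N) (u g : Euc N → ℝ) : Prop :=
  IsWeakDerivList [i] u g

/-- The weight `(1+|x|)^{-s-N/q}` of the space `L^q_s` (with `N/∞ := 0`). -/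
def wt (N : ℕ) (s : ℝ) (q : ℝ≥0∞) (x : Euc N) : ℝ :=
  (1 + ‖x‖) ^ (-s - (N : ℝ) / q.toReal)

/-- Membership in the weighted space `L^q_s`. -/
def MemLs (N : ℕ) (s : ℝ) (q : ℝ≥0∞) (u : Euc N → ℝ) : Prop :=
  MemLp (fun x => wt N s q x * u x) q volume

/-- The norm of the weighted space `L^q_s`. -/
def LsNorm (N : ℕ) (s : ℝ) (q : ℝ≥0∞) (u : Euc N → ℝ) : ℝ :=
  (eLpNorm (fun x => wt N s q x * u x) q volume).toReal

/-- Membership in the exponentially weighted space `L^q_{exp,s}`. -/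
def MemLexp (N : ℕ) (s : ℝ) (q : ℝ≥0∞) (u : Euc N → ℝ) : Prop :=
  MemLp (fun x => Real.exp (-(s * ‖x‖)) * u x) q volume

/-- The norm of the exponentially weighted space `L^q_{exp,s}`. -/
def LexpNorm (N : ℕ) (s : ℝ) (q : ℝ≥0∞) (u : Euc N → ℝ) : ℝ :=
  (eLpNorm (fun x => Real.exp (-(s * ‖x‖)) * u x) q volume).toReal

/-- The pointwise Euclidean (Frobenius) norm `|∇^k u|` of the `k`-th gradient, whose
components `g m` are indexed by the `k`-tuples `m` of coordinate directions. -/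
def gradNormK {N k : ℕ} (g : (Fin k → Fin N) → Euc N → ℝ) (x : Euc N) : ℝ :=
  Real.sqrt (∑ m : Fin k → Fin N, g m x ^ 2)

/-- The pointwise Euclidean norm `|∇u|` of a first-order gradient. -/
def gradNorm1 {N : ℕ} (g : Fin N → Euc N → ℝ) (x : Euc N) : ℝ :=
  Real.sqrt (∑ i, g i x ^ 2)

/-- The interval `I_{j,p}` of admissible exponents `q`. -/
def Ijp (N j : ℕ) (p : ℝ) : Set ℝ≥0∞ :=
  if p = (N : ℝ) / (j : ℝ) ∧ 1 < N then Set.Ico (ENNReal.ofReal p) ⊤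
  else if p < (N : ℝ) / (j : ℝ) then
    Set.Icc (ENNReal.ofReal p) (ENNReal.ofReal ((N : ℝ) * p / ((N : ℝ) - (j : ℝ) * p)))
  else Set.Icc (ENNReal.ofReal p) ⊤

/-- The average of `u` on the ball `B_ρ`. -/
def ballAvg {N : ℕ} (ρ : ℝ) (u : Euc N → ℝ) : ℝ :=
  (volume (ball (0 : Euc N) ρ)).toReal⁻¹ * ∫ y in ball (0 : Euc N) ρ, u y

/-- The radial symmetrization `u_S(x) = (Nω_N)⁻¹ ∫_{S^{N-1}} u(|x|σ) dσ`. -/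
def radialSymmetrization {N : ℕ} (u : Euc N → ℝ) (x : Euc N) : ℝ :=
  ((N : ℝ) * (volume (ball (0 : Euc N) 1)).toReal)⁻¹ *
    ∫ σ : sphere (0 : Euc N) 1, u (‖x‖ • (σ : Euc N)) ∂((volume : Measure (Euc N)).toSphere)

/-- `u` is radially symmetric: `u x` only depends on `|x|`. -/
def RadSymm {N : ℕ} (u : Euc N → ℝ) : Prop :=
  ∀ x y : Euc N, ‖x‖ = ‖y‖ → u x = u y

/-- Evaluation of a polynomial on `ℝ^N` at a point. -/
def polyEval {N : ℕ} (π : MvPolynomial (Fin N) ℝ) (x : Euc N) : ℝ :=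
  MvPolynomial.eval (fun i => x i) π


/-- `k_s`: `k` if `s > -1`, the integer part of `s+k+1` if `s ∈ (-k,-1)`, `0` if `s < -k`. -/
def kIndex (k : ℕ) (s : ℝ) : ℕ :=
  if -1 < s then k else if s < -(k : ℝ) then 0 else Nat.floor (s + k + 1)



/-- Jensen-type inequality for the Lebesgue integral over a finite measure. -/
theorem jensen_lint {α : Type*} [MeasurableSpace α] {ν : Measure α} [IsFiniteMeasure ν]
    {f : α → ℝ≥0∞} (hf : AEMeasurable f ν) {p : ℝ} (hp : 1 ≤ p) :
    (∫⁻ a, f a ∂ν) ^ p ≤ ν Set.univ ^ (p - 1) * ∫⁻ a, f a ^ p ∂ν := by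
  have hp0 : 0 < p := by linarith
  have h := eLpNorm'_le_eLpNorm'_mul_rpow_measure_univ (μ := ν) (f := f) one_pos hp
    hf.aestronglyMeasurable
  have h2 := ENNReal.rpow_le_rpow h hp0.le
  simp only [eLpNorm', enorm_eq_self, ENNReal.rpow_one, div_one] at h2
  refine h2.trans (le_of_eq ?_)
  rw [ENNReal.mul_rpow_of_nonneg _ _ hp0.le, ← ENNReal.rpow_mul, ← ENNReal.rpow_mul,
    one_div_mul_cancel hp0.ne', ENNReal.rpow_one, mul_comm]
  congr 2
  field_simp

/-- Minkowski's integral inequality, in the form of a uniform bound. -/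
theorem minkowski_lint {α β : Type*} [MeasurableSpace α] [MeasurableSpace β]
    {ν : Measure α} [IsFiniteMeasure ν] {μ : Measure β} [SFinite μ]
    {φ : α → β → ℝ≥0∞} (hφ : Measurable (Function.uncurry φ)) {q : ℝ≥0∞} (hq : 1 ≤ q)
    {K : ℝ≥0∞} (hK : ∀ᵐ t ∂ν, eLpNorm (φ t) q μ ≤ K) :
    eLpNorm (fun x => ∫⁻ t, φ t x ∂ν) q μ ≤ ν Set.univ * K := by
  by_cases hqt : q = ∞
  · subst hqt
    simp only [eLpNorm_exponent_top] at hK ⊢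
    have h1 : ∀ᵐ t ∂ν, ∀ᵐ x ∂μ, φ t x ≤ K := by
      filter_upwards [hK] with t ht
      filter_upwards [ae_le_eLpNormEssSup (f := φ t) (μ := μ)] with x hx
      exact hx.trans ht
    have hms : MeasurableSet {z : α × β | φ z.1 z.2 ≤ K} :=
      measurableSet_le hφ measurable_const
    have h2 : ∀ᵐ z ∂(ν.prod μ), φ z.1 z.2 ≤ K := (Measure.ae_prod_iff_ae_ae hms).2 h1
    have h3 : ∀ᵐ z ∂(μ.prod ν), φ z.2 z.1 ≤ K := by
      have := (Measure.measurePreserving_swap (μ := μ) (ν := ν)).quasiMeasurePreserving.ae h2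
      simpa using this
    have h4 := Measure.ae_ae_of_ae_prod h3
    refine essSup_le_of_ae_le _ ?_
    filter_upwards [h4] with x hx
    calc ‖∫⁻ t, φ t x ∂ν‖ₑ = ∫⁻ t, φ t x ∂ν := rfl
      _ ≤ ∫⁻ t, K ∂ν := lintegral_mono_ae hx
      _ = ν Set.univ * K := by rw [lintegral_const, mul_comm]
  · have hq0 : q ≠ 0 := (zero_lt_one.trans_le hq).ne'
    set p := q.toReal with hpdef
    have hp1 : 1 ≤ p := by
      rw [hpdef, ← ENNReal.toReal_one]; exact ENNReal.toReal_mono hqt hq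
    have hp0 : 0 < p := by linarith
    have hKp : ∀ᵐ t ∂ν, ∫⁻ x, φ t x ^ p ∂μ ≤ K ^ p := by
      filter_upwards [hK] with t ht
      rw [eLpNorm_eq_lintegral_rpow_enorm_toReal hq0 hqt] at ht
      have := ENNReal.rpow_le_rpow ht hp0.le
      rwa [← ENNReal.rpow_mul, one_div_mul_cancel hp0.ne', ENNReal.rpow_one] at this
    rw [eLpNorm_eq_lintegral_rpow_enorm_toReal hq0 hqt]
    simp only [enorm_eq_self, ← hpdef]
    have hmain : ∫⁻ x, (∫⁻ t, φ t x ∂ν) ^ p ∂μ ≤ (ν Set.univ * K) ^ p := by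
      calc ∫⁻ x, (∫⁻ t, φ t x ∂ν) ^ p ∂μ
          ≤ ∫⁻ x, ν Set.univ ^ (p - 1) * ∫⁻ t, φ t x ^ p ∂ν ∂μ := by
            refine lintegral_mono fun x => jensen_lint ?_ hp1
            exact (hφ.comp (measurable_id.prodMk measurable_const)).aemeasurable
        _ = ν Set.univ ^ (p - 1) * ∫⁻ x, ∫⁻ t, φ t x ^ p ∂ν ∂μ := by
            rw [lintegral_const_mul]
            have : Measurable (fun z : β × α => φ z.2 z.1 ^ p) :=
              (hφ.comp measurable_swap).pow_const p
            exact this.lintegral_prod_right'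
        _ = ν Set.univ ^ (p - 1) * ∫⁻ t, ∫⁻ x, φ t x ^ p ∂μ ∂ν := by
            rw [lintegral_lintegral_swap]
            exact ((hφ.comp measurable_swap).pow_const p).aemeasurable
        _ ≤ ν Set.univ ^ (p - 1) * ∫⁻ t, K ^ p ∂ν := by
            gcongr 1
            exact lintegral_mono_ae hKp
        _ = (ν Set.univ * K) ^ p := by
            rw [lintegral_const, mul_comm (K ^ p), ← mul_assoc,
              ENNReal.mul_rpow_of_nonneg _ _ hp0.le]
            congr 1
            by_cases h0 : ν Set.univ = 0
            · rw [h0]; simp [hp0]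
            · nth_rewrite 2 [← ENNReal.rpow_one (ν Set.univ)]
              rw [← ENNReal.rpow_add _ _ h0 (measure_ne_top _ _)]; congr 1; ring
    calc _ ≤ ((ν Set.univ * K) ^ p) ^ (1 / p) := ENNReal.rpow_le_rpow hmain (by positivity)
      _ = _ := by rw [← ENNReal.rpow_mul, mul_one_div_cancel hp0.ne', ENNReal.rpow_one]

/-- Change of variables on a ball. -/
theorem ball_comp {N : ℕ} (x : Euc N) {r : ℝ} (hr : 0 < r) (H : Euc N → ℝ≥0∞) :
    ∫⁻ z in ball (0 : Euc N) 1, H (x + r • z) =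
      ENNReal.ofReal ((r ^ N)⁻¹) * ∫⁻ y in ball x r, H y := by
  have hme : MeasurableEmbedding (fun z : Euc N => x + r • z) := 
    ((Homeomorph.addLeft x).measurableEmbedding).comp
      (Homeomorph.smulOfNeZero r hr.ne').measurableEmbedding
  have hmap : Measure.map (fun z : Euc N => x + r • z) volume
      = ENNReal.ofReal ((r ^ N)⁻¹) • (volume : Measure (Euc N)) := by
    have h1 : (fun z : Euc N => x + r • z) = (fun z => x + z) ∘ (fun z => r • z) := rfl
    rw [h1, ← Measure.map_map (measurable_const_add x) (measurable_const_smul r),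
      Measure.map_addHaar_smul _ hr.ne', Measure.map_smul, map_add_left_eq_self]
    simp [abs_of_pos hr]
  have hpre : (fun z : Euc N => x + r • z) ⁻¹' (ball x r) = ball 0 1 := by
    ext z
    simp [norm_smul, abs_of_pos hr, hr]
  rw [← hpre, ← hme.lintegral_map H, ← hme.restrict_map, hmap, Measure.restrict_smul,
    lintegral_smul_measure, smul_eq_mul]

theorem av_int {N : ℕ} {h : Euc N → ℝ} (hm : Measurable h)
    (hL : ∀ x y, |h x - h y| ≤ (1 / 2) * ‖x - y‖) {t : ℝ} (ht : 0 < t) (ht1 : t ≤ 1)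
    {G : Euc N → ℝ≥0∞} (hG : Measurable G) :
    ∫⁻ x in {x | 0 < h x}, ENNReal.ofReal (((t * h x) ^ N)⁻¹) * ∫⁻ y in ball x (t * h x), G y
      ≤ (ENNReal.ofReal (3 ^ N) * volume (ball (0 : Euc N) 1)) * ∫⁻ y, G y := by
  have hsm : MeasurableSet {x | 0 < h x} := measurableSet_lt measurable_const hm
  set S : Set (Euc N × Euc N) := {z | dist z.2 z.1 < t * h z.1 ∧ 0 < h z.1} with hS
  have hSm : MeasurableSet S := by
    apply MeasurableSet.inter
    · exact measurableSet_lt (measurable_snd.dist measurable_fst)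
        ((hm.comp measurable_fst).const_mul t)
    · exact measurableSet_lt measurable_const (hm.comp measurable_fst)
  set Φ : Euc N → Euc N → ℝ≥0∞ := fun x y =>
    S.indicator (fun z => ENNReal.ofReal (((t * h z.1) ^ N)⁻¹) * G z.2) (x, y) with hΦ
  have hΦm : Measurable (Function.uncurry Φ) := by
    apply Measurable.indicator _ hSm
    refine Measurable.mul (ENNReal.measurable_ofReal.comp ?_) (hG.comp measurable_snd)
    exact (((hm.comp measurable_fst).const_mul t).pow_const N).inv
  have h1 : ∫⁻ x in {x | 0 < h x}, ENNReal.ofReal (((t * h x) ^ N)⁻¹) *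
      ∫⁻ y in ball x (t * h x), G y = ∫⁻ x, ∫⁻ y, Φ x y := by
    rw [← lintegral_indicator hsm]
    refine lintegral_congr fun x => ?_
    by_cases hx : 0 < h x
    · rw [Set.indicator_of_mem (by exact hx), ← lintegral_indicator measurableSet_ball,
        ← lintegral_const_mul _ (hG.indicator measurableSet_ball)]
      refine lintegral_congr fun y => ?_
      by_cases hy : dist y x < t * h x
      · rw [hΦ, Set.indicator_of_mem (by exact hy)]
        simp only
        rw [Set.indicator_of_mem]
        exact ⟨hy, hx⟩
      · rw [hΦ, Set.indicator_of_notMem (by exact hy)]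
        simp only
        rw [Set.indicator_of_notMem, mul_zero]
        exact fun h => hy h.1
    · rw [Set.indicator_of_notMem (by exact hx)]
      symm
      rw [← lintegral_zero (μ := (volume : Measure (Euc N)))]
      refine lintegral_congr fun y => ?_
      exact Set.indicator_of_notMem (fun h => hx h.2) _
  rw [h1, lintegral_lintegral_swap hΦm.aemeasurable, ← lintegral_const_mul _ hG]
  refine lintegral_mono fun y => ?_
  by_cases hy : 0 < h y
  · calc ∫⁻ x, Φ x y ≤ ∫⁻ x, (ball y (2 * t * h y)).indicator
          (fun _ => ENNReal.ofReal ((3 / 2) ^ N * ((t * h y) ^ N)⁻¹) * G y) x := by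
          refine lintegral_mono fun x => ?_
          by_cases hx : (x, y) ∈ S
          · have hd := hx.1
            have hx0 := hx.2
            simp only at hd hx0
            have hl := hL x y
            rw [dist_comm, dist_eq_norm] at hd
            have hth : t * h x ≤ h x := by nlinarith
            have hab := abs_le.1 hl
            have e1 : h x ≤ 2 * h y := by linarith [hab.2]
            have e2 : h y ≤ 3 / 2 * h x := by linarith [hab.1]
            have hmem : x ∈ ball y (2 * t * h y) := by
              rw [mem_ball, dist_eq_norm]
              nlinarith
            rw [Set.indicator_of_mem hmem]
            simp only [hΦ]
            rw [Set.indicator_of_mem hx]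
            simp only
            gcongr
            rw [← one_div, ← one_div, div_le_iff₀ (by positivity), mul_one_div,
              div_mul_eq_mul_div, le_div_iff₀ (by positivity), one_mul, ← mul_pow]
            refine pow_le_pow_left₀ (by positivity) ?_ N
            nlinarith
          · simp only [hΦ]
            rw [Set.indicator_of_notMem hx]
            exact zero_le
      _ = _ := by
          rw [lintegral_indicator measurableSet_ball, lintegral_const,
            Measure.restrict_apply MeasurableSet.univ, Set.univ_inter,
            Measure.addHaar_ball_of_pos _ _ (by positivity : 0 < 2 * t * h y)]
          simp only [finrank_euclideanSpace, Fintype.card_fin]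
          have : (3:ℝ) ^ N = ((3 / 2) ^ N * ((t * h y) ^ N)⁻¹) * (2 * t * h y) ^ N := by
            rw [show 2 * t * h y = 2 * (t * h y) by ring, mul_pow 2 (t * h y), div_pow]
            have h3 : (t * h y) ^ N ≠ 0 := by positivity
            generalize (t * h y) ^ N = a at h3
            field_simp
          rw [this, ENNReal.ofReal_mul (p := (3 / 2) ^ N * ((t * h y) ^ N)⁻¹) (by positivity)]
          generalize ENNReal.ofReal ((3 / 2) ^ N * ((t * h y) ^ N)⁻¹) = A
          generalize ENNReal.ofReal ((2 * t * h y) ^ N) = A'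
          ring
  · have : ∫⁻ x, Φ x y = 0 := by
      rw [← lintegral_zero (μ := (volume : Measure (Euc N)))]
      refine lintegral_congr fun x => ?_
      refine Set.indicator_of_notMem (fun hx => hy ?_) _
      have hd := hx.1
      have hx0 := hx.2
      simp only at hd hx0
      have hl := hL x y
      rw [dist_comm, dist_eq_norm] at hd
      have hth : t * h x ≤ h x := by nlinarith
      have hab := abs_le.1 hl
      linarith [hab.2]
    rw [this]; exact zero_le



theorem av_pt {N : ℕ} (x : Euc N) {r : ℝ} (hr : 0 < r) {H : Euc N → ℝ≥0∞} (hH : Measurable H)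
    {p : ℝ} (hp : 1 ≤ p) :
    (∫⁻ z in ball (0 : Euc N) 1, H (x + r • z)) ^ p ≤
      volume (ball (0 : Euc N) 1) ^ (p - 1) *
        (ENNReal.ofReal ((r ^ N)⁻¹) * ∫⁻ y in ball x r, H y ^ p) := by
  have : IsFiniteMeasure ((volume : Measure (Euc N)).restrict (ball (0 : Euc N) 1)) :=
    ⟨by rw [Measure.restrict_apply_univ]; exact measure_ball_lt_top⟩
  have h1 := jensen_lint (ν := (volume : Measure (Euc N)).restrict (ball (0 : Euc N) 1))
    (f := fun z => H (x + r • z)) (by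
      apply Measurable.aemeasurable
      exact hH.comp (by fun_prop)) hp
  rw [Measure.restrict_apply_univ] at h1
  refine h1.trans (le_of_eq ?_)
  rw [ball_comp x hr (fun y => H y ^ p)]

theorem ofReal_inv_pow {N : ℕ} {r : ℝ} (hr : 0 < r) :
    ENNReal.ofReal ((r ^ N)⁻¹) = ENNReal.ofReal r ^ (-(N : ℝ)) := by
  rw [ENNReal.ofReal_rpow_of_pos hr, Real.rpow_neg hr.le, Real.rpow_natCast]

theorem av_bound (N : ℕ) {p : ℝ} (hp : 1 ≤ p) {q : ℝ≥0∞} (hpq : ENNReal.ofReal p ≤ q) :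
    ∃ C : NNReal, ∀ h : Euc N → ℝ, Measurable h →
      (∀ x y, |h x - h y| ≤ (1 / 2) * ‖x - y‖) → ∀ t : ℝ, 0 < t → t ≤ 1 →
      ∀ H : Euc N → ℝ≥0∞, Measurable H →
      eLpNorm ({x | 0 < h x}.indicator (fun x =>
          ENNReal.ofReal (h x) ^ ((N : ℝ) * (1 / p - 1 / q.toReal)) *
            ∫⁻ z in ball (0 : Euc N) 1, H (x + (t * h x) • z))) q volume
        ≤ C * ENNReal.ofReal t ^ (-((N : ℝ) * (1 / p - 1 / q.toReal))) *
            eLpNorm H (ENNReal.ofReal p) volume := by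
  have hp0 : 0 < p := by linarith
  set b := volume (ball (0 : Euc N) 1) with hb
  have hbt : b ≠ ∞ := measure_ball_lt_top.ne
  have hP0 : ENNReal.ofReal p ≠ 0 := by simpa using hp0
  have hPt : ENNReal.ofReal p ≠ ∞ := ofReal_ne_top
  have hPr : (ENNReal.ofReal p).toReal = p := ENNReal.toReal_ofReal hp0.le
  have hpp : 0 ≤ (p - 1) / p := div_nonneg (by linarith) hp0.le
  have key : ∀ h : Euc N → ℝ, ∀ t : ℝ, 0 < t → ∀ H : Euc N → ℝ≥0∞, Measurable H → ∀ x, 0 < h x →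
      (∫⁻ z in ball (0 : Euc N) 1, H (x + (t * h x) • z)) ^ p ≤
      b ^ (p - 1) * (ENNReal.ofReal t ^ (-(N : ℝ)) * ENNReal.ofReal (h x) ^ (-(N : ℝ))
        * ∫⁻ y, H y ^ p) := by
    intro h t ht H hH x hx
    refine (av_pt x (mul_pos ht hx) hH hp).trans ?_
    gcongr
    · rw [ofReal_inv_pow (mul_pos ht hx), ENNReal.ofReal_mul ht.le,
        ENNReal.mul_rpow_of_ne_top ofReal_ne_top ofReal_ne_top]
    · exact Measure.restrict_le_self
  have hcanc : ∀ y : ℝ, 0 < y → ∀ a : ℝ,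
      ENNReal.ofReal y ^ a * ENNReal.ofReal y ^ (-a) = 1 := by
    intro y hy a
    rw [← ENNReal.rpow_add _ _ (by simpa using hy) ofReal_ne_top, add_neg_cancel,
      ENNReal.rpow_zero]
  by_cases hqt : q = ∞
  · subst hqt
    refine ⟨(b ^ ((p - 1) / p)).toNNReal, ?_⟩
    intro h hm hL t ht ht1 H hH
    rw [ENNReal.coe_toNNReal (ENNReal.rpow_ne_top_of_nonneg hpp hbt)]
    simp only [ENNReal.toReal_top, _root_.div_zero, sub_zero]
    rw [eLpNorm_exponent_top]
    refine essSup_le_of_ae_le _ (Eventually.of_forall fun x => ?_)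
    simp only [enorm_eq_self]
    by_cases hx : 0 < h x
    swap
    · rw [Set.indicator_of_notMem (by exact hx)]; exact zero_le
    rw [Set.indicator_of_mem (by exact hx)]
    have h1 := ENNReal.rpow_le_rpow (key h t ht H hH x hx) (by positivity : 0 ≤ 1 / p)
    rw [← ENNReal.rpow_mul, mul_one_div_cancel hp0.ne', ENNReal.rpow_one] at h1
    rw [eLpNorm_eq_lintegral_rpow_enorm_toReal hP0 hPt, hPr]
    simp only [enorm_eq_self]
    refine (mul_le_mul_right h1 _).trans (le_of_eq ?_)
    have hi : 0 ≤ 1 / p := by positivity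
    rw [ENNReal.mul_rpow_of_nonneg _ _ hi, ENNReal.mul_rpow_of_nonneg _ _ hi,
      ENNReal.mul_rpow_of_nonneg _ _ hi, ← ENNReal.rpow_mul, ← ENNReal.rpow_mul,
      ← ENNReal.rpow_mul, neg_mul, mul_one_div (p - 1)]
    have := hcanc (h x) hx ((N : ℝ) * (1 / p))
    calc _ = b ^ ((p - 1) / p) * ENNReal.ofReal t ^ (-((N : ℝ) * (1 / p))) *
          (∫⁻ y, H y ^ p) ^ (1 / p) *
          (ENNReal.ofReal (h x) ^ ((N : ℝ) * (1 / p)) *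
            ENNReal.ofReal (h x) ^ (-((N : ℝ) * (1 / p)))) := by ring
      _ = _ := by rw [this, mul_one]
  · have hq0 : q ≠ 0 := ((pos_iff_ne_zero.2 hP0).trans_le hpq).ne'
    set Q := q.toReal with hQ
    have hpQ : p ≤ Q := by rw [← hPr]; exact ENNReal.toReal_mono hqt hpq
    have hQ0 : 0 < Q := by linarith
    set c := (ENNReal.ofReal (3 ^ N) * b) with hc
    have hct : c ≠ ∞ := ENNReal.mul_ne_top ofReal_ne_top hbt
    have hCt : b ^ ((p - 1) / p) * c ^ (1 / Q) ≠ ∞ :=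
      ENNReal.mul_ne_top (ENNReal.rpow_ne_top_of_nonneg hpp hbt)
        (ENNReal.rpow_ne_top_of_nonneg (by positivity) hct)
    refine ⟨(b ^ ((p - 1) / p) * c ^ (1 / Q)).toNNReal, ?_⟩
    intro h hm hL t ht ht1 H hH
    rw [ENNReal.coe_toNNReal hCt]
    have hsm : MeasurableSet {x | 0 < h x} := measurableSet_lt measurable_const hm
    set e := Q / p - 1 with he
    have he0 : 0 ≤ e := by rw [he, sub_nonneg, one_le_div hp0]; exact hpQ
    set I := ∫⁻ y, H y ^ p with hI
    set d := (N : ℝ) * (1 / p - 1 / Q) with hd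
    have hdQ : d * Q = N * e := by rw [hd, he]; field_simp
    rw [eLpNorm_eq_lintegral_rpow_enorm_toReal hq0 hqt,
      eLpNorm_eq_lintegral_rpow_enorm_toReal hP0 hPt, hPr]
    simp only [enorm_eq_self]
    rw [← hI, ← hQ]
    have hmain : ∫⁻ x, ({x | 0 < h x}.indicator (fun x => ENNReal.ofReal (h x) ^ d *
        ∫⁻ z in ball (0 : Euc N) 1, H (x + (t * h x) • z)) x) ^ Q ≤
        ((b ^ (p - 1)) * I) ^ e * ENNReal.ofReal t ^ (-((N : ℝ) * e)) * (b ^ (p - 1) * (c * I)) := by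
      calc _ ≤ ∫⁻ x, {x | 0 < h x}.indicator (fun x =>
            ((b ^ (p - 1)) * I) ^ e * ENNReal.ofReal t ^ (-((N : ℝ) * e)) * b ^ (p - 1) *
            (ENNReal.ofReal (((t * h x) ^ N)⁻¹) * ∫⁻ y in ball x (t * h x), H y ^ p)) x := by
            refine lintegral_mono fun x => ?_
            by_cases hx : 0 < h x
            swap
            · rw [Set.indicator_of_notMem (by exact hx), Set.indicator_of_notMem (by exact hx),
                ENNReal.zero_rpow_of_pos hQ0]
            rw [Set.indicator_of_mem (by exact hx), Set.indicator_of_mem (by exact hx)]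
            rw [ENNReal.mul_rpow_of_nonneg _ _ hQ0.le, ← ENNReal.rpow_mul, hdQ]
            set X := ∫⁻ z in ball (0 : Euc N) 1, H (x + (t * h x) • z) with hX
            have hXQ : X ^ Q = (X ^ p) ^ e * X ^ p := by
              rw [← ENNReal.rpow_mul, ← ENNReal.rpow_add_of_nonneg _ _ (by positivity) hp0.le]
              congr 1; rw [he]; field_simp; ring
            have k1 := ENNReal.rpow_le_rpow (key h t ht H hH x hx) he0
            have k2 := av_pt x (mul_pos ht hx) hH hp
            rw [hXQ]
            refine (mul_le_mul_right (mul_le_mul' k1 k2) _).trans (le_of_eq ?_)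
            rw [← hI]
            have := hcanc (h x) hx ((N : ℝ) * e)
            simp only [ENNReal.mul_rpow_of_nonneg _ _ he0]
            rw [← ENNReal.rpow_mul (ENNReal.ofReal t), ← ENNReal.rpow_mul (ENNReal.ofReal (h x)),
              neg_mul]
            set Y := (ENNReal.ofReal (((t * h x) ^ N)⁻¹) * ∫⁻ y in ball x (t * h x), H y ^ p)
            calc _ = (b ^ (p - 1)) ^ e * I ^ e * ENNReal.ofReal t ^ (-((N : ℝ) * e)) *
                  b ^ (p - 1) * Y * (ENNReal.ofReal (h x) ^ ((N : ℝ) * e) *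
                  ENNReal.ofReal (h x) ^ (-((N : ℝ) * e))) := by ring
              _ = _ := by rw [this, mul_one]
        _ ≤ _ := by
            rw [lintegral_indicator hsm]
            have hbb : ∀ e₁ : ℝ, 0 ≤ e₁ → b ^ e₁ ≠ ∞ := fun e₁ h₁ =>
              ENNReal.rpow_ne_top_of_nonneg h₁ hbt
            have h3 := av_int hm hL ht ht1 (hH.pow_const p)
            by_cases hfin : ((b ^ (p - 1)) * I) ^ e * ENNReal.ofReal t ^ (-((N : ℝ) * e)) *
              b ^ (p - 1) = ∞
            · have hIt : I = ∞ := by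
                by_contra hI'
                refine ENNReal.mul_ne_top (ENNReal.mul_ne_top ?_ ?_) ?_ hfin
                · exact ENNReal.rpow_ne_top_of_nonneg he0
                    (ENNReal.mul_ne_top (hbb _ (by linarith)) hI')
                · exact ENNReal.rpow_ne_top_of_ne_zero (by simpa using ht) ofReal_ne_top
                · exact hbb _ (by linarith)
              have hb0 : b ≠ 0 := (measure_ball_pos _ _ one_pos).ne'
              have hc0 : c ≠ 0 := by
                rw [hc]; exact mul_ne_zero (by simp) hb0
              have hz : b ^ (p - 1) ≠ 0 := by
                simp [ENNReal.rpow_eq_zero_iff, hb0, hbt]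
              refine le_top.trans (le_of_eq ?_)
              symm
              rw [hIt, ENNReal.mul_top hc0, ENNReal.mul_top hz, ENNReal.mul_top]
              refine mul_ne_zero ?_ ?_
              · rcases he0.eq_or_lt with h0 | h0
                · rw [← h0]; simp
                · rw [ENNReal.top_rpow_of_pos h0]; simp
              · simp [ENNReal.rpow_eq_zero_iff]
                intro h'; linarith
            · rw [lintegral_const_mul' _ _ hfin]
              calc _ ≤ _ := mul_le_mul_right h3 _
                _ = _ := by rw [← hc, ← hI]; ring
    refine (ENNReal.rpow_le_rpow hmain (by positivity : 0 ≤ 1 / Q)).trans (le_of_eq ?_)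
    have hiQ : 0 ≤ 1 / Q := by positivity
    simp only [ENNReal.mul_rpow_of_nonneg _ _ hiQ, ENNReal.mul_rpow_of_nonneg _ _ he0,
      ← ENNReal.rpow_mul]
    have e1 : -(↑N * e) * (1 / Q) = -d := by rw [← hdQ]; field_simp
    have e2 : b ^ ((p - 1) / p) = b ^ ((p - 1) * e * (1 / Q)) * b ^ ((p - 1) * (1 / Q)) := by
      rw [← ENNReal.rpow_add_of_nonneg _ _
        (mul_nonneg (mul_nonneg (by linarith) he0) hiQ) (mul_nonneg (by linarith) hiQ)]
      congr 1; rw [he]; field_simp; ring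
    have e3 : I ^ (1 / p) = I ^ (e * (1 / Q)) * I ^ (1 / Q) := by
      rw [← ENNReal.rpow_add_of_nonneg _ _ (mul_nonneg he0 hiQ) hiQ]
      congr 1; rw [he]; field_simp; ring
    rw [e1, e2, e3]
    ring



/-- First-order classical partial derivative. -/
def pd {N : ℕ} (e : Fin N) (f : Euc N → ℝ) (x : Euc N) : ℝ :=
  fderiv ℝ f x (EuclideanSpace.single e 1)

theorem pd_contDiff {N : ℕ} {e : Fin N} {f : Euc N → ℝ} (hf : ContDiff ℝ (⊤ : ℕ∞) f) :
    ContDiff ℝ (⊤ : ℕ∞) (pd e f) :=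
  (hf.fderiv_right (m := (⊤ : ℕ∞)) (by simp)).clm_apply contDiff_const

theorem fderiv_enorm_le {N : ℕ} (f : Euc N → ℝ) (x : Euc N) :
    ‖fderiv ℝ f x‖ₑ ≤ ∑ e, ‖pd e f x‖ₑ := by
  have h : ‖fderiv ℝ f x‖ ≤ ∑ e, ‖pd e f x‖ := by
    refine ContinuousLinearMap.opNorm_le_bound _ (by positivity) fun v => ?_
    have hv : v = ∑ i, v i • EuclideanSpace.single i (1 : ℝ) := by
      ext j
      simp [Finset.sum_apply, Pi.single_apply]
    conv_lhs => rw [hv]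
    rw [map_sum, Finset.sum_mul]
    refine (norm_sum_le _ _).trans (Finset.sum_le_sum fun i _ => ?_)
    rw [map_smul, norm_smul, mul_comm]
    exact mul_le_mul_of_nonneg_left (PiLp.norm_apply_le v i) (norm_nonneg _)
  rw [← ofReal_norm]
  refine (ENNReal.ofReal_le_ofReal h).trans ?_
  rw [ENNReal.ofReal_sum_of_nonneg (fun _ _ => norm_nonneg _)]
  exact le_of_eq (Finset.sum_congr rfl fun _ _ => ofReal_norm _)

theorem pd_enorm_le {N : ℕ} (e : Fin N) (f : Euc N → ℝ) (x : Euc N) :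
    ‖pd e f x‖ₑ ≤ ‖fderiv ℝ f x‖ₑ := by
  rw [← ofReal_norm, ← ofReal_norm]
  refine ENNReal.ofReal_le_ofReal ?_
  have := (fderiv ℝ f x).le_opNorm (EuclideanSpace.single e 1)
  simpa [pd] using this

theorem ftc_enorm {N : ℕ} {f : Euc N → ℝ} (hf : ContDiff ℝ 1 f) (x v : Euc N) :
    ‖f (x + v) - f x‖ₑ ≤ ∫⁻ t in Set.Ioc (0 : ℝ) 1, ‖fderiv ℝ f (x + t • v) v‖ₑ := by
  have hc : Continuous (fun t : ℝ => fderiv ℝ f (x + t • v) v) := by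
    have := hf.continuous_fderiv one_ne_zero
    fun_prop
  have hd : ∀ t ∈ Set.uIcc (0 : ℝ) 1,
      HasDerivAt (fun t : ℝ => f (x + t • v)) (fderiv ℝ f (x + t • v) v) t := by
    intro t _
    have h1 : HasFDerivAt f (fderiv ℝ f (x + t • v)) (x + t • v) :=
      (hf.differentiable one_ne_zero _).hasFDerivAt
    have h2 : HasDerivAt (fun t : ℝ => x + t • v) v t := by
      simpa using ((hasDerivAt_id t).smul_const v).const_add x
    exact h1.comp_hasDerivAt t h2
  have h := intervalIntegral.integral_eq_sub_of_hasDerivAt hd (hc.intervalIntegrable 0 1)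
  simp only [one_smul, zero_smul, add_zero] at h
  rw [← h, intervalIntegral.integral_of_le zero_le_one]
  exact enorm_integral_le_lintegral_enorm _

/-- A fixed mollifier supported in the unit ball. -/
def psi (N : ℕ) : Euc N → ℝ :=
  (⟨1 / 2, 1, by norm_num, by norm_num⟩ : ContDiffBump (0 : Euc N)).normed volume

theorem psi_contDiff (N : ℕ) : ContDiff ℝ (⊤ : ℕ∞) (psi N) := ContDiffBump.contDiff_normed _
theorem psi_integral (N : ℕ) : ∫ z, psi N z = 1 := ContDiffBump.integral_normed _
theorem psi_compact (N : ℕ) : HasCompactSupport (psi N) := ContDiffBump.hasCompactSupport_normed _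
theorem psi_support (N : ℕ) : Function.support (psi N) = ball 0 1 :=
  ContDiffBump.support_normed_eq _

theorem psi_bound (N : ℕ) : ∃ C : NNReal, (∀ z, ‖psi N z‖ₑ ≤ C) ∧
    ∀ e z, ‖pd e (psi N) z‖ₑ ≤ C := by
  obtain ⟨C1, h1⟩ := (psi_compact N).exists_bound_of_continuous (psi_contDiff N).continuous
  have hc := (psi_contDiff N).continuous_fderiv (by simp)
  obtain ⟨C2, h2⟩ := ((psi_compact N).fderiv (𝕜 := ℝ)).exists_bound_of_continuous hc
  refine ⟨(max C1 C2).toNNReal, fun z => ?_, fun e z => (pd_enorm_le e _ z).trans ?_⟩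
  · rw [← ofReal_norm]
    exact ENNReal.ofReal_le_ofReal ((h1 z).trans (le_max_left _ _))
  · rw [← ofReal_norm]
    exact ENNReal.ofReal_le_ofReal ((h2 z).trans (le_max_right _ _))

theorem enorm_int_le_of_support {N : ℕ} {ρ F : Euc N → ℝ} {C : NNReal}
    (hρ : ∀ z, ‖ρ z‖ₑ ≤ C) (hs : ∀ z, z ∉ ball (0 : Euc N) 1 → ρ z = 0) :
    ‖∫ z, ρ z * F z‖ₑ ≤ C * ∫⁻ z in ball (0 : Euc N) 1, ‖F z‖ₑ := by
  refine (enorm_integral_le_lintegral_enorm _).trans ?_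
  rw [← lintegral_const_mul' _ _ coe_ne_top, ← lintegral_indicator measurableSet_ball]
  refine lintegral_mono fun z => ?_
  by_cases hz : z ∈ ball (0 : Euc N) 1
  · rw [Set.indicator_of_mem hz, enorm_mul]
    exact mul_le_mul_left (hρ z) _
  · rw [Set.indicator_of_notMem hz, hs z hz]
    simp

theorem pd_psi_zero {N : ℕ} (e : Fin N) (z : Euc N) (hz : z ∉ ball (0 : Euc N) 1) :
    pd e (psi N) z = 0 := by
  by_contra hne
  have h0 : psi N z = 0 := by
    by_contra h
    exact hz (by rw [← psi_support]; exact h)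
  have hmin : IsMinOn (psi N) Set.univ z := by
    intro y _
    change psi N z ≤ psi N y
    rw [h0]
    exact ContDiffBump.nonneg_normed _ _
  have : fderiv ℝ (psi N) z = 0 := (hmin.isLocalMin Filter.univ_mem).fderiv_eq_zero
  simp [pd, this] at hne

theorem pt1 (N : ℕ) {C : NNReal} (hC : ∀ z, ‖psi N z‖ₑ ≤ C) {f : Euc N → ℝ}
    (hf : ContDiff ℝ 1 f) (x : Euc N) {h : ℝ} (hh : 0 < h) :
    ‖f x‖ₑ ≤ ‖∫ z, psi N z * f (x + h • z)‖ₑ +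
      C * (ENNReal.ofReal h * ∫⁻ t in Set.Ioc (0 : ℝ) 1, ∫⁻ z in ball (0 : Euc N) 1,
        ‖fderiv ℝ f (x + (t * h) • z)‖ₑ) := by
  have hpc : Continuous (psi N) := (psi_contDiff N).continuous
  have hfc : Continuous f := hf.continuous
  have i1 : Integrable (fun z => psi N z * f x) :=
    (hpc.integrable_of_hasCompactSupport (psi_compact N)).mul_const _
  have i2 : Integrable (fun z => psi N z * f (x + h • z)) :=
    Continuous.integrable_of_hasCompactSupport (by fun_prop) ((psi_compact N).mul_right)
  have heq : f x = (∫ z, psi N z * f (x + h • z)) -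
      ∫ z, psi N z * (f (x + h • z) - f x) := by
    rw [← integral_sub i2]
    · simp only [mul_sub, _root_.sub_sub_cancel]
      rw [integral_mul_const, psi_integral, one_mul]
    · simp only [mul_sub]
      exact i2.sub i1
  conv_lhs => rw [heq]
  refine enorm_sub_le.trans ?_
  gcongr
  refine (enorm_int_le_of_support hC (fun z hz => by
    by_contra h; exact hz (by rw [← psi_support]; exact h))).trans ?_
  gcongr
  have hfd := hf.continuous_fderiv one_ne_zero
  rw [lintegral_lintegral_swap (by
    apply Measurable.aemeasurable
    have : Continuous (Function.uncurry fun (t : ℝ) (z : Euc N) =>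
      ‖fderiv ℝ f (x + (t * h) • z)‖ₑ) := by
      apply Continuous.enorm
      fun_prop
    exact this.measurable)]
  rw [← lintegral_const_mul' _ _ ofReal_ne_top]
  refine setLIntegral_mono' measurableSet_ball fun z hz => ?_
  refine (ftc_enorm hf x (h • z)).trans ?_
  rw [← lintegral_const_mul' _ _ ofReal_ne_top]
  refine lintegral_mono fun t => ?_
  simp only [smul_smul]
  rw [← ofReal_norm, ← ofReal_norm, ← ENNReal.ofReal_mul hh.le]
  refine ENNReal.ofReal_le_ofReal ?_
  refine ((fderiv ℝ f (x + (t * h) • z)).le_opNorm _).trans ?_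
  rw [mul_comm]
  refine mul_le_mul_of_nonneg_right ?_ (norm_nonneg _)
  rw [norm_smul, Real.norm_of_nonneg hh.le]
  have : ‖z‖ < 1 := by simpa using hz
  nlinarith

theorem pt2 (N : ℕ) {C : NNReal} (hC : ∀ z, ‖psi N z‖ₑ ≤ C) (f : Euc N → ℝ) (x : Euc N) (h : ℝ) :
    ‖∫ z, psi N z * f (x + h • z)‖ₑ ≤ C * ∫⁻ z in ball (0 : Euc N) 1, ‖f (x + h • z)‖ₑ :=
  enorm_int_le_of_support hC (fun z hz => by
    by_contra h; exact hz (by rw [← psi_support]; exact h))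

theorem pt3 (N : ℕ) {C : NNReal} (hC : ∀ e z, ‖pd e (psi N) z‖ₑ ≤ C) {f : Euc N → ℝ}
    (hf : ContDiff ℝ 1 f) (e : Fin N) (x : Euc N) {h : ℝ} (hh : 0 < h) :
    ‖∫ z, psi N z * pd e f (x + h • z)‖ₑ ≤
      C * (ENNReal.ofReal h⁻¹ * ∫⁻ z in ball (0 : Euc N) 1, ‖f (x + h • z)‖ₑ) := by
  have hpc : Continuous (psi N) := (psi_contDiff N).continuous
  have hfc : Continuous f := hf.continuous
  have hfd := hf.continuous_fderiv one_ne_zero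
  have hpfd := (psi_contDiff N).continuous_fderiv (by simp)
  set F : Euc N → ℝ := fun z => f (x + h • z) with hF
  have hFd : ∀ z, HasFDerivAt F (h • fderiv ℝ f (x + h • z)) z := by
    intro z
    have h1 : HasFDerivAt f (fderiv ℝ f (x + h • z)) (x + h • z) :=
      (hf.differentiable one_ne_zero _).hasFDerivAt
    have h2 : HasFDerivAt (fun z : Euc N => x + h • z) (h • ContinuousLinearMap.id ℝ (Euc N)) z :=
      ((hasFDerivAt_id z).const_smul h).const_add x
    have e : h • fderiv ℝ f (x + h • z) =
        (fderiv ℝ f (x + h • z)).comp (h • ContinuousLinearMap.id ℝ (Euc N)) := by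
      ext v; simp
    rw [e]
    exact h1.comp z h2
  have hFe : ∀ z, fderiv ℝ F z (EuclideanSpace.single e 1) = h * pd e f (x + h • z) := by
    intro z; rw [(hFd z).fderiv]; rfl
  have hFpc : Continuous (fun z => fderiv ℝ F z (EuclideanSpace.single e 1)) := by
    simp only [hFe, pd]; fun_prop
  have hFc : Continuous F := by rw [hF]; fun_prop
  have hibp := integral_mul_fderiv_eq_neg_fderiv_mul_of_integrable (μ := volume) (𝕜 := ℝ)
    (f := psi N) (g := F) (v := EuclideanSpace.single e 1)
    (Continuous.integrable_of_hasCompactSupport (by fun_prop)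
      (((psi_compact N).fderiv_apply (𝕜 := ℝ) _).mul_right))
    (Continuous.integrable_of_hasCompactSupport (by fun_prop) ((psi_compact N).mul_right))
    (Continuous.integrable_of_hasCompactSupport (by fun_prop) ((psi_compact N).mul_right))
    (fun z _ => (psi_contDiff N).differentiable (by simp) z) (fun z _ => (hFd z).differentiableAt)
  have h5 : ∫ z, psi N z * pd e f (x + h • z) = - (h⁻¹ * ∫ z, pd e (psi N) z * F z) := by
    simp only [hFe] at hibp
    have : ∀ z, psi N z * (h * pd e f (x + h • z)) = h * (psi N z * pd e f (x + h • z)) := by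
      intro z; ring
    simp only [this] at hibp
    rw [integral_const_mul] at hibp
    have h6 : (∫ z, pd e (psi N) z * F z) = - (h * ∫ z, psi N z * pd e f (x + h • z)) := by
      rw [hibp, neg_neg]; rfl
    rw [h6]; field_simp
  rw [h5, enorm_neg, enorm_mul, Real.enorm_of_nonneg (inv_nonneg.2 hh.le)]
  refine (mul_le_mul_right (enorm_int_le_of_support (hC e) (pd_psi_zero e)) _).trans (le_of_eq ?_)
  ring



/-- Extended-valued weight `(1+|x|)^b`. -/
def om {N : ℕ} (b : ℝ) (x : Euc N) : ℝ≥0∞ := ENNReal.ofReal (1 + ‖x‖) ^ b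

/-- Weighted norm of an extended nonnegative function. -/
def wn {N : ℕ} (b : ℝ) (q : ℝ≥0∞) (F : Euc N → ℝ≥0∞) : ℝ≥0∞ :=
  eLpNorm (fun x => om b x * F x) q volume

theorem ofReal_one_add_ne_zero {N : ℕ} (x : Euc N) : ENNReal.ofReal (1 + ‖x‖) ≠ 0 := by
  have := norm_nonneg x
  simp only [ne_eq, ENNReal.ofReal_eq_zero, not_le]; linarith

theorem om_add {N : ℕ} (a b : ℝ) (x : Euc N) : om (a + b) x = om a x * om b x :=
  ENNReal.rpow_add _ _ (ofReal_one_add_ne_zero x) ofReal_ne_top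

theorem om_ne_zero {N : ℕ} (b : ℝ) (x : Euc N) : om b x ≠ 0 := by
  unfold om
  have h := ENNReal.rpow_pos (p := b) (pos_iff_ne_zero.2 (ofReal_one_add_ne_zero x)) ofReal_ne_top
  exact h.ne'

theorem om_ne_top {N : ℕ} (b : ℝ) (x : Euc N) : om b x ≠ ∞ :=
  ENNReal.rpow_ne_top_of_ne_zero (ofReal_one_add_ne_zero x) ofReal_ne_top

theorem om_measurable {N : ℕ} (b : ℝ) : Measurable (om b : Euc N → ℝ≥0∞) := by
  unfold om; fun_prop

theorem om_eq {N : ℕ} (b : ℝ) (x : Euc N) : om b x = ENNReal.ofReal ((1 + ‖x‖) ^ b) := by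
  have := norm_nonneg x
  rw [om, ENNReal.ofReal_rpow_of_pos (by linarith)]

theorem enorm_wt {N : ℕ} (s : ℝ) (q : ℝ≥0∞) (x : Euc N) :
    ‖wt N s q x‖ₑ = om (-s - N / q.toReal) x := by
  have := norm_nonneg x
  rw [om_eq, wt, Real.enorm_of_nonneg (by positivity)]

theorem nrm_eq {N : ℕ} (s : ℝ) (q : ℝ≥0∞) (f : Euc N → ℝ) :
    eLpNorm (fun x => wt N s q x * f x) q volume
      = wn (-s - N / q.toReal) q (fun x => ‖f x‖ₑ) := by
  rw [wn, ← eLpNorm_enorm]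
  congr 1
  ext x
  rw [enorm_mul, enorm_wt]

theorem om_comp {N : ℕ} (b : ℝ) {x y : Euc N} (hxy : ‖y - x‖ ≤ (1 + ‖x‖) / 2) :
    om b x ≤ ((2 : NNReal) ^ |b| : NNReal) * om b y := by
  have h1 : ‖x‖ ≤ ‖y‖ + ‖y - x‖ := by
    have := norm_sub_norm_le x y; rw [norm_sub_rev] at this; linarith
  have h2 : ‖y‖ ≤ ‖x‖ + ‖y - x‖ := by
    have := norm_sub_norm_le y x; linarith
  have hx := norm_nonneg x
  have hy := norm_nonneg y
  have h3 : ((2 : NNReal) ^ |b| : NNReal) * om b y = ENNReal.ofReal (2 ^ |b| * (1 + ‖y‖) ^ b) := by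
    rw [om_eq, ENNReal.ofReal_mul (by positivity)]
    congr 1
    rw [← ENNReal.ofReal_coe_nnreal]; simp
  rw [h3, om_eq]
  apply ENNReal.ofReal_le_ofReal
  rcases le_total 0 b with hb | hb
  · rw [abs_of_nonneg hb, ← Real.mul_rpow (by norm_num) (by positivity)]
    exact Real.rpow_le_rpow (by positivity) (by linarith) hb
  · rw [abs_of_nonpos hb]
    have : (1 + ‖x‖) ^ b ≤ ((1 + ‖y‖) / 2) ^ b :=
      Real.rpow_le_rpow_of_nonpos (by positivity) (by linarith) hb
    refine this.trans (le_of_eq ?_)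
    rw [Real.div_rpow (by positivity) (by norm_num), Real.rpow_neg (by norm_num)]
    field_simp

theorem loc_bound (N : ℕ) {p : ℝ} {q : ℝ≥0∞} (hp : 1 ≤ p) (hpq : ENNReal.ofReal p ≤ q) :
    ∃ C : NNReal, ∀ h : Euc N → ℝ, Measurable h → (∀ x y, |h x - h y| ≤ (1 / 2) * ‖x - y‖) →
      ∀ ω : Euc N → ℝ≥0∞, Measurable ω → ∀ K : NNReal,
      (∀ x y, 0 < h x → ‖y - x‖ ≤ h x → ω x ≤ K * ω y) →
      ∀ t : ℝ, 0 < t → t ≤ 1 → ∀ G : Euc N → ℝ≥0∞, Measurable G →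
      eLpNorm ({x | 0 < h x}.indicator (fun x => ω x *
        (ENNReal.ofReal (h x) ^ ((N : ℝ) * (1 / p - 1 / q.toReal)) *
          ∫⁻ z in ball (0 : Euc N) 1, G (x + (t * h x) • z)))) q volume ≤
      (C * K) * ENNReal.ofReal t ^ (-((N : ℝ) * (1 / p - 1 / q.toReal))) *
        eLpNorm (fun x => ω x * G x) (ENNReal.ofReal p) volume := by
  obtain ⟨C, hC⟩ := av_bound N hp hpq
  refine ⟨C, fun h hm hL ω hω K hK t ht ht1 G hG => ?_⟩
  have h1 := hC h hm hL t ht ht1 (fun x => ω x * G x) (hω.mul hG)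
  have h2 := eLpNorm_le_nnreal_smul_eLpNorm_of_ae_le_mul' (μ := (volume : Measure (Euc N)))
    (f := {x | 0 < h x}.indicator (fun x => ω x *
        (ENNReal.ofReal (h x) ^ ((N : ℝ) * (1 / p - 1 / q.toReal)) *
          ∫⁻ z in ball (0 : Euc N) 1, G (x + (t * h x) • z))))
    (g := {x | 0 < h x}.indicator (fun x => 
        (ENNReal.ofReal (h x) ^ ((N : ℝ) * (1 / p - 1 / q.toReal)) *
          ∫⁻ z in ball (0 : Euc N) 1, ω (x + (t * h x) • z) * G (x + (t * h x) • z))))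
    (c := K) (Eventually.of_forall ?_) q
  · refine h2.trans ?_
    rw [ENNReal.smul_def, smul_eq_mul]
    refine (mul_le_mul_right h1 _).trans (le_of_eq (by ring))
  · intro x
    by_cases hx : x ∈ {x | 0 < h x}
    · simp only [Set.indicator_of_mem hx, enorm_eq_self]
      have hx' : 0 < h x := hx
      rw [mul_left_comm (ω x), mul_left_comm (K : ℝ≥0∞)]
      refine mul_le_mul_right ?_ _
      rw [← lintegral_const_mul' _ _ coe_ne_top]
      have : ω x * ∫⁻ z in ball (0 : Euc N) 1, G (x + (t * h x) • z)
        = ∫⁻ z in ball (0 : Euc N) 1, ω x * G (x + (t * h x) • z) := by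
        rw [lintegral_const_mul _ (by fun_prop)]
      rw [this]
      refine setLIntegral_mono' measurableSet_ball fun z hz => ?_
      rw [← mul_assoc]
      gcongr
      apply hK x _ hx'
      have hz' : ‖z‖ < 1 := by simpa using hz
      rw [add_sub_cancel_left, norm_smul, Real.norm_of_nonneg (by positivity)]
      calc t * h x * ‖z‖ ≤ 1 * h x * 1 := by gcongr
        _ = h x := by ring
    · simp [Set.indicator_of_notMem hx]

theorem loc_int (N : ℕ) {p : ℝ} {q : ℝ≥0∞} (hp : 1 ≤ p) (hpq : ENNReal.ofReal p ≤ q)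
    (hα : (N : ℝ) * (1 / p - 1 / q.toReal) < 1) :
    ∃ C : NNReal, ∀ h : Euc N → ℝ, Measurable h → (∀ x y, |h x - h y| ≤ (1 / 2) * ‖x - y‖) →
      ∀ ω : Euc N → ℝ≥0∞, Measurable ω → ∀ K : NNReal,
      (∀ x y, 0 < h x → ‖y - x‖ ≤ h x → ω x ≤ K * ω y) →
      ∀ G : Euc N → ℝ≥0∞, Measurable G →
      eLpNorm ({x | 0 < h x}.indicator (fun x => ω x *
        (ENNReal.ofReal (h x) ^ ((N : ℝ) * (1 / p - 1 / q.toReal)) *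
          ∫⁻ t in Set.Ioc (0 : ℝ) 1, ∫⁻ z in ball (0 : Euc N) 1, G (x + (t * h x) • z)))) q volume ≤
      (C * K) * eLpNorm (fun x => ω x * G x) (ENNReal.ofReal p) volume := by
  obtain ⟨C, hC⟩ := loc_bound N hp hpq
  set α := (N : ℝ) * (1 / p - 1 / q.toReal) with hαd
  set ν : Measure ℝ := (volume.restrict (Set.Ioc (0 : ℝ) 1)).withDensity
    (fun t => ENNReal.ofReal t ^ (-α)) with hν
  have hdm : Measurable (fun t : ℝ => ENNReal.ofReal t ^ (-α)) := by fun_prop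
  have hfin : ν Set.univ ≠ ∞ := by
    rw [hν, withDensity_apply _ MeasurableSet.univ, Measure.restrict_univ]
    have hi : IntegrableOn (fun t : ℝ => t ^ (-α)) (Set.Ioc 0 1) := by
      have := intervalIntegral.intervalIntegrable_rpow' (a := 0) (b := 1) (r := -α) (by linarith)
      rwa [intervalIntegrable_iff_integrableOn_Ioc_of_le zero_le_one] at this
    have h2 := hi.2.ne
    refine ne_top_of_le_ne_top h2 ?_
    refine setLIntegral_mono' measurableSet_Ioc fun t ht => ?_
    rw [ENNReal.ofReal_rpow_of_pos ht.1, Real.enorm_of_nonneg (Real.rpow_nonneg ht.1.le _)]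
  have : IsFiniteMeasure ν := ⟨hfin.lt_top⟩
  refine ⟨(ν Set.univ).toNNReal * C, fun h hm hL ω hω K hK G hG => ?_⟩
  have hq1 : 1 ≤ q := le_trans (by simpa using hp) hpq
  set φ : ℝ → Euc N → ℝ≥0∞ := fun t => {x | 0 < h x}.indicator (fun x => ENNReal.ofReal t ^ α *
    (ω x * (ENNReal.ofReal (h x) ^ α * ∫⁻ z in ball (0 : Euc N) 1, G (x + (t * h x) • z)))) with hφ
  have hsm : MeasurableSet {x | 0 < h x} := measurableSet_lt measurable_const hm
  have hjm : Measurable (fun y : (ℝ × Euc N) × Euc N => G (y.1.2 + (y.1.1 * h y.1.2) • y.2)) := by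
    fun_prop
  have hφm : Measurable (Function.uncurry φ) := by
    have h1 : Measurable (fun y : ℝ × Euc N => ENNReal.ofReal y.1 ^ α *
      (ω y.2 * (ENNReal.ofReal (h y.2) ^ α * 
        ∫⁻ z in ball (0 : Euc N) 1, G (y.2 + (y.1 * h y.2) • z)))) := by
      have h3 : Measurable fun y : ℝ × Euc N => 
        ∫⁻ z in ball (0 : Euc N) 1, G (y.2 + (y.1 * h y.2) • z) := hjm.lintegral_prod_right'
      fun_prop
    have h2 : Function.uncurry φ = (Prod.snd ⁻¹' {x | 0 < h x}).indicator
        (fun y : ℝ × Euc N => ENNReal.ofReal y.1 ^ α *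
      (ω y.2 * (ENNReal.ofReal (h y.2) ^ α * 
        ∫⁻ z in ball (0 : Euc N) 1, G (y.2 + (y.1 * h y.2) • z)))) := by
      ext ⟨t, x⟩
      simp only [hφ, Function.uncurry, Set.indicator]
      rfl
    rw [h2]
    exact h1.indicator (measurable_snd hsm)
  have hb := minkowski_lint (ν := ν) (μ := (volume : Measure (Euc N))) hφm hq1
    (K := (C * K) * eLpNorm (fun x => ω x * G x) (ENNReal.ofReal p) volume) ?_
  · refine le_trans (le_of_eq ?_) (hb.trans (le_of_eq ?_))
    · congr 1
      ext x
      by_cases hx : x ∈ {x | 0 < h x}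
      · simp only [hφ, Set.indicator_of_mem hx]
        have h3 : Measurable fun y : ℝ => 
          ∫⁻ z in ball (0 : Euc N) 1, G (x + (y * h x) • z) := by
          have : Measurable (fun y : ℝ × Euc N => G (x + (y.1 * h x) • y.2)) := by fun_prop
          exact this.lintegral_prod_right'
        rw [hν, lintegral_withDensity_eq_lintegral_mul _ hdm (by fun_prop)]
        rw [← lintegral_const_mul _ h3, ← lintegral_const_mul _ (by fun_prop)]
        refine setLIntegral_congr_fun measurableSet_Ioc fun t ht => ?_
        simp only [Pi.mul_apply]
        rw [← mul_assoc (ENNReal.ofReal t ^ (-α)), ← ENNReal.rpow_add _ _ (by simpa using ht.1) ofReal_ne_top]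
        simp
      · simp [hφ, Set.indicator_of_notMem hx]
    · rw [coe_mul, coe_toNNReal hfin]; ring
  · have : ∀ᵐ t ∂(volume.restrict (Set.Ioc (0 : ℝ) 1)), 
        eLpNorm (φ t) q volume ≤ (C * K) * eLpNorm (fun x => ω x * G x) (ENNReal.ofReal p) volume := by
      refine (ae_restrict_iff' measurableSet_Ioc).2 (Eventually.of_forall fun t ht => ?_)
      have h1 := hC h hm hL ω hω K hK t ht.1 ht.2 G hG
      have hcne : ENNReal.ofReal t ^ α ≠ ∞ :=
        ENNReal.rpow_ne_top_of_ne_zero (by simpa using ht.1) ofReal_ne_top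
      have h2 := eLpNorm_le_nnreal_smul_eLpNorm_of_ae_le_mul' (μ := (volume : Measure (Euc N)))
        (f := φ t)
        (g := {x | 0 < h x}.indicator (fun x => ω x * (ENNReal.ofReal (h x) ^ α *
          ∫⁻ z in ball (0 : Euc N) 1, G (x + (t * h x) • z))))
        (c := (ENNReal.ofReal t ^ α).toNNReal) (Eventually.of_forall ?_) q
      · refine h2.trans ?_
        rw [ENNReal.smul_def, smul_eq_mul, coe_toNNReal hcne]
        refine (mul_le_mul_right h1 _).trans (le_of_eq ?_)
        calc _ = (ENNReal.ofReal t ^ α * ENNReal.ofReal t ^ (-α)) * (C * K * 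
              eLpNorm (fun x => ω x * G x) (ENNReal.ofReal p) volume) := by ring
          _ = _ := by
              rw [← ENNReal.rpow_add _ _ (by simpa using ht.1) ofReal_ne_top]; simp
      · intro x
        rw [coe_toNNReal hcne]
        by_cases hx : x ∈ {x | 0 < h x}
        · simp only [hφ, Set.indicator_of_mem hx, enorm_eq_self, le_refl]
        · simp [hφ, Set.indicator_of_notMem hx]
    exact (withDensity_absolutelyContinuous _ _).ae_le this


theorem eLp_le_add {N : ℕ} {q : ℝ≥0∞} (hq : 1 ≤ q) {f A B : Euc N → ℝ≥0∞} (c : NNReal)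
    (hA : Measurable A) (hB : Measurable B) (h : ∀ x, f x ≤ c * (A x + B x)) :
    eLpNorm f q volume ≤ c * (eLpNorm A q volume + eLpNorm B q volume) := by
  have h2 := eLpNorm_le_nnreal_smul_eLpNorm_of_ae_le_mul' (μ := (volume : Measure (Euc N)))
    (f := f) (g := A + B) (c := c) (Eventually.of_forall (fun x => by simpa using h x)) q
  refine h2.trans ?_
  rw [ENNReal.smul_def, smul_eq_mul]
  exact mul_le_mul_right (eLpNorm_add_le hA.aestronglyMeasurable hB.aestronglyMeasurable hq) _

theorem eLp_le_mul {N : ℕ} {q : ℝ≥0∞} {f A : Euc N → ℝ≥0∞} (c : NNReal)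
    (h : ∀ x, f x ≤ c * A x) :
    eLpNorm f q volume ≤ c * eLpNorm A q volume := by
  have h2 := eLpNorm_le_nnreal_smul_eLpNorm_of_ae_le_mul' (μ := (volume : Measure (Euc N)))
    (f := f) (g := A) (c := c) (Eventually.of_forall (fun x => by simpa using h x)) q
  refine h2.trans ?_
  rw [ENNReal.smul_def, smul_eq_mul]

theorem eLp_mono {N : ℕ} {q : ℝ≥0∞} {f A : Euc N → ℝ≥0∞} (h : ∀ x, f x ≤ A x) :
    eLpNorm f q volume ≤ eLpNorm A q volume :=
  eLpNorm_mono_enorm (fun x => by simpa using h x)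

theorem eLp_sum {N : ℕ} {q : ℝ≥0∞} (hq : 1 ≤ q) {ι : Type*} (s : Finset ι)
    {A : ι → Euc N → ℝ≥0∞}
    (hA : ∀ i, Measurable (A i)) :
    eLpNorm (fun x => ∑ i ∈ s, A i x) q volume ≤ ∑ i ∈ s, eLpNorm (A i) q volume := by
  classical
  induction s using Finset.induction_on with
  | empty => simp [← Pi.zero_def]
  | insert a s ha ih =>
    simp only [Finset.sum_insert ha]
    refine (eLp_le_add hq 1 (hA a) (Finset.measurable_sum s fun i _ => hA i) 
      (f := fun x => A a x + ∑ i ∈ s, A i x) (fun x => by simp)).trans ?_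
    simp only [coe_one, one_mul]
    gcongr

theorem pd_measurable {N : ℕ} {e : Fin N} {f : Euc N → ℝ} (hf : ContDiff ℝ (⊤ : ℕ∞) f) :
    Measurable (fun x => ‖pd e f x‖ₑ) := (pd_contDiff hf).continuous.enorm.measurable

theorem wn_fderiv {N : ℕ} {b : ℝ} {q : ℝ≥0∞} (hq : 1 ≤ q) {f : Euc N → ℝ}
    (hf : ContDiff ℝ (⊤ : ℕ∞) f) {M : ℝ≥0∞}
    (h : ∀ e, wn b q (fun x => ‖pd e f x‖ₑ) ≤ M) :
    wn b q (fun x => ‖fderiv ℝ f x‖ₑ) ≤ (N : NNReal) * M := by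
  have h1 : wn b q (fun x => ‖fderiv ℝ f x‖ₑ) ≤
      eLpNorm (fun x => ∑ e, om b x * ‖pd e f x‖ₑ) q volume := by
    refine eLp_mono fun x => ?_
    rw [← Finset.mul_sum]
    gcongr
    exact fderiv_enorm_le f x
  refine (h1.trans (eLp_sum hq _ fun e => (om_measurable b).mul (pd_measurable hf))).trans ?_
  refine (Finset.sum_le_sum (fun e _ => h e)).trans ?_
  simp

theorem meas_av {N : ℕ} {h : Euc N → ℝ} (hm : Measurable h) {G : Euc N → ℝ≥0∞}
    (hG : Measurable G) (t : ℝ) :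
    Measurable (fun x => ∫⁻ z in ball (0 : Euc N) 1, G (x + (t * h x) • z)) := by
  have : Measurable (fun y : Euc N × Euc N => G (y.1 + (t * h y.1) • y.2)) := by fun_prop
  exact this.lintegral_prod_right'

theorem meas_av2 {N : ℕ} {h : Euc N → ℝ} (hm : Measurable h) {G : Euc N → ℝ≥0∞}
    (hG : Measurable G) :
    Measurable (fun x => ∫⁻ t in Set.Ioc (0 : ℝ) 1, ∫⁻ z in ball (0 : Euc N) 1,
      G (x + (t * h x) • z)) := by
  have h1 : Measurable (fun y : (Euc N × ℝ) × Euc N => G (y.1.1 + (y.1.2 * h y.1.1) • y.2)) := by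
    fun_prop
  have h2 : Measurable (fun y : Euc N × ℝ => ∫⁻ z in ball (0 : Euc N) 1, 
    G (y.1 + (y.2 * h y.1) • z)) := h1.lintegral_prod_right'
  exact h2.lintegral_prod_right'

theorem emb_sub (N : ℕ) {p : ℝ} {q : ℝ≥0∞} (hp : 1 ≤ p) (hpq : ENNReal.ofReal p ≤ q)
    (hα : (N : ℝ) * (1 / p - 1 / q.toReal) < 1) (b : ℝ) :
    ∃ C : NNReal, ∀ f : Euc N → ℝ, ContDiff ℝ (⊤ : ℕ∞) f → ∀ M : ℝ≥0∞,
      wn b (ENNReal.ofReal p) (fun x => ‖f x‖ₑ) ≤ M →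
      (∀ e, wn (b + 1) (ENNReal.ofReal p) (fun x => ‖pd e f x‖ₑ) ≤ M) →
      wn (b + (N : ℝ) * (1 / p - 1 / q.toReal)) q (fun x => ‖f x‖ₑ) ≤ C * M := by
  obtain ⟨C1, hC1⟩ := loc_bound N hp hpq
  obtain ⟨C2, hC2⟩ := loc_int N hp hpq hα
  obtain ⟨C0, hC0, -⟩ := psi_bound N
  have hq1 : 1 ≤ q := le_trans (by simpa using hp) hpq
  set α := (N : ℝ) * (1 / p - 1 / q.toReal) with hαd
  set h : Euc N → ℝ := fun x => (1 + ‖x‖) / 2 with hh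
  have hm : Measurable h := by fun_prop
  have hpos : ∀ x, 0 < h x := fun x => by have := norm_nonneg x; simp only [hh]; linarith
  have hL : ∀ x y, |h x - h y| ≤ (1 / 2) * ‖x - y‖ := by
    intro x y
    have := abs_norm_sub_norm_le x y
    have h2 : h x - h y = (1 / 2) * (‖x‖ - ‖y‖) := by simp only [hh]; ring
    rw [h2, abs_mul, abs_of_pos (by norm_num : (0 : ℝ) < 1 / 2)]
    gcongr
  set K : ℝ → NNReal := fun b => (2 : NNReal) ^ |b|
  have hK : ∀ b : ℝ, ∀ x y, 0 < h x → ‖y - x‖ ≤ h x → om b x ≤ K b * om b y :=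
    fun b x y _ hxy => om_comp b hxy
  refine ⟨(2 ^ α * (C0 + C0)) * (C1 * K b + C2 * K (b + 1) * N), fun f hf M h0 h1 => ?_⟩
  have hf1 : ContDiff ℝ 1 f := hf.of_le (by simp)
  have hfm : Measurable (fun x => ‖f x‖ₑ) := hf.continuous.enorm.measurable
  have hgm : Measurable (fun x => ‖fderiv ℝ f x‖ₑ) :=
    (hf1.continuous_fderiv one_ne_zero).enorm.measurable
  have hg := wn_fderiv (by simpa using hp : 1 ≤ ENNReal.ofReal p) hf h1
  have e1 := hC1 h hm hL (om b) (om_measurable b) (K b) (hK b) 1 one_pos le_rfl _ hfm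
  have e2 := hC2 h hm hL (om (b + 1)) (om_measurable _) (K (b + 1)) (hK _) _ hgm
  have hind : ∀ F : Euc N → ℝ≥0∞, {x | 0 < h x}.indicator F = F := by
    intro F; ext x; exact Set.indicator_of_mem (show x ∈ {x | 0 < h x} from hpos x) F
  rw [hind] at e1 e2
  have key := eLp_le_add hq1 (2 ^ α * (C0 + C0)) (f := fun x => om (b + α) x * ‖f x‖ₑ)
    (A := fun x => om b x * (ENNReal.ofReal (h x) ^ α *
      ∫⁻ z in ball (0 : Euc N) 1, ‖f (x + (1 * h x) • z)‖ₑ))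
    (B := fun x => om (b + 1) x * (ENNReal.ofReal (h x) ^ α *
      ∫⁻ t in Set.Ioc (0 : ℝ) 1, ∫⁻ z in ball (0 : Euc N) 1, ‖fderiv ℝ f (x + (t * h x) • z)‖ₑ))
    (by have := meas_av hm hfm 1
        have := om_measurable (N := N) b
        fun_prop)
    (by have := meas_av2 hm hgm
        have := om_measurable (N := N) (b + 1)
        fun_prop) ?_
  · refine key.trans ?_
    push_cast
    rw [mul_assoc (_ * _) _ M]
    refine mul_le_mul_right ?_ _
    rw [add_mul]
    refine add_le_add (e1.trans ?_) (e2.trans ?_)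
    · simp only [ENNReal.ofReal_one, ENNReal.one_rpow, mul_one]
      exact mul_le_mul_right h0 _
    · refine (mul_le_mul_right hg _).trans (le_of_eq ?_)
      push_cast; ring
  · intro x
    have hx := norm_nonneg x
    have a1 := pt1 N hC0 hf1 x (hpos x)
    have a2 := pt2 N hC0 f x (h x)
    have a3 : om α x = (2 : ℝ≥0∞) ^ α * ENNReal.ofReal (h x) ^ α := by
      have : ENNReal.ofReal (1 + ‖x‖) = 2 * ENNReal.ofReal (h x) := by
        have h22 : (2 : ℝ≥0∞) = ENNReal.ofReal 2 := by simp
        have h23 : 1 + ‖x‖ = 2 * h x := by simp only [hh]; ring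
        rw [h23, ENNReal.ofReal_mul (by norm_num), ← h22]
      rw [om, this, ENNReal.mul_rpow_of_ne_top (by simp) ofReal_ne_top]
    have a4 : om b x * ENNReal.ofReal (h x) ≤ om (b + 1) x := by
      rw [om_add]
      gcongr
      rw [om, ENNReal.rpow_one]
      exact ENNReal.ofReal_le_ofReal (by simp only [hh]; linarith)
    set I1 := ∫⁻ z in ball (0 : Euc N) 1, ‖f (x + h x • z)‖ₑ
    set I2 := ∫⁻ t in Set.Ioc (0 : ℝ) 1, ∫⁻ z in ball (0 : Euc N) 1, 
      ‖fderiv ℝ f (x + (t * h x) • z)‖ₑ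
    have h2c : ((2 ^ α : NNReal) : ℝ≥0∞) = 2 ^ α := by
      rw [ENNReal.coe_rpow_of_ne_zero (by norm_num)]; norm_num
    simp only [one_mul]
    push_cast
    rw [h2c]
    calc om (b + α) x * ‖f x‖ₑ ≤ om b x * om α x * (C0 * I1 + C0 * (ENNReal.ofReal (h x) * I2)) := by
          rw [om_add]; gcongr; exact a1.trans (by gcongr)
      _ = 2 ^ α * C0 * (om b x * (ENNReal.ofReal (h x) ^ α * I1)) + 
          2 ^ α * C0 * ((om b x * ENNReal.ofReal (h x)) * (ENNReal.ofReal (h x) ^ α * I2)) := by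
          rw [a3]; ring
      _ ≤ 2 ^ α * C0 * (om b x * (ENNReal.ofReal (h x) ^ α * I1)) + 
          2 ^ α * C0 * (om (b + 1) x * (ENNReal.ofReal (h x) ^ α * I2)) := by gcongr
      _ = 2 ^ α * C0 * (om b x * (ENNReal.ofReal (h x) ^ α * I1) +
          om (b + 1) x * (ENNReal.ofReal (h x) ^ α * I2)) := by ring
      _ ≤ _ := by gcongr; simp


theorem fatou_ev {N : ℕ} {q : ℝ≥0∞} (hq : 1 ≤ q) {F : ℕ → Euc N → ℝ≥0∞} {G : Euc N → ℝ≥0∞}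
    (hF : ∀ n, Measurable (F n)) (hG : ∀ x, ∀ᶠ n in atTop, F n x = G x) {M : ℝ≥0∞}
    (hM : ∀ n, eLpNorm (F n) q volume ≤ M) : eLpNorm G q volume ≤ M := by
  by_cases hqt : q = ∞
  · subst hqt
    simp only [eLpNorm_exponent_top] at hM ⊢
    refine eLpNormEssSup_le_of_ae_enorm_bound ?_
    have : ∀ᵐ x ∂(volume : Measure (Euc N)), ∀ n, ‖F n x‖ₑ ≤ M := by
      rw [ae_all_iff]; intro n
      filter_upwards [ae_le_eLpNormEssSup (f := F n) (μ := volume)] with x hx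
      exact hx.trans (hM n)
    filter_upwards [this] with x hx
    obtain ⟨n, hn⟩ := (hG x).exists
    rw [← hn]; exact hx n
  · have hq0 : q ≠ 0 := fun h => by simp [h] at hq
    have hqp : 0 < q.toReal := ENNReal.toReal_pos hq0 hqt
    have key : ∀ H : Euc N → ℝ≥0∞, eLpNorm H q volume ≤ M ↔ ∫⁻ x, H x ^ q.toReal ≤ M ^ q.toReal := by
      intro H
      rw [eLpNorm_eq_lintegral_rpow_enorm_toReal hq0 hqt, one_div, ENNReal.rpow_inv_le_iff hqp]
      simp
    rw [key]
    have e : (fun x => G x ^ q.toReal) = fun x => liminf (fun n => F n x ^ q.toReal) atTop := by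
      ext x
      refine (Tendsto.liminf_eq ?_).symm
      refine tendsto_const_nhds.congr' ?_
      filter_upwards [hG x] with n hn
      rw [hn]
    rw [e]
    refine (lintegral_liminf_le (fun n => (hF n).pow_const _)).trans ?_
    refine liminf_le_of_le ?_ ?_
    · isBoundedDefault
    · intro c hc
      obtain ⟨n, hn⟩ := hc.exists
      exact hn.trans ((key _).1 (hM n))

theorem seq_aux {C : ℝ} (hC : 0 < C) (k : ℕ) : ∀ δ > 0, ∃ K : ℝ, 0 ≤ K ∧ ∀ a : ℕ → ℝ,
    (∀ i, 0 ≤ a i) → (∀ ε, 0 < ε → ε ≤ 1 / 2 → ∀ i, i + 2 ≤ k + 1 → 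
      a (i + 1) ≤ C * (ε⁻¹ * a i + ε * a (i + 2))) → a k ≤ δ * a (k + 1) + K * a 0 := by
  induction k with
  | zero =>
    intro δ hδ
    refine ⟨1, zero_le_one, fun a ha _ => ?_⟩
    have := mul_nonneg hδ.le (ha 1)
    simp only [Nat.zero_add]; linarith
  | succ k ih =>
    intro δ hδ
    set ε := min (1 / 2) (δ / (2 * C)) with hε
    have hε0 : 0 < ε := by positivity
    have hε1 : ε ≤ 1 / 2 := min_le_left _ _
    have hε2 : C * ε ≤ δ / 2 := by
      have := min_le_right (1 / 2) (δ / (2 * C))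
      rw [← hε, le_div_iff₀ (by positivity)] at this
      linarith
    obtain ⟨K, hK, h⟩ := ih (ε / (2 * C)) (by positivity)
    refine ⟨2 * C * ε⁻¹ * K, by positivity, fun a ha hr => ?_⟩
    have h1 := h a ha (fun ε h1 h2 i hi => hr ε h1 h2 i (by omega))
    have h2 := hr ε hε0 hε1 k (by omega)
    have h3 : C * (ε⁻¹ * a k) ≤ C * (ε⁻¹ * (ε / (2 * C) * a (k + 1) + K * a 0)) := by gcongr
    have h4 : C * (ε⁻¹ * (ε / (2 * C) * a (k + 1) + K * a 0)) = 
      a (k + 1) / 2 + C * ε⁻¹ * K * a 0 := by field_simp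
    have h5 : C * ε * a (k + 2) ≤ δ / 2 * a (k + 2) := mul_le_mul_of_nonneg_right hε2 (ha _)
    have h6 : C * (ε⁻¹ * a k + ε * a (k + 2)) = C * (ε⁻¹ * a k) + C * ε * a (k + 2) := by ring
    have h7 : k + 1 + 1 = k + 2 := rfl
    rw [h7]
    nlinarith

theorem seq_main {C : ℝ} (hC : 0 < C) (k : ℕ) : ∃ K : ℝ, 0 ≤ K ∧ ∀ a : ℕ → ℝ,
    (∀ i, 0 ≤ a i) → (∀ ε, 0 < ε → ε ≤ 1 / 2 → ∀ i, i + 2 ≤ k → 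
      a (i + 1) ≤ C * (ε⁻¹ * a i + ε * a (i + 2))) → ∀ i ≤ k, a i ≤ K * (a 0 + a k) := by
  induction k with
  | zero =>
    refine ⟨1, zero_le_one, fun a ha _ i hi => ?_⟩
    have : i = 0 := by omega
    subst this
    linarith [ha 0]
  | succ k ih =>
    obtain ⟨K, hK, h⟩ := ih
    obtain ⟨L, hL, h'⟩ := seq_aux hC k 1 one_pos
    refine ⟨K * (1 + L) + 1, by positivity, fun a ha hr i hi => ?_⟩
    have h1 := h' a ha hr
    have a0 := ha 0
    have a1 := ha (k + 1)
    rcases Nat.lt_or_ge k i with h2 | h2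
    · have : i = k + 1 := by omega
      subst this
      have : 0 ≤ K * (1 + L) := by positivity
      nlinarith
    · have h3 := h a ha (fun ε h1 h2 i hi => hr ε h1 h2 i (by omega)) i h2
      have h4 : K * (a 0 + a k) ≤ K * (a 0 + (1 * a (k + 1) + L * a 0)) := by gcongr
      have : 0 ≤ K * L * a (k + 1) := by positivity
      nlinarith

/-- Truncated distance function. -/
def dR {N : ℕ} (R : ℝ) (x : Euc N) : ℝ := max 0 (min (1 + ‖x‖) (R - ‖x‖))

theorem dR_nonneg {N : ℕ} (R : ℝ) (x : Euc N) : 0 ≤ dR R x := le_max_left _ _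
theorem dR_le {N : ℕ} (R : ℝ) (x : Euc N) : dR R x ≤ 1 + ‖x‖ :=
  max_le (by positivity) (min_le_left _ _)
theorem dR_lip {N : ℕ} (R : ℝ) (x y : Euc N) : |dR R x - dR R y| ≤ ‖x - y‖ := by
  have h := abs_norm_sub_norm_le x y
  unfold dR
  refine (abs_max_sub_max_le_max _ _ _ _).trans ?_
  refine max_le (by simp) ((abs_min_sub_min_le_max _ _ _ _).trans (max_le ?_ ?_))
  · rwa [add_sub_add_left_eq_sub]
  · rw [show R - ‖x‖ - (R - ‖y‖) = -(‖x‖ - ‖y‖) by ring, abs_neg]; exact h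
theorem dR_cont {N : ℕ} (R : ℝ) : Continuous (dR R : Euc N → ℝ) := by
  unfold dR; fun_prop
theorem dR_zero {N : ℕ} {R : ℝ} {x : Euc N} (h : R ≤ ‖x‖) : dR R x = 0 :=
  max_eq_left (min_le_iff.2 (Or.inr (by linarith)))
theorem dR_ev {N : ℕ} (x : Euc N) : ∀ᶠ n : ℕ in atTop, dR (n : ℝ) x = 1 + ‖x‖ := by
  filter_upwards [eventually_ge_atTop ⌈1 + 2 * ‖x‖⌉₊] with n hn
  have h1 : 1 + 2 * ‖x‖ ≤ n := Nat.ceil_le.1 hn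
  unfold dR
  rw [min_eq_left (by linarith), max_eq_right (by positivity)]

/-- Truncated weight. -/
def omR {N : ℕ} (b R : ℝ) (n : ℕ) (x : Euc N) : ℝ≥0∞ := om b x * ENNReal.ofReal (dR R x) ^ n

theorem omR_measurable {N : ℕ} (b R : ℝ) (n : ℕ) : Measurable (omR b R n : Euc N → ℝ≥0∞) := by
  unfold omR
  have := om_measurable (N := N) b
  have := (dR_cont (N := N) R).measurable
  fun_prop

theorem omR_le {N : ℕ} (b R : ℝ) (n : ℕ) (x : Euc N) : omR b R n x ≤ om (b + n) x := by
  rw [omR, om_add]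
  gcongr
  rw [om, ENNReal.rpow_natCast]
  gcongr
  exact dR_le R x

theorem omR_comp {N : ℕ} (b R : ℝ) (n : ℕ) {x y : Euc N} (hxy : ‖y - x‖ ≤ dR R x / 2) :
    omR b R n x ≤ (((2 : NNReal) ^ |b| * 2 ^ n : NNReal) : ℝ≥0∞) * omR b R n y := by
  have h1 := om_comp b (hxy.trans (by have := dR_le R x; linarith))
  have h2 : ENNReal.ofReal (dR R x) ≤ 2 * ENNReal.ofReal (dR R y) := by
    have h22 : (2 : ℝ≥0∞) = ENNReal.ofReal 2 := by simp
    rw [h22, ← ENNReal.ofReal_mul (by norm_num)]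
    apply ENNReal.ofReal_le_ofReal
    have := dR_lip R y x
    rw [abs_le] at this
    linarith
  unfold omR
  calc _ ≤ (((2 : NNReal) ^ |b| : NNReal) * om b y) * (2 * ENNReal.ofReal (dR R y)) ^ n := by gcongr
    _ = _ := by push_cast; rw [mul_pow]; ring

theorem interp_step (N : ℕ) {p : ℝ} (hp : 1 ≤ p) (b : ℝ) (n : ℕ) :
    ∃ C : NNReal, ∀ ε : ℝ, 0 < ε → ε ≤ 1 / 2 → ∀ R : ℝ, ∀ f : Euc N → ℝ, 
      ContDiff ℝ (⊤ : ℕ∞) f → ∀ e : Fin N, ∀ M0 M2 : ℝ≥0∞,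
      eLpNorm (fun x => omR b R n x * ‖f x‖ₑ) (ENNReal.ofReal p) volume ≤ M0 →
      (∀ e', eLpNorm (fun x => omR b R (n + 2) x * ‖pd e' (pd e f) x‖ₑ) 
        (ENNReal.ofReal p) volume ≤ M2) →
      eLpNorm (fun x => omR b R (n + 1) x * ‖pd e f x‖ₑ) (ENNReal.ofReal p) volume ≤ 
        C * (ENNReal.ofReal ε⁻¹ * M0 + ENNReal.ofReal ε * M2) := by
  have hα : (N : ℝ) * (1 / p - 1 / (ENNReal.ofReal p).toReal) = 0 := by
    rw [ENNReal.toReal_ofReal (by linarith)]; simp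
  obtain ⟨C1, hC1⟩ := loc_bound N hp (le_refl (ENNReal.ofReal p))
  obtain ⟨C2, hC2⟩ := loc_int N hp (le_refl (ENNReal.ofReal p)) (by rw [hα]; exact one_pos)
  simp only [hα, ENNReal.rpow_zero, one_mul, neg_zero, mul_one] at hC1 hC2
  obtain ⟨C0, hC0, hC0'⟩ := psi_bound N
  have hq1 : 1 ≤ ENNReal.ofReal p := by simpa using hp
  set K : ℕ → NNReal := fun n => (2 : NNReal) ^ |b| * 2 ^ n with hKd
  refine ⟨C0 * (C1 * K n + C2 * K (n + 2) * N), fun ε hε hε1 R f hf e M0 M2 h0 h2 => ?_⟩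
  set h : Euc N → ℝ := fun x => ε * dR R x with hh
  have hdm : Measurable (dR R : Euc N → ℝ) := (dR_cont R).measurable
  have hm : Measurable h := by fun_prop
  have hL : ∀ x y, |h x - h y| ≤ (1 / 2) * ‖x - y‖ := by
    intro x y
    have := dR_lip R x y
    simp only [hh]
    rw [← mul_sub, abs_mul, abs_of_pos hε]
    gcongr
  have hK : ∀ n, ∀ x y, 0 < h x → ‖y - x‖ ≤ h x → omR b R n x ≤ K n * omR b R n y := by
    intro n x y _ hxy
    refine omR_comp b R n (hxy.trans ?_)
    have := dR_nonneg R x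
    simp only [hh]; nlinarith
  set g := pd e f with hg
  have hgs : ContDiff ℝ (⊤ : ℕ∞) g := pd_contDiff hf
  have hf1 : ContDiff ℝ 1 f := hf.of_le (by simp)
  have hg1 : ContDiff ℝ 1 g := hgs.of_le (by simp)
  have hfm : Measurable (fun x => ‖f x‖ₑ) := hf.continuous.enorm.measurable
  have hgm : Measurable (fun x => ‖fderiv ℝ g x‖ₑ) :=
    (hg1.continuous_fderiv one_ne_zero).enorm.measurable
  have hD : eLpNorm (fun x => omR b R (n + 2) x * ‖fderiv ℝ g x‖ₑ) (ENNReal.ofReal p) volume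
      ≤ (N : NNReal) * M2 := by
    have h1 : eLpNorm (fun x => omR b R (n + 2) x * ‖fderiv ℝ g x‖ₑ) (ENNReal.ofReal p) volume ≤
        eLpNorm (fun x => ∑ e', omR b R (n + 2) x * ‖pd e' g x‖ₑ) (ENNReal.ofReal p) volume := by
      refine eLp_mono fun x => ?_
      rw [← Finset.mul_sum]
      gcongr
      exact fderiv_enorm_le g x
    refine (h1.trans (eLp_sum hq1 _ fun e => (omR_measurable b R _).mul (pd_measurable hgs))).trans ?_
    refine (Finset.sum_le_sum (fun e _ => h2 e)).trans ?_
    simp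
  have e1 := hC1 h hm hL (omR b R n) (omR_measurable b R n) (K n) (hK n) 1 one_pos le_rfl _ hfm
  have e2 := hC2 h hm hL (omR b R (n + 2)) (omR_measurable b R _) (K (n + 2)) (hK _) _ hgm
  simp only [one_mul, ENNReal.ofReal_one, ENNReal.one_rpow, mul_one] at e1
  have hsm : MeasurableSet {x | 0 < h x} := measurableSet_lt measurable_const hm
  have hmA : Measurable (({x | 0 < h x}.indicator (fun x => omR b R n x *
      ∫⁻ z in ball (0 : Euc N) 1, ‖f (x + h x • z)‖ₑ))) := by
    refine Measurable.indicator ?_ hsm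
    have := meas_av hm hfm 1
    simp only [one_mul] at this
    exact (omR_measurable b R n).mul this
  have hmB : Measurable (({x | 0 < h x}.indicator (fun x => omR b R (n + 2) x *
      ∫⁻ t in Set.Ioc (0 : ℝ) 1, ∫⁻ z in ball (0 : Euc N) 1, ‖fderiv ℝ g (x + (t * h x) • z)‖ₑ))) := by
    refine Measurable.indicator ?_ hsm
    exact (omR_measurable b R _).mul (meas_av2 hm hgm)
  have key := eLp_le_add hq1 C0 (f := fun x => omR b R (n + 1) x * ‖g x‖ₑ)
    (A := fun x => ENNReal.ofReal ε⁻¹ * ({x | 0 < h x}.indicator (fun x => omR b R n x *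
      ∫⁻ z in ball (0 : Euc N) 1, ‖f (x + h x • z)‖ₑ)) x)
    (B := fun x => ENNReal.ofReal ε * ({x | 0 < h x}.indicator (fun x => omR b R (n + 2) x *
      ∫⁻ t in Set.Ioc (0 : ℝ) 1, ∫⁻ z in ball (0 : Euc N) 1, ‖fderiv ℝ g (x + (t * h x) • z)‖ₑ)) x)
    (hmA.const_mul _) (hmB.const_mul _) ?_
  · refine key.trans ?_
    push_cast
    rw [mul_assoc (C0 : ℝ≥0∞)]
    refine mul_le_mul_right ?_ _
    calc _ ≤ ENNReal.ofReal ε⁻¹ * (C1 * K n * M0) + ENNReal.ofReal ε * (C2 * K (n + 2) * (N * M2)) := by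
          refine add_le_add ?_ ?_
          · refine (eLp_le_mul (ε⁻¹).toNNReal (A := ({x | 0 < h x}.indicator (fun x => omR b R n x *
              ∫⁻ z in ball (0 : Euc N) 1, ‖f (x + h x • z)‖ₑ))) (fun x => le_rfl)).trans ?_
            exact mul_le_mul_right (e1.trans (mul_le_mul_right h0 _)) _
          · refine (eLp_le_mul ε.toNNReal (A := ({x | 0 < h x}.indicator (fun x => omR b R (n + 2) x *
              ∫⁻ t in Set.Ioc (0 : ℝ) 1, ∫⁻ z in ball (0 : Euc N) 1, 
                ‖fderiv ℝ g (x + (t * h x) • z)‖ₑ))) (fun x => le_rfl)).trans ?_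
            exact mul_le_mul_right (e2.trans (mul_le_mul_right hD _)) _
      _ = C1 * K n * (ENNReal.ofReal ε⁻¹ * M0) + C2 * K (n + 2) * N * (ENNReal.ofReal ε * M2) := by ring
      _ ≤ (C1 * K n + C2 * K (n + 2) * N) * (ENNReal.ofReal ε⁻¹ * M0) + 
          (C1 * K n + C2 * K (n + 2) * N) * (ENNReal.ofReal ε * M2) := by
          gcongr
          · exact le_self_add
          · exact le_add_self
      _ = _ := by ring
  · intro x
    rcases (dR_nonneg R x).eq_or_lt with hd | hd
    · have : omR b R (n + 1) x = 0 := by simp [omR, ← hd]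
      rw [this, zero_mul]; exact zero_le
    · have hpos : 0 < h x := by simp only [hh]; positivity
      have hx : x ∈ {x | 0 < h x} := hpos
      rw [Set.indicator_of_mem hx, Set.indicator_of_mem hx]
      have a1 := pt1 N hC0 hg1 x hpos
      have a2 := pt3 N hC0' hf1 e x hpos
      set I1 := ∫⁻ z in ball (0 : Euc N) 1, ‖f (x + h x • z)‖ₑ
      set I2 := ∫⁻ t in Set.Ioc (0 : ℝ) 1, ∫⁻ z in ball (0 : Euc N) 1, 
        ‖fderiv ℝ g (x + (t * h x) • z)‖ₑ
      have b1 : omR b R (n + 1) x * ENNReal.ofReal (h x)⁻¹ = ENNReal.ofReal ε⁻¹ * omR b R n x := by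
        simp only [omR, hh, mul_inv]
        rw [ENNReal.ofReal_mul (by positivity), pow_succ]
        have : ENNReal.ofReal (dR R x) * ENNReal.ofReal (dR R x)⁻¹ = 1 := by
          rw [← ENNReal.ofReal_mul hd.le, mul_inv_cancel₀ hd.ne']; simp
        calc _ = om b x * ENNReal.ofReal (dR R x) ^ n * ENNReal.ofReal ε⁻¹ * 
              (ENNReal.ofReal (dR R x) * ENNReal.ofReal (dR R x)⁻¹) := by ring
          _ = _ := by rw [this]; ring
      have b2 : omR b R (n + 1) x * ENNReal.ofReal (h x) = ENNReal.ofReal ε * omR b R (n + 2) x := by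
        simp only [omR, hh]
        rw [ENNReal.ofReal_mul (by positivity)]
        ring
      calc omR b R (n + 1) x * ‖g x‖ₑ ≤ omR b R (n + 1) x * (C0 * (ENNReal.ofReal (h x)⁻¹ * I1) +
            C0 * (ENNReal.ofReal (h x) * I2)) := by gcongr; exact a1.trans (by gcongr)
        _ = C0 * ((omR b R (n + 1) x * ENNReal.ofReal (h x)⁻¹) * I1 + 
            (omR b R (n + 1) x * ENNReal.ofReal (h x)) * I2) := by ring
        _ = _ := by rw [b1, b2]; ring


theorem pderivList_snoc {N : ℕ} (l : List (Fin N)) (e : Fin N) (f : Euc N → ℝ) :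
    pderivList (l ++ [e]) f = pd e (pderivList l f) := by
  induction l generalizing f with
  | nil => rfl
  | cons a l ih => simp only [List.cons_append, pderivList]; exact ih _

theorem pderivList_contDiff {N : ℕ} (l : List (Fin N)) {f : Euc N → ℝ}
    (hf : ContDiff ℝ (⊤ : ℕ∞) f) : ContDiff ℝ (⊤ : ℕ∞) (pderivList l f) := by
  induction l generalizing f with
  | nil => exact hf
  | cons a l ih => exact ih (pd_contDiff hf)

theorem exists_snoc {α : Type*} {n : ℕ} (l : List α) (h : l.length = n + 1) :
    ∃ l' e, l = l' ++ [e] ∧ l'.length = n := by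
  have hne : l ≠ [] := by rintro rfl; simp at h
  exact ⟨l.dropLast, l.getLast hne, (List.dropLast_append_getLast hne).symm, by simp [h]⟩

theorem omR_fin {N : ℕ} {p : ℝ≥0∞} (b R : ℝ) {n : ℕ} (hn : n ≠ 0) {F : Euc N → ℝ}
    (hF : Continuous F) : eLpNorm (fun x => omR b R n x * ‖F x‖ₑ) p volume ≠ ∞ := by
  have hc : Continuous (fun x : Euc N => (1 + ‖x‖) ^ b * dR R x ^ n * F x) := by
    have := dR_cont (N := N) R
    have h2 : Continuous (fun x : Euc N => (1 + ‖x‖) ^ b) :=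
      (by fun_prop : Continuous (fun x : Euc N => (1 + ‖x‖))).rpow_const
        (fun x => Or.inl (by have := norm_nonneg x; linarith))
    fun_prop
  have hs : HasCompactSupport (fun x : Euc N => (1 + ‖x‖) ^ b * dR R x ^ n * F x) := by
    refine HasCompactSupport.intro (isCompact_closedBall 0 R) fun x hx => ?_
    have : R ≤ ‖x‖ := by
      have := hx; simp at this; exact this.le
    simp [dR_zero this, hn]
  have h := (hc.memLp_of_hasCompactSupport (p := p) (μ := volume) hs).2.ne
  rw [← eLpNorm_enorm] at h
  convert h using 3 with x
  rw [enorm_mul, enorm_mul, enorm_pow, Real.enorm_of_nonneg (dR_nonneg R x), omR, om_eq,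
    Real.enorm_of_nonneg (by positivity : 0 ≤ (1 + ‖x‖) ^ b)]

theorem interp (N : ℕ) {p : ℝ} (hp : 1 ≤ p) (b : ℝ) (k : ℕ) :
    ∃ C : NNReal, ∀ u : Euc N → ℝ, ContDiff ℝ (⊤ : ℕ∞) u → ∀ M : ℝ≥0∞, M ≠ ∞ →
      wn b (ENNReal.ofReal p) (fun x => ‖u x‖ₑ) ≤ M →
      (∀ l : List (Fin N), l.length = k →
        wn (b + k) (ENNReal.ofReal p) (fun x => ‖pderivList l u x‖ₑ) ≤ M) →
      ∀ i ≤ k, ∀ l : List (Fin N), l.length = i →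
        wn (b + i) (ENNReal.ofReal p) (fun x => ‖pderivList l u x‖ₑ) ≤ C * M := by
  choose c hc using fun n => interp_step N hp b n
  set C : ℝ := ∑ n ∈ Finset.range k, (c n : ℝ) * N ^ (n + 1) + 1 with hCd
  have hC : 0 < C := by positivity
  have hcC : ∀ n < k, (c n : ℝ) * N ^ (n + 1) ≤ C := by
    intro n hn
    have := Finset.single_le_sum (f := fun n => (c n : ℝ) * (N : ℝ) ^ (n + 1))
      (fun i _ => by positivity) (Finset.mem_range.2 hn)
    linarith
  obtain ⟨K, hK, hseq⟩ := seq_main hC k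
  refine ⟨(K * (1 + N ^ k)).toNNReal, fun u hu M hM h0 hk i hi l hl => ?_⟩
  have hq1 : 1 ≤ ENNReal.ofReal p := by simpa using hp
  refine fatou_ev hq1 (F := fun n x => omR b (n : ℝ) i x * ‖pderivList l u x‖ₑ)
    (fun n => (omR_measurable b _ i).mul (pderivList_contDiff l hu).continuous.enorm.measurable)
    (fun x => ?_) (fun n => ?_)
  · filter_upwards [dR_ev x] with n hn
    rw [omR, hn, om_add, om, om, ENNReal.rpow_natCast]
  · set R : ℝ := (n : ℝ)
    set A : ℕ → List (Fin N) → ℝ≥0∞ := fun i l =>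
      eLpNorm (fun x => omR b R i x * ‖pderivList l u x‖ₑ) (ENNReal.ofReal p) volume with hA
    set a' : ℕ → ℝ≥0∞ := fun i => ∑ m : Fin i → Fin N, A i (List.ofFn m) with ha'
    have hAle : ∀ i l, l.length = i → A i l ≤ a' i := by
      rintro i l rfl
      have := Finset.single_le_sum (f := fun m : Fin l.length → Fin N => A l.length (List.ofFn m))
        (fun _ _ => zero_le) (Finset.mem_univ l.get)
      simpa using this
    have hA0 : A 0 [] ≤ M := by
      refine le_trans (eLp_mono fun x => ?_) h0
      simp [omR, pderivList]
    have hAfin : ∀ i l, l.length = i → A i l ≠ ∞ := by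
      intro i l hl
      rcases Nat.eq_zero_or_pos i with rfl | hi
      · rw [List.length_eq_zero_iff.1 hl]
        exact ne_top_of_le_ne_top hM hA0
      · exact omR_fin b R hi.ne' (pderivList_contDiff l hu).continuous
    have hafin : ∀ i, a' i ≠ ∞ := fun i => ENNReal.sum_ne_top.2 fun m _ => hAfin i _ (by simp)
    have ha0 : a' 0 ≤ M := by
      simp only [ha', Finset.univ_unique, Finset.sum_singleton, List.ofFn_zero]
      exact hA0
    have hak : a' k ≤ (N ^ k : NNReal) * M := by
      refine (Finset.sum_le_sum fun m _ => 
        (?_ : A k (List.ofFn m) ≤ M)).trans (le_of_eq ?_)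
      · refine le_trans (eLp_mono fun x => ?_) (hk (List.ofFn m) (by simp))
        gcongr
        exact omR_le b R k x
      · simp
    have hstep : ∀ ε : ℝ, 0 < ε → ε ≤ 1 / 2 → ∀ i, i + 2 ≤ k → 
        (a' (i + 1)).toReal ≤ C * (ε⁻¹ * (a' i).toReal + ε * (a' (i + 2)).toReal) := by
      intro ε h1 h2 i hi
      have e1 : a' (i + 1) ≤ (N ^ (i + 1) : NNReal) * 
          (c i * (ENNReal.ofReal ε⁻¹ * a' i + ENNReal.ofReal ε * a' (i + 2))) := by
        refine (Finset.sum_le_sum fun m _ => (?_ : A (i + 1) (List.ofFn m) ≤ 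
          c i * (ENNReal.ofReal ε⁻¹ * a' i + ENNReal.ofReal ε * a' (i + 2)))).trans (le_of_eq ?_)
        · obtain ⟨l', e, hl', hlen⟩ := exists_snoc (List.ofFn m) (by simp : _ = i + 1)
          rw [hl']
          simp only [hA, pderivList_snoc]
          refine hc i ε h1 h2 R _ (pderivList_contDiff l' hu) e _ _ (hAle i l' hlen) fun e' => ?_
          rw [← pderivList_snoc, ← pderivList_snoc]
          exact hAle (i + 2) _ (by simp [hlen])
        · simp
      have e2 := ENNReal.toReal_mono (by
        refine mul_ne_top coe_ne_top (mul_ne_top coe_ne_top (add_ne_top.2 ⟨?_, ?_⟩))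
        · exact mul_ne_top ofReal_ne_top (hafin _)
        · exact mul_ne_top ofReal_ne_top (hafin _)) e1
      refine e2.trans ?_
      rw [ENNReal.toReal_mul, ENNReal.toReal_mul, ENNReal.toReal_add
        (mul_ne_top ofReal_ne_top (hafin _)) (mul_ne_top ofReal_ne_top (hafin _)), 
        ENNReal.toReal_mul, ENNReal.toReal_mul, ENNReal.toReal_ofReal (by positivity),
        ENNReal.toReal_ofReal (by positivity)]
      have := hcC i (by omega)
      simp only [coe_toReal, NNReal.coe_pow, NNReal.coe_natCast]
      rw [← mul_assoc, mul_comm ((N : ℝ) ^ _)]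
      gcongr
    have hfin := hseq (fun i => (a' i).toReal) (fun _ => toReal_nonneg) hstep i hi
    refine (hAle i l hl).trans ?_
    rw [← ENNReal.ofReal_toReal (hafin i)]
    refine (ENNReal.ofReal_le_ofReal hfin).trans ?_
    rw [ENNReal.ofReal_mul hK, ENNReal.ofReal_add toReal_nonneg toReal_nonneg, 
      ENNReal.ofReal_toReal (hafin _), ENNReal.ofReal_toReal (hafin _)]
    calc ENNReal.ofReal K * (a' 0 + a' k) ≤ ENNReal.ofReal K * (M + (N ^ k : NNReal) * M) := by gcongr
      _ = ENNReal.ofReal K * (1 + (N ^ k : NNReal)) * M := by ring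
      _ = _ := by
        congr 1
        change _ = ENNReal.ofReal (K * (1 + N ^ k))
        rw [ENNReal.ofReal_mul hK, ENNReal.ofReal_add zero_le_one (by positivity)]
        congr 2
        · simp
        · rw [← ENNReal.ofReal_coe_nnreal]; simp


theorem scale_norm {N : ℕ} {p : ℝ} (hp : 1 ≤ p) {c : ℝ} (hc : 0 < c) (H : Euc N → ℝ≥0∞) :
    eLpNorm (fun x => H (c • x)) (ENNReal.ofReal p) volume =
      ENNReal.ofReal (c ^ (-(N / p : ℝ))) * eLpNorm H (ENNReal.ofReal p) volume := by
  have hp0 : 0 < p := by linarith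
  have hme : MeasurableEmbedding (fun z : Euc N => c • z) := 
      (Homeomorph.smulOfNeZero c hc.ne').measurableEmbedding
  have hmap : Measure.map (fun z : Euc N => c • z) volume
      = ENNReal.ofReal ((c ^ N)⁻¹) • (volume : Measure (Euc N)) := by
    rw [Measure.map_addHaar_smul _ hc.ne']
    simp [abs_of_pos hc]
  have e0 : ENNReal.ofReal p ≠ 0 := by simpa using hp0
  rw [eLpNorm_eq_lintegral_rpow_enorm_toReal e0 ofReal_ne_top,
    eLpNorm_eq_lintegral_rpow_enorm_toReal e0 ofReal_ne_top, ENNReal.toReal_ofReal hp0.le]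
  simp only [enorm_eq_self]
  have h1 : ∫⁻ x : Euc N, H (c • x) ^ p = ENNReal.ofReal ((c ^ N)⁻¹) * ∫⁻ x, H x ^ p := by
    rw [← hme.lintegral_map (fun x => H x ^ p), hmap, lintegral_smul_measure, smul_eq_mul]
  rw [h1, ENNReal.mul_rpow_of_nonneg _ _ (by positivity), 
    ENNReal.ofReal_rpow_of_pos (by positivity)]
  congr 2
  rw [← Real.rpow_natCast, ← Real.rpow_neg hc.le, ← Real.rpow_mul hc.le]
  congr 1
  field_simp

theorem om_scale {N : ℕ} (b : ℝ) {c : ℝ} (hc : 1 ≤ c) (x : Euc N) :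
    om b x ≤ ENNReal.ofReal (c ^ (max 0 (-b))) * om b (c • x) := by
  have hx := norm_nonneg x
  have hc0 : 0 < c := by linarith
  have hcx : ‖c • x‖ = c * ‖x‖ := by rw [norm_smul, Real.norm_of_nonneg hc0.le]
  rw [om_eq, om_eq, ← ENNReal.ofReal_mul (by positivity), hcx]
  apply ENNReal.ofReal_le_ofReal
  have h1 : ‖x‖ ≤ c * ‖x‖ := le_mul_of_one_le_left hx hc
  rcases le_total 0 b with hb | hb
  · rw [max_eq_left (by linarith), Real.rpow_zero, one_mul]
    exact Real.rpow_le_rpow (by positivity) (by linarith) hb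
  · rw [max_eq_right (by linarith)]
    have : (1 + ‖x‖) ^ b ≤ ((1 + c * ‖x‖) / c) ^ b := by
      refine Real.rpow_le_rpow_of_nonpos (by positivity) ?_ hb
      rw [div_le_iff₀ hc0]; nlinarith
    refine this.trans (le_of_eq ?_)
    rw [Real.div_rpow (by positivity) hc0.le, Real.rpow_neg hc0.le]
    field_simp

theorem wn_scale {N : ℕ} {p : ℝ} (hp : 1 ≤ p) (b : ℝ) {c : ℝ} (hc : 1 ≤ c) (F : Euc N → ℝ≥0∞) :
    wn b (ENNReal.ofReal p) (fun x => F (c • x)) ≤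
      ENNReal.ofReal (c ^ (max 0 (-b) - N / p)) * wn b (ENNReal.ofReal p) F := by
  have hc0 : 0 < c := by linarith
  have h1 := eLp_le_mul (q := ENNReal.ofReal p) (c ^ (max 0 (-b))).toNNReal 
    (f := fun x => om b x * F (c • x)) (A := fun x => (fun y => om b y * F y) (c • x)) (fun x => by
      rw [← mul_assoc]
      exact mul_le_mul_left (om_scale b hc x) _)
  refine h1.trans (le_of_eq ?_)
  rw [scale_norm hp hc0 (fun y => om b y * F y), ← mul_assoc]
  congr 1
  change ENNReal.ofReal _ * _ = _
  rw [← ENNReal.ofReal_mul (by positivity), ← Real.rpow_add hc0]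
  rfl

theorem hardy {N : ℕ} (hN : 1 ≤ N) {p : ℝ} (hp : 1 ≤ p) {b : ℝ} (hb : 0 < b + N / p) :
    ∃ C : NNReal, ∀ f : Euc N → ℝ, ContDiff ℝ (⊤ : ℕ∞) f → ∀ M : ℝ≥0∞,
      wn b (ENNReal.ofReal p) (fun x => ‖f x‖ₑ) ≠ ∞ →
      (∀ e, wn (b + 1) (ENNReal.ofReal p) (fun x => ‖pd e f x‖ₑ) ≤ M) →
      wn b (ENNReal.ofReal p) (fun x => ‖f x‖ₑ) ≤ C * M := by
  have hp0 : 0 < p := by linarith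
  have hq1 : 1 ≤ ENNReal.ofReal p := by simpa using hp
  have hN0 : (0 : ℝ) < N := by exact_mod_cast hN
  set δ : ℝ := N / p - max 0 (-b) with hδ
  have hδ0 : 0 < δ := by
    have : 0 < N / p := by positivity
    rw [hδ, sub_pos, max_lt_iff]
    exact ⟨this, by linarith⟩
  set T : ℝ := 2 ^ (1 / δ) with hT
  have hT1 : 1 ≤ T := Real.one_le_rpow (by norm_num) (by positivity)
  have hT0 : 0 < T := by linarith
  have hTδ : T ^ (max 0 (-b) - N / p) = 1 / 2 := by
    rw [show max 0 (-b) - N / p = -δ by rw [hδ]; ring, hT, ← Real.rpow_mul (by norm_num)]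
    rw [show 1 / δ * -δ = -1 by field_simp, Real.rpow_neg_one]; norm_num
  set L : NNReal := (T * T ^ (max 0 (-(b + 1)))).toNNReal with hL
  refine ⟨2 * (L * N), fun f hf M hX h1 => ?_⟩
  have hf1 : ContDiff ℝ 1 f := hf.of_le (by simp)
  have hfd := hf1.continuous_fderiv one_ne_zero
  have hg := wn_fderiv hq1 hf h1
  set X := wn b (ENNReal.ofReal p) (fun x => ‖f x‖ₑ) with hXd
  set φ : ℝ → Euc N → ℝ≥0∞ := fun t x => 
    om b x * ‖fderiv ℝ f (x + t • ((T - 1) • x)) ((T - 1) • x)‖ₑ with hφ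
  have hφm : Measurable (Function.uncurry φ) := by
    have h2 : Measurable (fun y : ℝ × Euc N => om b y.2) := (om_measurable b).comp measurable_snd
    have h3 : Continuous (fun y : ℝ × Euc N => 
      ‖fderiv ℝ f (y.2 + y.1 • ((T - 1) • y.2)) ((T - 1) • y.2)‖ₑ) := by
      apply Continuous.enorm; fun_prop
    exact h2.mul h3.measurable
  have hbd : ∀ᵐ t ∂(volume.restrict (Set.Ioc (0 : ℝ) 1)), 
      eLpNorm (φ t) (ENNReal.ofReal p) volume ≤ L * (N * M) := by
    refine (ae_restrict_iff' measurableSet_Ioc).2 (Eventually.of_forall fun t ht => ?_)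
    set c : ℝ := 1 + t * (T - 1) with hc
    have hc1 : 1 ≤ c := by nlinarith [ht.1]
    have hcT : c ≤ T := by nlinarith [ht.2]
    have e1 : eLpNorm (φ t) (ENNReal.ofReal p) volume ≤ T.toNNReal * 
        wn (b + 1) (ENNReal.ofReal p) (fun x => (fun y => ‖fderiv ℝ f y‖ₑ) (c • x)) := by
      refine eLp_le_mul T.toNNReal fun x => ?_
      have hx := norm_nonneg x
      have e2 : x + t • ((T - 1) • x) = c • x := by
        rw [smul_smul, hc, add_smul, one_smul]
      simp only [hφ, e2]
      calc om b x * ‖fderiv ℝ f (c • x) ((T - 1) • x)‖ₑ 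
          ≤ om b x * (‖fderiv ℝ f (c • x)‖ₑ * ‖(T - 1) • x‖ₑ) := by
            gcongr; exact ContinuousLinearMap.le_opENorm _ _
        _ ≤ om b x * (‖fderiv ℝ f (c • x)‖ₑ * (T.toNNReal * om 1 x)) := by
            gcongr
            rw [om, ENNReal.rpow_one]
            change _ ≤ ENNReal.ofReal T * _
            rw [← ENNReal.ofReal_mul hT0.le, ← ofReal_norm]
            apply ENNReal.ofReal_le_ofReal
            rw [norm_smul, Real.norm_of_nonneg (by linarith)]
            nlinarith
        _ = _ := by rw [om_add]; ring
    refine e1.trans ?_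
    have e3 := wn_scale hp (b + 1) hc1 (fun y => ‖fderiv ℝ f y‖ₑ)
    refine (mul_le_mul_right e3 _).trans ?_
    rw [← mul_assoc]
    refine mul_le_mul' ?_ (by simpa using hg)
    change ENNReal.ofReal T * _ ≤ ENNReal.ofReal _
    rw [← ENNReal.ofReal_mul hT0.le]
    apply ENNReal.ofReal_le_ofReal
    gcongr
    calc c ^ (max 0 (-(b + 1)) - N / p) ≤ c ^ (max 0 (-(b + 1))) :=
          Real.rpow_le_rpow_of_exponent_le hc1 (by have : 0 ≤ N / p := by positivity
                                                   linarith)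
      _ ≤ _ := Real.rpow_le_rpow (by linarith) hcT (le_max_left _ _)
  have hmk := minkowski_lint (ν := volume.restrict (Set.Ioc (0 : ℝ) 1)) 
    (μ := (volume : Measure (Euc N))) hφm hq1 hbd
  have hν : (volume.restrict (Set.Ioc (0 : ℝ) 1)) Set.univ = 1 := by simp
  rw [hν, one_mul] at hmk
  have hmain : X ≤ X / 2 + L * (N * M) := by
    have hmeasf : Measurable (fun x : Euc N => om b x * ‖f (T • x)‖ₑ) := by
      have := om_measurable (N := N) b
      have h3 : Measurable (fun x : Euc N => ‖f (T • x)‖ₑ) := by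
        have hfc := hf.continuous
        have : Continuous (fun x : Euc N => ‖f (T • x)‖ₑ) := by apply Continuous.enorm; fun_prop
        exact this.measurable
      fun_prop
    have h3 := eLp_le_add hq1 1 (f := fun x : Euc N => om b x * ‖f x‖ₑ)
      (A := fun x => om b x * ‖f (T • x)‖ₑ) 
      (B := fun x => ∫⁻ t in Set.Ioc (0 : ℝ) 1, φ t x) hmeasf hφm.lintegral_prod_left' ?_
    · rw [coe_one, one_mul] at h3
      refine h3.trans (add_le_add ?_ hmk)
      refine (wn_scale hp b hT1 (fun y => ‖f y‖ₑ)).trans (le_of_eq ?_)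
      rw [hTδ, ← hXd, mul_comm, div_eq_mul_inv]
      congr 1
      rw [one_mul, ENNReal.ofReal_inv_of_pos (by norm_num)]; simp
    · intro x
      rw [coe_one, one_mul]
      have h4 := ftc_enorm hf1 x ((T - 1) • x)
      have e2 : x + (T - 1) • x = T • x := by rw [sub_smul, one_smul]; abel
      rw [e2] at h4
      have h5 : ‖f x‖ₑ ≤ ‖f (T • x)‖ₑ + ‖f (T • x) - f x‖ₑ := by
        have : f x = f (T • x) - (f (T • x) - f x) := by ring
        conv_lhs => rw [this]
        exact enorm_sub_le
      simp only [hφ]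
      rw [lintegral_const_mul' _ _ (om_ne_top b x), ← mul_add]
      gcongr
      exact h5.trans (by gcongr)
  have h2 : X / 2 ≤ L * (N * M) := by
    have h3 : X / 2 + X / 2 ≤ X / 2 + L * (N * M) := by rwa [ENNReal.add_halves]
    exact (ENNReal.add_le_add_iff_left (ENNReal.div_ne_top hX (by simp))).1 h3
  have h4 : X = 2 * (X / 2) := by
    rw [ENNReal.mul_div_cancel (by simp) (by simp)]
  rw [h4]
  refine (mul_le_mul_right h2 _).trans (le_of_eq ?_)
  push_cast; ring


theorem rp_cmp {X Y : ℝ} (hX : 0 < X) (hY : 0 < Y) (h1 : X ≤ 2 * Y) (h2 : Y ≤ 2 * X) (c : ℝ) :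
    X ^ c ≤ 2 ^ |c| * Y ^ c := by
  rcases le_total 0 c with hb | hb
  · rw [abs_of_nonneg hb, ← Real.mul_rpow (by norm_num) (by positivity)]
    exact Real.rpow_le_rpow (by positivity) (by linarith) hb
  · rw [abs_of_nonpos hb]
    have : X ^ c ≤ (Y / 2) ^ c :=
      Real.rpow_le_rpow_of_nonpos (by positivity) (by linarith) hb
    refine this.trans (le_of_eq ?_)
    rw [Real.div_rpow (by positivity) (by norm_num), Real.rpow_neg (by norm_num)]
    field_simp

/-- Smooth version of the weight. -/
def gb {N : ℕ} (c : ℝ) (x : Euc N) : ℝ := (1 + ‖x‖ ^ 2) ^ (c / 2)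

theorem gb_pos {N : ℕ} (c : ℝ) (x : Euc N) : 0 < gb c x := by unfold gb; positivity

theorem sq_rp {N : ℕ} (c : ℝ) (x : Euc N) : ((1 + ‖x‖) ^ 2) ^ (c / 2) = (1 + ‖x‖) ^ c := by
  rw [← Real.rpow_natCast, ← Real.rpow_mul (by positivity)]
  congr 1; push_cast; ring

theorem gb_le {N : ℕ} (c : ℝ) (x : Euc N) : gb c x ≤ 2 ^ |c / 2| * (1 + ‖x‖) ^ c := by
  rw [← sq_rp]
  have := norm_nonneg x
  exact rp_cmp (by positivity) (by positivity) (by nlinarith) (by nlinarith [sq_nonneg (1 - ‖x‖)]) _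

theorem le_gb {N : ℕ} (c : ℝ) (x : Euc N) : (1 + ‖x‖) ^ c ≤ 2 ^ |c / 2| * gb c x := by
  rw [← sq_rp]
  have := norm_nonneg x
  exact rp_cmp (by positivity) (by positivity) (by nlinarith [sq_nonneg (1 - ‖x‖)]) (by nlinarith) _

theorem gb_contDiff {N : ℕ} (c : ℝ) : ContDiff ℝ (⊤ : ℕ∞) (gb c : Euc N → ℝ) := by
  unfold gb
  refine ContDiff.rpow_const_of_ne (contDiff_const.add (contDiff_norm_sq ℝ)) fun x => ?_
  positivity

theorem gb_fderiv {N : ℕ} (c : ℝ) (x : Euc N) : ‖fderiv ℝ (gb c) x‖ ≤ |c| * gb (c - 1) x := by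
  have h1 : HasFDerivAt (fun x : Euc N => 1 + ‖x‖ ^ 2) (2 • innerSL ℝ x) x := by
    have := (hasStrictFDerivAt_norm_sq x).hasFDerivAt
    exact this.const_add 1
  have h2 := h1.rpow_const (p := c / 2) (Or.inl (by positivity))
  have h3 : fderiv ℝ (gb c) x = _ := h2.fderiv
  rw [h3, norm_smul, ← Nat.cast_smul_eq_nsmul ℝ, norm_smul, innerSL_apply_norm]
  have hp : 0 < (1 + ‖x‖ ^ 2) := by positivity
  have h4 : ‖x‖ ≤ (1 + ‖x‖ ^ 2) ^ ((1:ℝ) / 2) := by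
    rw [← Real.sqrt_eq_rpow]
    apply Real.le_sqrt_of_sq_le; linarith
  have h5 : gb (c - 1) x = (1 + ‖x‖ ^ 2) ^ (c / 2 - 1) * (1 + ‖x‖ ^ 2) ^ ((1:ℝ) / 2) := by
    rw [gb, ← Real.rpow_add hp]; congr 1; ring
  rw [h5, norm_mul, Real.norm_eq_abs (c / 2), Real.norm_of_nonneg (by positivity : 0 ≤ (1 + ‖x‖ ^ 2) ^ (c / 2 - 1)), abs_div, abs_two]
  simp only [Nat.cast_ofNat, Real.norm_ofNat]
  calc _ = |c| * ((1 + ‖x‖ ^ 2) ^ (c / 2 - 1) * ‖x‖) := by ring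
    _ ≤ _ := by gcongr

theorem cutoff (N : ℕ) : ∃ (χ : ℕ → Euc N → ℝ) (K : ℝ), 0 ≤ K ∧ (∀ n, ContDiff ℝ (⊤ : ℕ∞) (χ n)) ∧
    (∀ n, HasCompactSupport (χ n)) ∧ (∀ n x, |χ n x| ≤ 1) ∧
    (∀ n x, ‖fderiv ℝ (χ n) x‖ ≤ K * (1 + ‖x‖)⁻¹) ∧ (∀ x, ∀ᶠ n in atTop, χ n x = 1) := by
  let B : ContDiffBump (0 : Euc N) := ⟨1, 2, by norm_num, by norm_num⟩
  have hBc : ContDiff ℝ (⊤ : ℕ∞) B := B.contDiff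
  obtain ⟨K, hK⟩ : ∃ K, ∀ x, ‖fderiv ℝ B x‖ ≤ K := by
    refine (B.hasCompactSupport.fderiv ℝ).exists_bound_of_continuous ?_
    exact hBc.continuous_fderiv (by simp)
  have hK0 : 0 ≤ K := (norm_nonneg _).trans (hK 0)
  have hR : ∀ n : ℕ, (0:ℝ) < n + 1 := fun n => by positivity
  refine ⟨fun n x => B (((n:ℝ) + 1)⁻¹ • x), 3 * K, by positivity, fun n => ?_, fun n => ?_, fun n x => ?_, fun n x => ?_, fun x => ?_⟩
  · exact hBc.comp (contDiff_const_smul _)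
  · exact B.hasCompactSupport.comp_smul (inv_ne_zero (hR n).ne')
  · rw [abs_of_nonneg B.nonneg]; exact B.le_one
  · have h1 : fderiv ℝ (fun x => B (((n:ℝ) + 1)⁻¹ • x)) x = ((n:ℝ) + 1)⁻¹ • fderiv ℝ B (((n:ℝ) + 1)⁻¹ • x) := by
      have hd : HasFDerivAt B (fderiv ℝ B (((n:ℝ) + 1)⁻¹ • x)) (((n:ℝ) + 1)⁻¹ • x) :=
        (hBc.differentiable (by simp) _).hasFDerivAt
      have := hd.comp x ((hasFDerivAt_id x).const_smul (((n:ℝ) + 1)⁻¹))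
      have h2 : fderiv ℝ (fun x => B (((n:ℝ) + 1)⁻¹ • x)) x = _ := this.fderiv
      rw [h2]
      ext v; simp
    rw [h1, norm_smul, Real.norm_of_nonneg (by positivity)]
    by_cases hx : ‖x‖ ≤ 2 * ((n:ℝ) + 1)
    · rw [← div_eq_mul_inv, le_div_iff₀ (by positivity)]
      have h3 : ((n:ℝ) + 1)⁻¹ * (1 + ‖x‖) ≤ 3 := by
        rw [inv_mul_le_iff₀ (hR n)]; nlinarith [(Nat.cast_nonneg n : (0:ℝ) ≤ n)]
      calc _ = (((n:ℝ) + 1)⁻¹ * (1 + ‖x‖)) * ‖fderiv ℝ B (((n:ℝ) + 1)⁻¹ • x)‖ := by ring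
        _ ≤ 3 * K := by gcongr; exact hK _
    · have : fderiv ℝ B (((n:ℝ) + 1)⁻¹ • x) = 0 := by
        by_contra hne
        have h4 := support_fderiv_subset ℝ (f := B) (Function.mem_support.2 hne)
        rw [B.tsupport_eq, mem_closedBall_zero_iff, norm_smul, Real.norm_of_nonneg (by have := hR n; positivity),
          inv_mul_le_iff₀ (hR n)] at h4
        apply hx
        calc ‖x‖ ≤ _ := h4
          _ = _ := mul_comm _ _
      rw [this, norm_zero, mul_zero]; positivity
  · filter_upwards [eventually_ge_atTop ⌈‖x‖⌉₊] with n hn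
    apply B.one_of_mem_closedBall
    rw [mem_closedBall_zero_iff, norm_smul, Real.norm_of_nonneg (by have := hR n; positivity), inv_mul_le_iff₀ (hR n)]
    have : ‖x‖ ≤ n := (Nat.le_ceil _).trans (by exact_mod_cast hn)
    change _ ≤ (_:ℝ) * 1
    linarith

theorem emb_crit_abs (N : ℕ) {P q : ℝ≥0∞} (hP : 1 ≤ P) (hq : 1 ≤ q) {S : NNReal}
    (hS : ∀ F : Euc N → ℝ, ContDiff ℝ 1 F → HasCompactSupport F →
      eLpNorm F q volume ≤ S * eLpNorm (fderiv ℝ F) P volume) (b : ℝ) :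
    ∃ C : NNReal, ∀ f : Euc N → ℝ, ContDiff ℝ (⊤ : ℕ∞) f → ∀ M : ℝ≥0∞,
      wn b P (fun x => ‖f x‖ₑ) ≤ M →
      (∀ e, wn (b + 1) P (fun x => ‖pd e f x‖ₑ) ≤ M) →
      wn (b + 1) q (fun x => ‖f x‖ₑ) ≤ C * M := by
  obtain ⟨χ, K, hK0, hχc, hχs, hχ1, hχd, hχe⟩ := cutoff N
  set a := b + 1 with ha
  set c1 : ℝ := 2 ^ |a / 2| with hc1
  set c2 : ℝ := |a| * 2 ^ |(a - 1) / 2| + 2 ^ |a / 2| * K with hc2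
  set L : NNReal := Real.toNNReal (c1 + c2) with hL
  have hc1n : 0 ≤ c1 := by positivity
  have hc2n : 0 ≤ c2 := by positivity
  have hLr : (L : ℝ) = c1 + c2 := Real.coe_toNNReal _ (by positivity)
  -- the weights
  set W : ℕ → Euc N → ℝ := fun n x => gb a x * χ n x with hW
  have hWc : ∀ n, ContDiff ℝ (⊤ : ℕ∞) (W n) := fun n => (gb_contDiff a).mul (hχc n)
  have hWs : ∀ n, HasCompactSupport (W n) := fun n => (hχs n).mul_left
  have hW1 : ∀ n x, ‖W n x‖ₑ ≤ L * om a x := by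
    intro n x
    rw [om_eq, ← ENNReal.ofReal_coe_nnreal, ← ENNReal.ofReal_mul (by positivity), ← ofReal_norm]
    apply ENNReal.ofReal_le_ofReal
    rw [hW, norm_mul, Real.norm_of_nonneg (gb_pos a x).le, Real.norm_eq_abs, hLr]
    have hx := norm_nonneg x
    have hp : 0 ≤ (1 + ‖x‖) ^ a := by positivity
    calc gb a x * |χ n x| ≤ c1 * (1 + ‖x‖) ^ a * 1 := by
          gcongr
          · exact gb_le a x
          · exact hχ1 n x
      _ ≤ _ := by nlinarith
  have hW2 : ∀ n x, ‖fderiv ℝ (W n) x‖ₑ ≤ L * om (a - 1) x := by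
    intro n x
    rw [om_eq, ← ENNReal.ofReal_coe_nnreal, ← ENNReal.ofReal_mul (by positivity), ← ofReal_norm]
    apply ENNReal.ofReal_le_ofReal
    have h1 : fderiv ℝ (W n) x = _ := fderiv_fun_mul ((gb_contDiff a).differentiable (by simp) x)
      ((hχc n).differentiable (by simp) x)
    rw [h1]
    refine (norm_add_le _ _).trans ?_
    rw [norm_smul, norm_smul, Real.norm_of_nonneg (gb_pos a x).le, Real.norm_eq_abs, hLr]
    have hx := norm_nonneg x
    have hp : 0 ≤ (1 + ‖x‖) ^ (a-1) := by positivity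
    have e1 : (1 + ‖x‖) ^ a * (1 + ‖x‖)⁻¹ = (1 + ‖x‖) ^ (a-1) := by
      rw [Real.rpow_sub_one (by positivity), div_eq_mul_inv]
    calc gb a x * ‖fderiv ℝ (χ n) x‖ + |χ n x| * ‖fderiv ℝ (gb a) x‖ 
        ≤ (2 ^ |a / 2| * (1 + ‖x‖) ^ a) * (K * (1 + ‖x‖)⁻¹) + 1 * (|a| * (2 ^ |(a-1) / 2| * (1 + ‖x‖) ^ (a-1))) := by
          gcongr
          · exact gb_le a x
          · exact hχd n x
          · exact hχ1 n x
          · refine (gb_fderiv a x).trans ?_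
            gcongr
            exact gb_le _ x
      _ = c2 * (1 + ‖x‖) ^ (a-1) := by rw [hc2, ← e1]; ring
      _ ≤ _ := by nlinarith
  refine ⟨L * (S * (L * (1 + N))), fun f hf M h1 h2 => ?_⟩
  have hfd := wn_fderiv hP hf h2
  have hn : ∀ n, eLpNorm (fun x => ‖W n x * f x‖ₑ) q volume ≤ (S * (L * (1 + N)) : NNReal) * M := by
    intro n
    rw [eLpNorm_enorm (fun x => W n x * f x)]
    refine (hS (fun x => W n x * f x) (((hWc n).mul hf).of_le (by simp)) (hWs n).mul_right).trans ?_
    have h3 : eLpNorm (fderiv ℝ (fun x => W n x * f x)) P volume ≤ L * (M + (N:NNReal) * M) := by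
      rw [← eLpNorm_enorm]
      refine (eLp_le_add hP L ((om_measurable b).mul hf.continuous.enorm.measurable)
        ((om_measurable (b+1)).mul (hf.continuous_fderiv (by simp)).enorm.measurable) ?_).trans (mul_le_mul_right (add_le_add h1 hfd) _)
      intro x
      have h4 : fderiv ℝ (fun x => W n x * f x) x = _ := fderiv_fun_mul ((hWc n).differentiable (by simp) x)
        (hf.differentiable (by simp) x)
      rw [h4]
      refine (enorm_add_le (E := Euc N →L[ℝ] ℝ) (W n x • fderiv ℝ f x) (f x • fderiv ℝ (W n) x)).trans ?_
      rw [enorm_smul, enorm_smul, mul_add, add_comm]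
      refine add_le_add ?_ ?_
      · calc ‖f x‖ₑ * ‖fderiv ℝ (W n) x‖ₑ ≤ ‖f x‖ₑ * (L * om (a-1) x) := by gcongr; exact hW2 n x
          _ = _ := by rw [ha, add_sub_cancel_right]; simp only [Pi.mul_apply]; ring
      · calc ‖W n x‖ₑ * ‖fderiv ℝ f x‖ₑ ≤ (L * om a x) * ‖fderiv ℝ f x‖ₑ := by gcongr; exact hW1 n x
          _ = _ := by simp only [Pi.mul_apply]; ring
    refine (mul_le_mul_right h3 _).trans (le_of_eq ?_)
    push_cast; ring
  have hlim := fatou_ev hq (F := fun n x => ‖W n x * f x‖ₑ) (G := fun x => ‖gb a x * f x‖ₑ) (M := (S * (L * (1 + N)) : NNReal) * M)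
    (fun n => ((hWc n).mul hf).continuous.enorm.measurable) (fun x => by
      filter_upwards [hχe x] with n hn
      simp [hW, hn]) hn
  have hfin : wn a q (fun x => ‖f x‖ₑ) ≤ L * eLpNorm (fun x => ‖gb a x * f x‖ₑ) q volume := by
    refine eLp_le_mul L fun x => ?_
    rw [enorm_mul, ← mul_assoc]
    gcongr
    rw [om_eq, ← ENNReal.ofReal_coe_nnreal, ← ofReal_norm, ← ENNReal.ofReal_mul (by positivity)]
    apply ENNReal.ofReal_le_ofReal
    rw [Real.norm_of_nonneg (gb_pos a x).le, hLr]
    refine (le_gb a x).trans ?_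
    have := gb_pos a x
    change c1 * _ ≤ _
    nlinarith
  refine hfin.trans ((mul_le_mul_right hlim _).trans (le_of_eq ?_))
  push_cast; ring


/-- One-step weighted embedding property for smooth functions. -/
def Emb (N : ℕ) (P q : ℝ≥0∞) : Prop :=
  ∀ b : ℝ, ∃ C : NNReal, ∀ f : Euc N → ℝ, ContDiff ℝ (⊤ : ℕ∞) f → ∀ M : ℝ≥0∞,
      wn b P (fun x => ‖f x‖ₑ) ≤ M →
      (∀ e, wn (b + 1) P (fun x => ‖pd e f x‖ₑ) ≤ M) →
      wn (b + (N : ℝ) * (1 / P.toReal - 1 / q.toReal)) q (fun x => ‖f x‖ₑ) ≤ C * M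

theorem Emb_sub (N : ℕ) {p : ℝ} {q : ℝ≥0∞} (hp : 1 ≤ p) (hpq : ENNReal.ofReal p ≤ q)
    (hα : (N : ℝ) * (1 / p - 1 / q.toReal) < 1) : Emb N (ENNReal.ofReal p) q := by
  intro b
  rw [ENNReal.toReal_ofReal (by linarith)]
  exact emb_sub N hp hpq hα b

theorem Emb_gns (N : ℕ) (hN : 1 ≤ N) {p q : ℝ} (hp : 1 ≤ p) (hq : 1 ≤ q)
    (h : (N : ℝ) * (1 / p - 1 / q) = 1) : Emb N (ENNReal.ofReal p) (ENNReal.ofReal q) := by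
  intro b
  rw [ENNReal.toReal_ofReal (by linarith), ENNReal.toReal_ofReal (by linarith), h]
  have hN0 : (0:ℝ) < N := by exact_mod_cast hN
  refine emb_crit_abs N (by simpa using hp) (by simpa using hq) 
    (S := SNormLESNormFDerivOfEqConst ℝ (volume : Measure (Euc N)) (p.toNNReal : NNReal)) ?_ b
  intro F hF hFs
  have := eLpNorm_le_eLpNorm_fderiv_of_eq (volume : Measure (Euc N)) hF hFs (p := p.toNNReal)
    (p' := q.toNNReal) (by simpa using hp) (by rw [finrank_euclideanSpace_fin]; omega) (by
      rw [finrank_euclideanSpace_fin, Real.coe_toNNReal _ (by linarith), NNReal.coe_inv, Real.coe_toNNReal _ (by linarith)]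
      field_simp at h ⊢
      linarith)
  exact this

theorem one_dim (F : Euc 1 → ℝ) (hF : ContDiff ℝ 1 F) (hFs : HasCompactSupport F) :
    eLpNorm F ⊤ volume ≤ (1 : NNReal) * eLpNorm (fderiv ℝ F) 1 volume := by
  have hmp := (EuclideanSpace.volume_preserving_symm_measurableEquiv_toLp (Fin 1))
  have hm2 := (volume_preserving_funUnique (Fin 1) ℝ)
  set ι : ℝ → Euc 1 := fun t => t • EuclideanSpace.single 0 1 with hι
  have hιc : ContDiff ℝ 1 ι := contDiff_id.smul contDiff_const
  have hmi : MeasurePreserving ι volume volume := by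
    have h1 := hmp.symm.comp hm2.symm
    have h2 : ι = (⇑(MeasurableEquiv.toLp 2 (Fin 1 → ℝ)).symm.symm ∘ 
      ⇑(MeasurableEquiv.funUnique (Fin 1) ℝ).symm) := by
      funext t
      ext i
      fin_cases i
      simp [hι]
    rw [h2]
    exact h1
  have hex : ∀ x : Euc 1, x = ι (x 0) := by
    intro x; ext i; fin_cases i; simp [hι]
  have hn : ∀ t, ‖ι t‖ = ‖t‖ := fun t => by simp [hι, norm_smul]
  have hs : HasCompactSupport (F ∘ ι) := by
    apply hFs.comp_isClosedEmbedding
    have : Isometry ι := by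
      refine Isometry.of_dist_eq fun s t => ?_
      rw [dist_eq_norm, dist_eq_norm, ← hn]; simp [hι, sub_smul]
    exact this.isClosedEmbedding
  rw [eLpNorm_exponent_top, coe_one, one_mul, eLpNorm_one_eq_lintegral_enorm]
  refine eLpNormEssSup_le_of_ae_enorm_bound (Eventually.of_forall fun x => ?_)
  have h1 := HasCompactSupport.enorm_le_lintegral_Ici_deriv (hF.comp hιc) hs (x 0)
  have h2 : ∫⁻ y, ‖fderiv ℝ F y‖ₑ = ∫⁻ t, ‖fderiv ℝ F (ι t)‖ₑ :=
    (hmi.lintegral_comp (f := fun y => ‖fderiv ℝ F y‖ₑ) (hF.continuous_fderiv (by simp)).enorm.measurable).symm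
  rw [h2]
  calc ‖F x‖ₑ = ‖(F ∘ ι) (x 0)‖ₑ := by rw [Function.comp, ← hex x]
    _ ≤ _ := h1
    _ ≤ ∫⁻ t, ‖deriv (F ∘ ι) t‖ₑ := setLIntegral_le_lintegral _ _
    _ ≤ _ := by
      refine lintegral_mono fun t => ?_
      have hd : HasDerivAt ι (EuclideanSpace.single 0 1) t := by
        have := (hasDerivAt_id t).smul_const (EuclideanSpace.single (0 : Fin 1) (1:ℝ))
        simpa using this
      have h3 := ((hF.differentiable (by simp) (ι t)).hasFDerivAt.comp_hasDerivAt t hd).deriv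
      rw [h3]
      refine (ContinuousLinearMap.le_opENorm _ _).trans (le_of_eq ?_)
      have h6 : ‖(EuclideanSpace.single 0 1 : Euc 1)‖ₑ = 1 := by
        rw [← ofReal_norm]; simp
      rw [h6, mul_one]

theorem Emb_one : Emb 1 (ENNReal.ofReal 1) ⊤ := by
  intro b
  have := emb_crit_abs 1 (P := ENNReal.ofReal 1) (q := ⊤) (by simp) (by simp) (S := 1) (by simpa using one_dim) b
  simpa using this

theorem chain (N : ℕ) (Q : ℕ → ℝ≥0∞) (m : ℕ) : (∀ i < m, Emb N (Q i) (Q (i + 1))) → ∀ b : ℝ, 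
    ∃ C : NNReal, ∀ u : Euc N → ℝ, ContDiff ℝ (⊤ : ℕ∞) u → ∀ M : ℝ≥0∞,
      (∀ i ≤ m, ∀ l : List (Fin N), l.length = i → 
        wn (b + i) (Q 0) (fun x => ‖pderivList l u x‖ₑ) ≤ M) →
      wn (b + (N : ℝ) * (1 / (Q 0).toReal - 1 / (Q m).toReal)) (Q m) (fun x => ‖u x‖ₑ) ≤ C * M := by
  induction m with
  | zero =>
    intro _ b
    refine ⟨1, fun u hu M h => ?_⟩
    have := h 0 le_rfl [] rfl
    simpa [pderivList] using this
  | succ m ih =>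
    intro hE b
    obtain ⟨C1, h1⟩ := ih (fun i hi => hE i (by omega)) b
    obtain ⟨C2, h2⟩ := ih (fun i hi => hE i (by omega)) (b + 1)
    obtain ⟨C3, h3⟩ := hE m (by omega) (b + (N : ℝ) * (1 / (Q 0).toReal - 1 / (Q m).toReal))
    refine ⟨C3 * (C1 + C2), fun u hu M h => ?_⟩
    have := h3 u hu ((C1 + C2) * M) ?_ ?_
    · convert this using 1
      · congr 1; ring
      · push_cast; ring
    · refine (h1 u hu M fun i hi => h i (by omega)).trans ?_
      gcongr; exact le_self_add
    · intro e
      have h4 := h2 (pd e u) (pd_contDiff hu) M (fun i hi l hl => by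
        have := h (i + 1) (by omega) (e :: l) (by simp [hl])
        have e : b + 1 + (i : ℝ) = b + ((i + 1 : ℕ) : ℝ) := by push_cast; ring
        rw [e]
        exact this)
      have h5 : wn (b + ↑N * (1 / (Q 0).toReal - 1 / (Q m).toReal) + 1) (Q m) (fun x => ‖pd e u x‖ₑ) ≤ C2 * M := by
        convert h4 using 2; ring
      refine h5.trans ?_
      gcongr; exact le_add_self

theorem Q_exists {N j : ℕ} (hN : 1 ≤ N) (hj : 1 ≤ j) {p : ℝ} (hp : 1 ≤ p) {q : ℝ≥0∞} (hq : q ∈ Ijp N j p) :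
    ENNReal.ofReal p ≤ q ∧ ∃ Q : ℕ → ℝ≥0∞, Q 0 = ENNReal.ofReal p ∧ Q j = q ∧ ∀ i < j, Emb N (Q i) (Q (i + 1)) := by
  have hN0 : (1:ℝ) ≤ N := by exact_mod_cast hN
  have hj0 : (1:ℝ) ≤ j := by exact_mod_cast hj
  have hpq : ENNReal.ofReal p ≤ q := by
    unfold Ijp at hq
    split_ifs at hq <;> exact hq.1
  refine ⟨hpq, ?_⟩
  set c : ℝ := 1 / q.toReal with hc
  have hc0 : 0 ≤ c := by positivity
  have hca : c ≤ 1 / p := by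
    rcases eq_or_ne q ⊤ with rfl | hne
    · simp [hc]; linarith
    · have : p ≤ q.toReal := (ENNReal.ofReal_le_iff_le_toReal hne).1 hpq
      exact one_div_le_one_div_of_le (by linarith) this
  set δ : ℝ := (1 / p - c) / j with hδ
  have hδ0 : 0 ≤ δ := div_nonneg (by linarith) (by linarith)
  have hjδ : j * δ = 1 / p - c := by rw [hδ]; field_simp
  have hp0 : 0 < 1 / p := by positivity
  have hpos : ∀ m : ℕ, m < j → 0 < 1 / p - m * δ := by
    intro m hm
    have hm' : (m : ℝ) + 1 ≤ j := by exact_mod_cast hm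
    rcases eq_or_lt_of_le hδ0 with h | h
    · rw [← h]; simpa using hp0
    · nlinarith
  set Q : ℕ → ℝ≥0∞ := fun m => if m < j then ENNReal.ofReal (1 / (1 / p - m * δ)) else q with hQ
  have hQ0 : Q 0 = ENNReal.ofReal p := by simp [hQ, show 0 < j by omega]
  have hQj : Q j = q := by simp [hQ]
  have hQlt : ∀ m, m < j → Q m = ENNReal.ofReal (1 / (1 / p - m * δ)) := fun m hm => by simp [hQ, hm]
  have hQr : ∀ m, m ≤ j → 1 / (Q m).toReal = 1 / p - m * δ := by
    intro m hm
    rcases lt_or_eq_of_le hm with h | h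
    · rw [hQlt m h, ENNReal.toReal_ofReal (by have := hpos m h; positivity), one_div_one_div]
    · rw [h, hQj, hjδ]; ring
  have hone : ∀ m, m < j → 1 ≤ 1 / (1 / p - m * δ) := by
    intro m hm
    rw [le_div_iff₀ (hpos m hm)]
    have : 1 / p ≤ 1 := by rw [div_le_one (by linarith)]; exact hp
    have : 0 ≤ (m:ℝ) * δ := by positivity
    linarith
  have hmono : ∀ m, m < j → Q m ≤ Q (m + 1) := by
    intro m hm
    rw [hQlt m hm]
    rcases eq_or_ne (Q (m+1)) ⊤ with h | h
    · rw [h]; exact le_top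
    rw [ENNReal.ofReal_le_iff_le_toReal h]
    have h1 := hQr (m+1) hm
    have h2 : (Q (m+1)).toReal = 1 / (1 / p - (m+1 : ℕ) * δ) := by rw [← h1, one_div_one_div]
    have h3 : 0 < (Q (m+1)).toReal := by
      refine ENNReal.toReal_pos ?_ h
      by_cases h4 : m + 1 < j
      · rw [hQlt _ h4]; have := hone _ h4; simp only [ne_eq, ENNReal.ofReal_eq_zero, not_le]; linarith
      · have : m + 1 = j := by omega
        rw [this, hQj]
        have : 0 < ENNReal.ofReal p := by simp; linarith
        exact (this.trans_le hpq).ne'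
    have h5 : 0 < 1 / p - (m+1 : ℕ) * δ := by rw [← h1]; positivity
    rw [h2]
    apply one_div_le_one_div_of_le h5
    push_cast; nlinarith
  refine ⟨Q, hQ0, hQj, ?_⟩
  have hsub : N * δ < 1 → ∀ i < j, Emb N (Q i) (Q (i + 1)) := by
    intro h i hi
    have h1 := hmono i hi
    rw [hQlt i hi] at h1 ⊢
    refine Emb_sub N (hone i hi) h1 ?_
    rw [hQr (i+1) hi, one_div_one_div]
    calc _ = (N:ℝ) * δ := by push_cast; ring
      _ < 1 := h
  have hcr : N * δ = 1 → 0 < c → ∀ i < j, Emb N (Q i) (Q (i + 1)) := by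
    intro h hcp i hi
    have h2 : Q (i + 1) = ENNReal.ofReal (1 / (1 / p - (i+1 : ℕ) * δ)) := by
      by_cases h4 : i + 1 < j
      · exact hQlt _ h4
      · have h5 : i + 1 = j := by omega
        rw [h5, hQj, hjδ, _root_.sub_sub_cancel, hc, one_div_one_div, ENNReal.ofReal_toReal]
        rintro rfl
        simp [hc] at hcp
    have h3 : 1 ≤ 1 / (1 / p - (i+1 : ℕ) * δ) := by
      have : ENNReal.ofReal 1 ≤ ENNReal.ofReal (1 / (1 / p - (i+1 : ℕ) * δ)) := by
        rw [← h2]; refine le_trans ?_ (hmono i hi)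
        rw [hQlt i hi]; exact ENNReal.ofReal_le_ofReal (hone i hi)
      rw [ENNReal.ofReal_le_ofReal_iff'] at this
      rcases this with h | h
      · exact h
      · linarith
    rw [hQlt i hi, h2]
    refine Emb_gns N hN (hone i hi) h3 ?_
    rw [one_div_one_div, one_div_one_div, ← h]; push_cast; ring
  have hNδ : (N : ℝ) * δ * j = N * (1 / p - c) := by rw [← hjδ]; ring
  unfold Ijp at hq
  split_ifs at hq with h1 h2
  · apply hsub
    have hcp : 0 < c := by
      rw [hc]; have : 0 < q.toReal := ENNReal.toReal_pos (by
        have : 0 < ENNReal.ofReal p := by simp; linarith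
        exact (this.trans_le hpq).ne') hq.2.ne
      positivity
    have e1 : (N : ℝ) * (1 / p) = j := by
      have := h1.1; rw [this]; field_simp
    by_contra hcon
    push Not at hcon
    nlinarith
  · have hd : 0 < (N:ℝ) - j * p := by
      rw [lt_div_iff₀ (by linarith)] at h2; linarith
    have hle := hq.2
    have hqt : q ≠ ⊤ := ne_top_of_le_ne_top ofReal_ne_top hle
    have hq0 : 0 < q.toReal := ENNReal.toReal_pos (by
        have : 0 < ENNReal.ofReal p := by simp; linarith
        exact (this.trans_le hpq).ne') hqt
    have hr : q.toReal ≤ N * p / (N - j * p) := ENNReal.toReal_le_of_le_ofReal (by positivity) hle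
    have hcl : 1 / (N * p / (N - j * p)) ≤ c := one_div_le_one_div_of_le hq0 hr
    have hcp : 0 < c := by positivity
    have e2 : 1 / ((N:ℝ) * p / (N - j * p)) = 1 / p - j / N := by field_simp
    rw [e2] at hcl
    have e3 : (N:ℝ) * (1 / p - c) ≤ j := by
      have : 1 / p - c ≤ j / N := by linarith
      calc (N:ℝ) * (1 / p - c) ≤ N * (j / N) := by gcongr
        _ = j := by field_simp
    have e4 : (N : ℝ) * δ ≤ 1 := by
      by_contra hcon
      push Not at hcon
      nlinarith
    rcases lt_or_eq_of_le e4 with h | h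
    · exact hsub h
    · exact hcr h hcp
  · push Not at h1 h2
    rcases lt_or_eq_of_le h2 with h | h
    · apply hsub
      have : (N:ℝ) * (1 / p) < j := by
        rw [div_lt_iff₀ (by linarith)] at h
        rw [mul_one_div, div_lt_iff₀ (by linarith)]; linarith
      by_contra hcon
      push Not at hcon
      nlinarith
    · have hN1 : N = 1 := by
        have := h1 h.symm; omega
      subst hN1
      have hj1 : j = 1 := by
        have : (1:ℝ) / j = p := by simpa using h
        have h3 : p * j = 1 := by rw [← this]; field_simp
        have : (j:ℝ) ≤ 1 := by nlinarith
        have : j ≤ 1 := by exact_mod_cast this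
        omega
      subst hj1
      have hp1 : p = 1 := by simpa using h.symm
      rcases eq_or_ne q ⊤ with hqt | hqt
      · intro i hi
        have : i = 0 := by omega
        subst this
        rw [hQ0, hQj, hp1, hqt]
        exact Emb_one
      · apply hsub
        have hq0 : 0 < q.toReal := ENNReal.toReal_pos (by
          have : 0 < ENNReal.ofReal p := by simp; linarith
          exact (this.trans_le hpq).ne') hqt
        have hcp : 0 < c := by positivity
        simp at hNδ ⊢
        rw [hNδ, hp1]; norm_num; exact hcp


theorem pderivList_append {N : ℕ} (l l' : List (Fin N)) (f : Euc N → ℝ) :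
    pderivList (l ++ l') f = pderivList l' (pderivList l f) := by
  induction l generalizing f with
  | nil => rfl
  | cons e l ih => simp only [List.cons_append, pderivList, ih]

theorem kIndex_neg {k j : ℕ} {s : ℝ} (hj : 1 ≤ j) (hjk : j ≤ k) (h : j ≤ k - kIndex k s) :
    ∀ i : ℕ, i ≤ j → s + i < 0 := by
  have hs : s + j < 0 := by
    unfold kIndex at h
    split_ifs at h with h1 h2
    · omega
    · have : (j:ℝ) ≤ k := by exact_mod_cast hjk
      linarith
    · have h3 : Nat.floor (s + k + 1) ≤ k - j := by omega
      have h4 := Nat.lt_floor_add_one (s + k + 1)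
      have h5 : ((Nat.floor (s + k + 1) : ℕ) : ℝ) ≤ ((k - j : ℕ) : ℝ) := by exact_mod_cast h3
      rw [Nat.cast_sub hjk] at h5
      linarith
  intro i hi
  have : (i:ℝ) ≤ j := by exact_mod_cast hi
  linarith

theorem smooth_main {N : ℕ} (hN : 1 ≤ N) (k : ℕ) (p s : ℝ) (hp : 1 ≤ p) (j : ℕ) (hj : 1 ≤ j)
    (hjk : j ≤ k) (q : ℝ≥0∞) (hq : q ∈ Ijp N j p) :
    ∃ C : NNReal, ∀ u : Euc N → ℝ, ContDiff ℝ (⊤ : ℕ∞) u → ∀ A B : ℝ≥0∞, A ≠ ∞ → B ≠ ∞ →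
      wn (-(s + k) - N / p) (ENNReal.ofReal p) (fun x => ‖u x‖ₑ) ≤ A →
      (∀ l : List (Fin N), l.length = k → 
        wn (-s - N / p) (ENNReal.ofReal p) (fun x => ‖pderivList l u x‖ₑ) ≤ B) →
      ∀ l : List (Fin N), l.length = k - j →
        wn (-(s + j) - N / q.toReal) q (fun x => ‖pderivList l u x‖ₑ) ≤ C * (A + B) ∧
        (j ≤ k - kIndex k s → 
          wn (-(s + j) - N / q.toReal) q (fun x => ‖pderivList l u x‖ₑ) ≤ C * B) := by
  set P := ENNReal.ofReal p with hP
  set β : ℝ := -(s + k) - N / p with hβ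
  obtain ⟨hpq, Q, hQ0, hQj, hQ⟩ := Q_exists hN hj hp hq
  obtain ⟨C1, h1⟩ := interp N hp β k
  obtain ⟨C2, h2⟩ := chain N Q j hQ (β + (k - j : ℕ))
  rw [hQ0, hQj, ENNReal.toReal_ofReal (by linarith)] at h2
  have hexp : β + ((k - j : ℕ) : ℝ) + N * (1 / p - 1 / q.toReal) = -(s + j) - N / q.toReal := by
    rw [hβ, Nat.cast_sub hjk]; ring
  rw [hexp] at h2
  have happ : ∀ u : Euc N → ℝ, ContDiff ℝ (⊤ : ℕ∞) u → ∀ M : ℝ≥0∞,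
      (∀ i ≤ j, ∀ l : List (Fin N), l.length = k - i → 
        wn (β + (k - i : ℕ)) P (fun x => ‖pderivList l u x‖ₑ) ≤ M) → 
      ∀ l : List (Fin N), l.length = k - j →
        wn (-(s + j) - N / q.toReal) q (fun x => ‖pderivList l u x‖ₑ) ≤ C2 * M := by
    intro u hu M hM l hl
    refine h2 (pderivList l u) (pderivList_contDiff l hu) M fun i hi l' hl' => ?_
    have h3 := hM (j - i) (by omega) (l ++ l') (by simp [hl, hl']; omega)
    rw [pderivList_append] at h3
    have e1 : β + ((k - (j - i) : ℕ) : ℝ) = β + ((k - j : ℕ) : ℝ) + i := by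
      rw [show k - (j - i) = (k - j) + i by omega]; push_cast; ring
    rwa [e1] at h3
  -- Hardy constants
  have hhardy : j ≤ k - kIndex k s → ∀ i : ℕ, i ≤ j → ∃ C : NNReal, ∀ u : Euc N → ℝ, 
      ContDiff ℝ (⊤ : ℕ∞) u → ∀ B : ℝ≥0∞,
      (∀ i ≤ k, ∀ l : List (Fin N), l.length = i → wn (β + i) P (fun x => ‖pderivList l u x‖ₑ) ≠ ∞) →
      (∀ l : List (Fin N), l.length = k → 
        wn (-s - N / p) P (fun x => ‖pderivList l u x‖ₑ) ≤ B) →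
      (∀ i' ≤ i, ∀ l : List (Fin N), l.length = k - i' → 
        wn (β + (k - i' : ℕ)) P (fun x => ‖pderivList l u x‖ₑ) ≤ C * B) := by
    intro hjs i
    have hneg := kIndex_neg hj hjk hjs
    induction i with
    | zero => 
      intro _
      refine ⟨1, fun u hu B _ hB i' hi' l hl => ?_⟩
      have : i' = 0 := by omega
      subst this
      have e : β + ((k - 0 : ℕ) : ℝ) = -s - N / p := by rw [hβ]; simp; ring
      rw [e, coe_one, one_mul]
      exact hB l (by simpa using hl)
    | succ i ih =>
      intro hi
      obtain ⟨C3, h3⟩ := ih (by omega)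
      have hb : 0 < (β + ((k - (i + 1) : ℕ) : ℝ)) + N / p := by
        have := hneg (i + 1) hi
        rw [hβ, Nat.cast_sub (by omega)]
        linarith
      obtain ⟨C4, h4⟩ := hardy hN hp hb
      refine ⟨C3 + C4 * C3, fun u hu B hfin hB i' hi' l hl => ?_⟩
      have h5 := h3 u hu B hfin hB
      rcases Nat.lt_or_ge i' (i + 1) with hlt | hge
      · refine (h5 i' (by omega) l hl).trans ?_
        gcongr; exact le_self_add
      · have : i' = i + 1 := by omega
        subst this
        refine (h4 (pderivList l u) (pderivList_contDiff l hu) (C3 * B) ?_ ?_).trans ?_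
        · exact hfin _ (by omega) l hl
        · intro e
          have h6 := h5 i le_rfl (l ++ [e]) (by simp [hl]; omega)
          rw [pderivList_snoc] at h6
          have e1 : β + ((k - (i + 1) : ℕ) : ℝ) + 1 = β + ((k - i : ℕ) : ℝ) := by
            rw [show k - i = (k - (i + 1)) + 1 by omega]; push_cast; ring
          rw [e1]; exact h6
        · rw [← mul_assoc, ← coe_mul]
          gcongr
          exact le_add_self
  have hmain : ∃ C : NNReal, j ≤ k - kIndex k s → ∀ u : Euc N → ℝ, 
      ContDiff ℝ (⊤ : ℕ∞) u → ∀ B : ℝ≥0∞,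
      (∀ i ≤ k, ∀ l : List (Fin N), l.length = i → wn (β + i) P (fun x => ‖pderivList l u x‖ₑ) ≠ ∞) →
      (∀ l : List (Fin N), l.length = k → 
        wn (-s - N / p) P (fun x => ‖pderivList l u x‖ₑ) ≤ B) →
      (∀ i' ≤ j, ∀ l : List (Fin N), l.length = k - i' → 
        wn (β + (k - i' : ℕ)) P (fun x => ‖pderivList l u x‖ₑ) ≤ C * B) := by
    by_cases hjs : j ≤ k - kIndex k s
    · obtain ⟨C, hC⟩ := hhardy hjs j le_rfl
      exact ⟨C, fun _ => hC⟩
    · exact ⟨0, fun h => absurd h hjs⟩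
  obtain ⟨C5, h5⟩ := hmain
  refine ⟨C2 * C1 + C2 * C5, fun u hu A B hA hB hAu hBu l hl => ?_⟩
  have hI := h1 u hu (A + B) (by simp [hA, hB]) (hAu.trans le_self_add) (fun l hl => by
    have e : β + (k : ℝ) = -s - N / p := by rw [hβ]; ring
    rw [e]
    exact (hBu l hl).trans le_add_self)
  have hfin : ∀ i ≤ k, ∀ l : List (Fin N), l.length = i → 
      wn (β + i) P (fun x => ‖pderivList l u x‖ₑ) ≠ ∞ := fun i hi l hl =>
    ne_top_of_le_ne_top (by finiteness) (hI i hi l hl)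
  constructor
  · refine (happ u hu (C1 * (A + B)) (fun i hi l hl => hI (k - i) (by omega) l hl) l hl).trans ?_
    rw [← mul_assoc, ← coe_mul]
    gcongr
    exact le_self_add
  · intro hjs
    refine (happ u hu (C5 * B) (h5 hjs u hu B hfin hBu) l hl).trans ?_
    rw [← mul_assoc, ← coe_mul]
    gcongr
    exact le_add_self


theorem pd_comm {N : ℕ} (e e' : Fin N) {f : Euc N → ℝ} (hf : ContDiff ℝ (⊤ : ℕ∞) f) :
    pd e (pd e' f) = pd e' (pd e f) := by
  have hs : ∀ x, IsSymmSndFDerivAt ℝ f x := fun x =>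
    (hf.contDiffAt).isSymmSndFDerivAt (by simp; exact WithTop.coe_le_coe.2 (by exact_mod_cast le_top))
  have h : ∀ (e e' : Fin N) x, pd e (pd e' f) x = 
      fderiv ℝ (fderiv ℝ f) x (EuclideanSpace.single e 1) (EuclideanSpace.single e' 1) := by
    intro e e' x
    have hd : DifferentiableAt ℝ (fderiv ℝ f) x :=
      (hf.fderiv_right (m := (⊤ : ℕ∞)) (by simp)).differentiable (by simp) x
    change fderiv ℝ (fun y => fderiv ℝ f y (EuclideanSpace.single e' 1)) x _ = _
    rw [fderiv_clm_apply hd (differentiableAt_const _)]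
    simp
  funext x
  rw [h, h]
  exact hs x _ _

theorem pderivList_pd {N : ℕ} (l : List (Fin N)) (e : Fin N) {f : Euc N → ℝ}
    (hf : ContDiff ℝ (⊤ : ℕ∞) f) : pderivList l (pd e f) = pd e (pderivList l f) := by
  induction l generalizing f with
  | nil => rfl
  | cons a l ih =>
    change pderivList l (pd a (pd e f)) = pd e (pderivList l (pd a f))
    rw [pd_comm a e hf, ih (pd_contDiff hf)]

theorem pderivList_sub {N : ℕ} (l : List (Fin N)) {f g : Euc N → ℝ}
    (hf : ContDiff ℝ (⊤ : ℕ∞) f) (hg : ContDiff ℝ (⊤ : ℕ∞) g) :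
    pderivList l (fun x => f x - g x) = fun x => pderivList l f x - pderivList l g x := by
  induction l generalizing f g with
  | nil => rfl
  | cons a l ih =>
    have : pd a (fun x => f x - g x) = fun x => pd a f x - pd a g x := by
      funext x
      unfold pd
      rw [fderiv_fun_sub (hf.differentiable (by simp) x) (hg.differentiable (by simp) x)]
      rfl
    change pderivList l (pd a _) = _
    rw [this, ih (pd_contDiff hf) (pd_contDiff hg)]
    rfl

theorem pd_compact {N : ℕ} (e : Fin N) {f : Euc N → ℝ} (hf : HasCompactSupport f) :
    HasCompactSupport (pd e f) := by
  exact hf.fderiv_apply ℝ _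

theorem pderivList_compact {N : ℕ} (l : List (Fin N)) {f : Euc N → ℝ} (hf : HasCompactSupport f) :
    HasCompactSupport (pderivList l f) := by
  induction l generalizing f with
  | nil => exact hf
  | cons a l ih => exact ih (pd_compact a hf)

theorem ibp_one {N : ℕ} (e : Fin N) {f φ : Euc N → ℝ} (hf : ContDiff ℝ (⊤ : ℕ∞) f)
    (hφ : ContDiff ℝ (⊤ : ℕ∞) φ) (hc : HasCompactSupport φ) :
    ∫ x, f x * pd e φ x = - ∫ x, pd e f x * φ x := by
  refine integral_mul_fderiv_eq_neg_fderiv_mul_of_integrable ?_ ?_ ?_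
    (fun x _ => hf.differentiable (by simp) x) (fun x _ => hφ.differentiable (by simp) x)
  · exact Continuous.integrable_of_hasCompactSupport 
      ((pd_contDiff hf).continuous.mul hφ.continuous) hc.mul_left
  · exact Continuous.integrable_of_hasCompactSupport 
      (hf.continuous.mul (pd_contDiff hφ).continuous) (pd_compact e hc).mul_left
  · exact Continuous.integrable_of_hasCompactSupport 
      (hf.continuous.mul hφ.continuous) hc.mul_left

theorem ibp {N : ℕ} (l : List (Fin N)) {f φ : Euc N → ℝ} (hf : ContDiff ℝ (⊤ : ℕ∞) f)
    (hφ : ContDiff ℝ (⊤ : ℕ∞) φ) (hc : HasCompactSupport φ) :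
    ∫ x, f x * pderivList l φ x = (-1 : ℝ) ^ l.length * ∫ x, pderivList l f x * φ x := by
  induction l generalizing f φ with
  | nil => simp [pderivList]
  | cons e l ih =>
    change ∫ x, f x * pderivList l (pd e φ) x = _ * ∫ x, pderivList l (pd e f) x * φ x
    rw [ih hf (pd_contDiff hφ) (pd_compact e hc), pderivList_pd l e hf, 
      ibp_one e (pderivList_contDiff l hf) hφ hc, List.length_cons, pow_succ]
    ring

open scoped Convolution

/-- Convolution of real functions. -/
def cv {N : ℕ} (η u : Euc N → ℝ) : Euc N → ℝ := η ⋆[ContinuousLinearMap.lsmul ℝ ℝ, volume] u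

theorem cv_contDiff {N : ℕ} {η u : Euc N → ℝ} (hη : ContDiff ℝ (⊤ : ℕ∞) η)
    (hc : HasCompactSupport η) (hu : LocallyIntegrable u volume) : ContDiff ℝ (⊤ : ℕ∞) (cv η u) :=
  hc.contDiff_convolution_left _ hη hu

theorem pd_cv {N : ℕ} (e : Fin N) {η u : Euc N → ℝ} (hη : ContDiff ℝ (⊤ : ℕ∞) η)
    (hc : HasCompactSupport η) (hu : LocallyIntegrable u volume) : pd e (cv η u) = cv (pd e η) u := by
  funext x
  have h := hc.hasFDerivAt_convolution_left (ContinuousLinearMap.lsmul ℝ ℝ) (hη.of_le (by simp)) hu x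
  unfold pd
  have h2 : fderiv ℝ (cv η u) x = _ := h.fderiv
  rw [h2]
  have hex := (hc.fderiv ℝ).convolutionExists_left ((ContinuousLinearMap.lsmul ℝ ℝ).precompL (Euc N))
    (hη.continuous_fderiv (by simp)) hu x
  unfold cv
  rw [convolution, ContinuousLinearMap.integral_apply hex.integrable]
  rfl

theorem pderivList_cv {N : ℕ} (l : List (Fin N)) {η u : Euc N → ℝ} (hη : ContDiff ℝ (⊤ : ℕ∞) η)
    (hc : HasCompactSupport η) (hu : LocallyIntegrable u volume) :
    pderivList l (cv η u) = cv (pderivList l η) u := by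
  induction l generalizing η with
  | nil => rfl
  | cons e l ih =>
    change pderivList l (pd e (cv η u)) = cv (pderivList l (pd e η)) u
    rw [pd_cv e hη hc hu, ih (pd_contDiff hη) (pd_compact e hc)]

theorem pderivList_reflect {N : ℕ} (l : List (Fin N)) {η : Euc N → ℝ} (hη : ContDiff ℝ (⊤ : ℕ∞) η)
    (x : Euc N) (c : ℝ) : pderivList l (fun y => c * η (x - y)) = 
      fun y => c * (-1) ^ l.length * pderivList l η (x - y) := by
  induction l generalizing η c with
  | nil => simp [pderivList]
  | cons e l ih =>
    have : pd e (fun y => c * η (x - y)) = fun y => (-c) * pd e η (x - y) := by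
      funext y
      have h1 : HasFDerivAt (fun y => x - y) (-ContinuousLinearMap.id ℝ (Euc N)) y :=
        (hasFDerivAt_id y).const_sub x
      have h2 := ((hη.differentiable (by simp) (x - y)).hasFDerivAt.comp y h1).const_mul c
      have h3 : fderiv ℝ (fun y => c * η (x - y)) y = _ := h2.fderiv
      unfold pd
      rw [h3]; simp
    change pderivList l (pd e _) = _
    rw [this, ih (pd_contDiff hη)]
    funext y
    rw [List.length_cons, pow_succ]
    change _ = c * ((-1) ^ l.length * -1) * pderivList l (pd e η) (x - y)
    ring

theorem cv_weak {N : ℕ} (l : List (Fin N)) {η u g : Euc N → ℝ} (hη : ContDiff ℝ (⊤ : ℕ∞) η)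
    (hc : HasCompactSupport η) (h : IsWeakDerivList l u g) : pderivList l (cv η u) = cv η g := by
  obtain ⟨hu, hg, ht⟩ := h
  rw [pderivList_cv l hη hc hu]
  funext x
  unfold cv
  rw [convolution_lsmul_swap, convolution_lsmul_swap]
  have h1 := ht (fun y => 1 * η (x - y)) (contDiff_const.mul (hη.comp (contDiff_const.sub contDiff_id))) ?_
  · rw [pderivList_reflect l hη x 1] at h1
    have hpm : ((-1 : ℝ) ^ l.length) ≠ 0 := by positivity
    have e1 : ∫ y, u y * (1 * (-1) ^ l.length * pderivList l η (x - y)) = 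
        (-1) ^ l.length * ∫ y, pderivList l η (x - y) • u y := by
      rw [← integral_const_mul]; congr 1; funext y; rw [smul_eq_mul]; ring
    rw [e1] at h1
    rw [mul_left_cancel₀ hpm h1]
    congr 1; funext y; rw [smul_eq_mul]; ring
  · simp only [one_mul]
    exact hc.comp_homeomorph (Homeomorph.subLeft x)


theorem transl_tendsto {N : ℕ} {P : ℝ≥0∞} (hP : 1 ≤ P) (hPt : P ≠ ∞) {F : Euc N → ℝ}
    (hF : MemLp F P volume) :
    Tendsto (fun t : Euc N => eLpNorm (fun x => F (x - t) - F x) P volume) (𝓝 0) (𝓝 0) := by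
  have : Fact (1 ≤ P) := ⟨hP⟩
  let g : C(Euc N, C(Euc N, Euc N)) :=
    (ContinuousMap.mk (fun a : Euc N × Euc N => a.2 - a.1) (by fun_prop)).curry
  have hg : ∀ t, MeasurePreserving (g t) volume volume := fun t => measurePreserving_sub_right volume t
  have h1 : Tendsto (fun t : Euc N => Lp.compMeasurePreserving (g t) (hg t) (hF.toLp F)) (𝓝 0)
      (𝓝 (Lp.compMeasurePreserving (g 0) (hg 0) (hF.toLp F))) :=
    Filter.Tendsto.compMeasurePreservingLp tendsto_const_nhds (g.continuous.tendsto 0) _ _ hPt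
  rw [tendsto_iff_edist_tendsto_0] at h1
  refine h1.congr fun t => ?_
  rw [Lp.toLp_compMeasurePreserving, Lp.toLp_compMeasurePreserving, Lp.edist_toLp_toLp]
  refine eLpNorm_congr_ae (Eventually.of_forall fun x => ?_)
  simp [g]

theorem weight_ratio (N : ℕ) (b : ℝ) {ε : ℝ} (hε : 0 < ε) : ∀ᶠ t in 𝓝 (0 : Euc N), ∀ x : Euc N,
    |(1 + ‖x‖) ^ b - (1 + ‖x - t‖) ^ b| ≤ ε * (1 + ‖x - t‖) ^ b := by
  have hc : ContinuousAt (fun r : ℝ => r ^ b) 1 := Real.continuousAt_rpow_const _ _ (Or.inl one_ne_zero)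
  obtain ⟨ρ, hρ, h⟩ := Metric.continuousAt_iff.1 hc ε hε
  filter_upwards [Metric.ball_mem_nhds (0 : Euc N) hρ] with t ht x
  have ht' : ‖t‖ < ρ := by simpa using ht
  have hx := norm_nonneg x
  have hy := norm_nonneg (x - t)
  have hY : 0 < 1 + ‖x - t‖ := by positivity
  have h1 : |‖x‖ - ‖x - t‖| ≤ ‖t‖ := by
    have := abs_norm_sub_norm_le x (x - t); simpa using this
  have h2 : dist ((1 + ‖x‖) / (1 + ‖x - t‖)) 1 < ρ := by
    rw [Real.dist_eq, div_sub_one hY.ne', abs_div, abs_of_pos hY, div_lt_iff₀ hY]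
    calc |1 + ‖x‖ - (1 + ‖x - t‖)| = |‖x‖ - ‖x - t‖| := by congr 1; ring
      _ ≤ ‖t‖ := h1
      _ < ρ := ht'
      _ ≤ ρ * (1 + ‖x - t‖) := by nlinarith
  have h3 := (h h2).le
  rw [Real.one_rpow, Real.dist_eq, Real.div_rpow (by positivity) (by positivity)] at h3
  have hp : 0 < (1 + ‖x - t‖) ^ b := by positivity
  rw [div_sub_one hp.ne', abs_div, abs_of_pos hp, div_le_iff₀ hp] at h3
  exact h3

theorem wtransl_pt {N : ℕ} {P : ℝ≥0∞} (b : ℝ) {f F : Euc N → ℝ}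
    (hF : ∀ x, F x = (1 + ‖x‖) ^ b * f x) (n : NNReal) (t : Euc N)
    (ht2 : ∀ x : Euc N, |(1 + ‖x‖) ^ b - (1 + ‖x - t‖) ^ b| ≤ n * (1 + ‖x - t‖) ^ b) :
    wn b P (fun x => ‖f (x - t) - f x‖ₑ) ≤ 
      eLpNorm ((fun x => ‖F (x - t) - F x‖) + (fun x => (n : ℝ) * ‖F (x - t)‖)) P volume := by
  refine eLpNorm_mono_enorm fun x => ?_
  have hx := norm_nonneg x
  have hy := norm_nonneg (x - t)
  have hw : 0 ≤ (1 + ‖x‖) ^ b := by positivity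
  have hw' : 0 ≤ (1 + ‖x - t‖) ^ b := by positivity
  have key : (1 + ‖x‖) ^ b * ‖f (x - t) - f x‖ ≤ ‖F (x - t) - F x‖ + (n : ℝ) * ‖F (x - t)‖ := by
    have e1 : (1 + ‖x‖) ^ b * ‖f (x - t) - f x‖ = ‖(1 + ‖x‖) ^ b * (f (x - t) - f x)‖ := by
      rw [norm_mul, Real.norm_of_nonneg hw]
    have e2 : (1 + ‖x‖) ^ b * (f (x - t) - f x) = (F (x - t) - F x) + 
        ((1 + ‖x‖) ^ b - (1 + ‖x - t‖) ^ b) * f (x - t) := by rw [hF, hF]; ring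
    have e3 : ‖((1 + ‖x‖) ^ b - (1 + ‖x - t‖) ^ b) * f (x - t)‖ ≤ (n : ℝ) * ‖F (x - t)‖ := by
      rw [norm_mul, hF (x - t), norm_mul, Real.norm_of_nonneg hw', ← mul_assoc]
      exact mul_le_mul_of_nonneg_right (ht2 x) (norm_nonneg _)
    rw [e1, e2]
    exact (norm_add_le _ _).trans (add_le_add le_rfl e3)
  have l1 : ‖om b x * ‖f (x - t) - f x‖ₑ‖ₑ = ENNReal.ofReal ((1 + ‖x‖) ^ b * ‖f (x - t) - f x‖) := by
    rw [om_eq, enorm_eq_self, ← ofReal_norm, ← ENNReal.ofReal_mul hw]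
  have l2 : ‖((fun x => ‖F (x - t) - F x‖) + (fun x => (n : ℝ) * ‖F (x - t)‖)) x‖ₑ = 
      ENNReal.ofReal (‖F (x - t) - F x‖ + (n : ℝ) * ‖F (x - t)‖) := by
    rw [Pi.add_apply, Real.enorm_of_nonneg]
    exact add_nonneg (norm_nonneg _) (mul_nonneg n.2 (norm_nonneg _))
  rw [l1, l2]
  exact ENNReal.ofReal_le_ofReal key

theorem wtransl_aux {N : ℕ} {P : ℝ≥0∞} (hP : 1 ≤ P) (hPt : P ≠ ∞) (b : ℝ) {f F : Euc N → ℝ}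
    (hF : ∀ x, F x = (1 + ‖x‖) ^ b * f x) (hf : MemLp F P volume) :
    Tendsto (fun t : Euc N => wn b P (fun x => ‖f (x - t) - f x‖ₑ)) (𝓝 0) (𝓝 0) := by
  rw [ENNReal.tendsto_nhds_zero]
  intro ε hε
  have hfin : 1 + eLpNorm F P volume ≠ ∞ := ENNReal.add_ne_top.2 ⟨ENNReal.one_ne_top, hf.2.ne⟩
  obtain ⟨n, hn, hn2⟩ := ENNReal.exists_nnreal_pos_mul_lt hfin hε.ne'
  have h1 := (ENNReal.tendsto_nhds_zero.1 (transl_tendsto hP hPt hf)) n (by exact_mod_cast hn)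
  filter_upwards [h1, weight_ratio N b (ε := n) (by exact_mod_cast hn)] with t ht1 ht2
  refine le_trans ?_ hn2.le
  have hmp := measurePreserving_sub_right (volume : Measure (Euc N)) t
  have hFt : AEStronglyMeasurable (fun x => F (x - t)) volume := hf.1.comp_measurePreserving hmp
  have hFn : eLpNorm (fun x => F (x - t)) P volume = eLpNorm F P volume :=
    eLpNorm_comp_measurePreserving hf.1 hmp
  have hm1 : AEStronglyMeasurable (fun x => ‖F (x - t) - F x‖) volume := (hFt.sub hf.1).norm
  have hm2 : AEStronglyMeasurable (fun x => (n : ℝ) * ‖F (x - t)‖) volume := hFt.norm.const_mul _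
  refine (wtransl_pt b hF n t ht2).trans ((eLpNorm_add_le hm1 hm2 hP).trans ?_)
  rw [mul_add, mul_one]
  refine add_le_add ?_ ?_
  · rw [eLpNorm_norm]; exact ht1
  · have h5 := eLpNorm_const_smul (n : ℝ) (fun x => ‖F (x - t)‖) P (volume : Measure (Euc N))
    rw [eLpNorm_norm, hFn] at h5
    have h6 : ‖(n:ℝ)‖ₑ = n := by simp
    rw [h6] at h5
    exact h5.le

theorem wtransl {N : ℕ} {P : ℝ≥0∞} (hP : 1 ≤ P) (hPt : P ≠ ∞) (b : ℝ) {f : Euc N → ℝ}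
    (hf : MemLp (fun x => (1 + ‖x‖) ^ b * f x) P volume) :
    Tendsto (fun t : Euc N => wn b P (fun x => ‖f (x - t) - f x‖ₑ)) (𝓝 0) (𝓝 0) :=
  wtransl_aux hP hPt b (fun _ => rfl) hf

/-- The mollifier sequence. -/
def bmp (N n : ℕ) : ContDiffBump (0 : Euc N) :=
  ⟨1 / (2 * ((n : ℝ) + 1)), 1 / ((n : ℝ) + 1), by positivity, by
    apply one_div_lt_one_div_of_lt <;> linarith [(Nat.cast_nonneg n : (0 : ℝ) ≤ n)]⟩

/-- The mollifier sequence. -/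
def mo (N n : ℕ) : Euc N → ℝ := (bmp N n).normed volume

theorem mo_contDiff (N n : ℕ) : ContDiff ℝ (⊤ : ℕ∞) (mo N n) := ContDiffBump.contDiff_normed _
theorem mo_compact (N n : ℕ) : HasCompactSupport (mo N n) := ContDiffBump.hasCompactSupport_normed _
theorem mo_integral (N n : ℕ) : ∫ z, mo N n z = 1 := ContDiffBump.integral_normed _
theorem mo_nonneg (N n : ℕ) (x : Euc N) : 0 ≤ mo N n x := ContDiffBump.nonneg_normed _ _
theorem mo_zero (N n : ℕ) (x : Euc N) (h : mo N n x ≠ 0) : ‖x‖ < 1 / ((n : ℝ) + 1) := by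
  have : x ∈ Function.support (mo N n) := h
  rw [mo, ContDiffBump.support_normed_eq] at this
  simpa [bmp] using this

theorem moll_conv_meas {N : ℕ} {P : ℝ≥0∞} (hP : 1 ≤ P) (hPt : P ≠ ∞) (b : ℝ) {f : Euc N → ℝ}
    (hfm : Measurable f) (hl : LocallyIntegrable f volume)
    (hf : MemLp (fun x => (1 + ‖x‖) ^ b * f x) P volume) :
    Tendsto (fun n : ℕ => wn b P (fun x => ‖cv (mo N n) f x - f x‖ₑ)) atTop (𝓝 0) := by
  have hT := wtransl hP hPt b hf
  rw [ENNReal.tendsto_nhds_zero] at hT ⊢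
  intro ε hε
  obtain ⟨δ, hδ, hδ2⟩ := Metric.eventually_nhds_iff_ball.1 (hT ε hε)
  obtain ⟨n0, hn0⟩ := exists_nat_one_div_lt hδ
  filter_upwards [eventually_ge_atTop n0] with n hn
  have hnδ : 1 / ((n : ℝ) + 1) < δ := lt_of_le_of_lt (by gcongr) hn0
  set η := mo N n with hη
  have hηc : Continuous η := (mo_contDiff N n).continuous
  set ν : Measure (Euc N) := volume.withDensity (fun t => ‖η t‖ₑ) with hν
  have hν1 : ν Set.univ = 1 := by
    rw [hν, withDensity_apply _ MeasurableSet.univ, Measure.restrict_univ]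
    have h1 := ofReal_integral_eq_lintegral_ofReal 
      (hηc.integrable_of_hasCompactSupport (mo_compact N n) (μ := volume)) (Eventually.of_forall (mo_nonneg N n))
    rw [mo_integral, ENNReal.ofReal_one] at h1
    rw [h1]
    refine lintegral_congr fun t => ?_
    rw [Real.enorm_of_nonneg (mo_nonneg N n t)]
  have : IsFiniteMeasure ν := ⟨by rw [hν1]; simp⟩
  have hφm : Measurable (Function.uncurry (fun (t x : Euc N) => om b x * ‖f (x - t) - f x‖ₑ)) := by
    have := om_measurable (N := N) b
    unfold Function.uncurry
    fun_prop
  have hmk := minkowski_lint (ν := ν) (μ := (volume : Measure (Euc N))) hφm hP (K := ε) (by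
    rw [hν, ae_withDensity_iff hηc.enorm.measurable]
    refine Eventually.of_forall fun t ht => ?_
    refine hδ2 t ?_
    rw [mem_ball_zero_iff]
    exact (mo_zero N n t (by simpa using ht)).trans hnδ)
  rw [hν1, one_mul] at hmk
  refine le_trans (eLp_mono fun x => ?_) hmk
  rw [lintegral_const_mul' _ _ (om_ne_top b x)]
  gcongr
  rw [hν, lintegral_withDensity_eq_lintegral_mul _ hηc.enorm.measurable (by fun_prop)]
  have hi1 : Integrable (fun t => η t • f (x - t)) volume :=
    ((mo_compact N n).convolutionExists_left (ContinuousLinearMap.lsmul ℝ ℝ) hηc hl x).integrable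
  have hi2 : Integrable (fun t => η t • f x) volume :=
    (hηc.integrable_of_hasCompactSupport (mo_compact N n)).smul_const _
  have e : cv η f x - f x = ∫ t, η t • (f (x - t) - f x) := by
    simp only [smul_sub]
    rw [integral_sub hi1 hi2, integral_smul_const, mo_integral, one_smul]
    rfl
  change ‖cv η f x - f x‖ₑ ≤ _
  rw [e]
  refine (enorm_integral_le_lintegral_enorm _).trans (le_of_eq (lintegral_congr fun t => ?_))
  rw [enorm_smul]; rfl

theorem wn_congr {N : ℕ} {b : ℝ} {P : ℝ≥0∞} {F G : Euc N → ℝ≥0∞} (h : F =ᵐ[volume] G) :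
    wn b P F = wn b P G := by
  refine eLpNorm_congr_ae ?_
  filter_upwards [h] with x hx
  rw [hx]

theorem moll_conv {N : ℕ} {P : ℝ≥0∞} (hP : 1 ≤ P) (hPt : P ≠ ∞) (b : ℝ) {f : Euc N → ℝ}
    (hl : LocallyIntegrable f volume)
    (hf : MemLp (fun x => (1 + ‖x‖) ^ b * f x) P volume) :
    Tendsto (fun n : ℕ => wn b P (fun x => ‖cv (mo N n) f x - f x‖ₑ)) atTop (𝓝 0) := by
  have hae := hl.aestronglyMeasurable.ae_eq_mk
  set f' := hl.aestronglyMeasurable.mk f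
  have hl' : LocallyIntegrable f' volume := hl.congr hae
  have hf' : MemLp (fun x => (1 + ‖x‖) ^ b * f' x) P volume := by
    refine (memLp_congr_ae ?_).1 hf
    filter_upwards [hae] with x hx
    rw [hx]
  refine (moll_conv_meas hP hPt b hl.aestronglyMeasurable.stronglyMeasurable_mk.measurable hl' hf').congr fun n => ?_
  have : cv (mo N n) f' = cv (mo N n) f := convolution_congr _ EventuallyEq.rfl hae.symm
  rw [this]
  refine wn_congr ?_
  filter_upwards [hae] with x hx
  rw [hx]


theorem wn_eq {N : ℕ} (b : ℝ) (q : ℝ≥0∞) (f : Euc N → ℝ) :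
    wn b q (fun x => ‖f x‖ₑ) = eLpNorm (fun x => (1 + ‖x‖) ^ b * f x) q volume := by
  have h : ∀ x : Euc N, om b x * ‖f x‖ₑ = ‖(1 + ‖x‖) ^ b * f x‖ₑ := fun x => by
    have hx := norm_nonneg x
    rw [om_eq, enorm_mul, Real.enorm_of_nonneg (by positivity : 0 ≤ (1 + ‖x‖) ^ b)]
  unfold wn
  simp_rw [h]
  exact eLpNorm_enorm _

theorem wcont {N : ℕ} (b : ℝ) : Continuous (fun x : Euc N => (1 + ‖x‖) ^ b) := by
  refine Continuous.rpow_const (by fun_prop) fun x => Or.inl ?_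
  have := norm_nonneg x
  positivity

theorem wpos {N : ℕ} (b : ℝ) (x : Euc N) : 0 < (1 + ‖x‖) ^ b := by
  have := norm_nonneg x
  positivity

theorem cauchy_lim {N : ℕ} (b : ℝ) {q : ℝ≥0∞} (hq : 1 ≤ q) (f : ℕ → Euc N → ℝ) (hc : ∀ n, Continuous (f n))
    (hfin : ∀ n, wn b q (fun x => ‖f n x‖ₑ) ≠ ∞)
    (hcau : ∀ ε : ℝ≥0∞, 0 < ε → ∃ n0, ∀ n ≥ n0, ∀ m ≥ n0, wn b q (fun x => ‖f n x - f m x‖ₑ) < ε) :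
    ∃ v : Euc N → ℝ, MemLp (fun x => (1 + ‖x‖) ^ b * v x) q volume ∧
      Tendsto (fun n => wn b q (fun x => ‖f n x - v x‖ₑ)) atTop (𝓝 0) := by
  have : Fact (1 ≤ q) := ⟨hq⟩
  have hM : ∀ n, MemLp (fun x => (1 + ‖x‖) ^ b * f n x) q volume := fun n =>
    ⟨((wcont b).mul (hc n)).aestronglyMeasurable, by rw [← wn_eq]; exact (hfin n).lt_top⟩
  have hC : CauchySeq (fun n => (hM n).toLp _) := by
    rw [EMetric.cauchySeq_iff]
    intro ε hε
    obtain ⟨n0, h⟩ := hcau ε hε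
    refine ⟨n0, fun m hm n hn => ?_⟩
    rw [Lp.edist_toLp_toLp]
    refine lt_of_eq_of_lt ?_ (h m hm n hn)
    rw [wn_eq]
    refine eLpNorm_congr_ae (Eventually.of_forall fun x => ?_)
    simp [mul_sub]
  obtain ⟨V, hV⟩ := cauchySeq_tendsto_of_complete hC
  have e : ∀ x, (1 + ‖x‖) ^ b * (((1 + ‖x‖) ^ b)⁻¹ * V x) = V x := fun x => by
    rw [mul_inv_cancel_left₀ (wpos b x).ne']
  refine ⟨fun x => ((1 + ‖x‖) ^ b)⁻¹ * V x, ?_, ?_⟩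
  · simp_rw [e]; exact Lp.memLp V
  · rw [tendsto_iff_edist_tendsto_0] at hV
    refine hV.congr fun n => ?_
    rw [wn_eq, Lp.edist_def]
    refine eLpNorm_congr_ae ?_
    filter_upwards [(hM n).coeFn_toLp] with x hx
    simp only [Pi.sub_apply]
    rw [hx, mul_sub, e]

theorem loc_int_w {N : ℕ} (b : ℝ) {q : ℝ≥0∞} (hq : 1 ≤ q) {v : Euc N → ℝ} 
    (hv : MemLp (fun x => (1 + ‖x‖) ^ b * v x) q volume) : LocallyIntegrable v volume := by
  have h1 := hv.locallyIntegrable hq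
  have h2 := h1.continuous_smul ((wcont b).inv₀ fun x => (wpos b x).ne')
  convert h2 using 2 with x
  simp [inv_mul_cancel_left₀ (wpos b x).ne']

theorem int_conv {N : ℕ} (b : ℝ) {q : ℝ≥0∞} (hq : 1 ≤ q) {f : ℕ → Euc N → ℝ} {v : Euc N → ℝ}
    (hf : ∀ n, LocallyIntegrable (f n) volume) (hv : LocallyIntegrable v volume)
    (h : Tendsto (fun n => wn b q (fun x => ‖f n x - v x‖ₑ)) atTop (𝓝 0))
    {φ : Euc N → ℝ} (hφ : Continuous φ) (hφc : HasCompactSupport φ) :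
    Tendsto (fun n => ∫ x, f n x * φ x) atTop (𝓝 (∫ x, v x * φ x)) := by
  have hi : ∀ {f : Euc N → ℝ}, LocallyIntegrable f volume → Integrable (fun x => f x * φ x) volume := fun hf => by
    simpa [mul_comm] using hf.integrable_smul_left_of_hasCompactSupport hφ hφc
  set ψ : Euc N → ℝ := fun x => ((1 + ‖x‖) ^ b)⁻¹ * φ x with hψ
  have hψc : Continuous ψ := ((wcont b).inv₀ fun x => (wpos b x).ne').mul hφ
  have hψs : HasCompactSupport ψ := hφc.mul_left
  have : ENNReal.HolderConjugate q (ENNReal.conjExponent q) := ENNReal.HolderConjugate.conjExponent hq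
  set q' := ENNReal.conjExponent q
  have hK : eLpNorm ψ q' volume ≠ ∞ := (hψc.memLp_of_hasCompactSupport hψs).2.ne
  rw [tendsto_iff_edist_tendsto_0]
  have hz : Tendsto (fun n => wn b q (fun x => ‖f n x - v x‖ₑ) * eLpNorm ψ q' volume) atTop (𝓝 0) := by
    simpa using ENNReal.Tendsto.mul_const h (Or.inr hK)
  refine tendsto_of_tendsto_of_tendsto_of_le_of_le tendsto_const_nhds hz (fun n => bot_le) fun n => ?_
  simp only
  rw [edist_eq_enorm_sub, ← integral_sub (hi (hf n)) (hi hv)]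
  refine (enorm_integral_le_lintegral_enorm _).trans ?_
  have hm : AEStronglyMeasurable (fun x => (1 + ‖x‖) ^ b * (f n x - v x)) volume :=
    (wcont b).aestronglyMeasurable.mul ((hf n).aestronglyMeasurable.sub hv.aestronglyMeasurable)
  have := eLpNorm_smul_le_mul_eLpNorm (p := q) (q := q') (r := 1) hψc.aestronglyMeasurable hm
  rw [← wn_eq, eLpNorm_one_eq_lintegral_enorm] at this
  refine le_trans (le_of_eq (lintegral_congr fun x => ?_)) this
  have hw := (wpos b x).ne'
  congr 1
  simp only [Pi.smul_apply', smul_eq_mul, hψ]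
  field_simp


theorem wn_tri {N : ℕ} (b : ℝ) {q : ℝ≥0∞} (hq : 1 ≤ q) {f g : Euc N → ℝ}
    (hf : AEStronglyMeasurable f volume) (hg : AEStronglyMeasurable g volume) :
    wn b q (fun x => ‖f x‖ₑ) ≤ wn b q (fun x => ‖f x - g x‖ₑ) + wn b q (fun x => ‖g x‖ₑ) := by
  have h1 := wn_eq b q f
  have h2 := wn_eq b q (fun x => f x - g x)
  have h3 := wn_eq b q g
  rw [h1, h2, h3]
  have hw := (wcont (N := N) b).aestronglyMeasurable (μ := volume)
  refine le_trans (le_of_eq ?_) (eLpNorm_add_le (hw.mul (hf.sub hg)) (hw.mul hg) hq)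
  refine eLpNorm_congr_ae (Eventually.of_forall fun x => ?_)
  simp only [Pi.add_apply, Pi.mul_apply, Pi.sub_apply]
  ring

theorem wn_symm {N : ℕ} (b : ℝ) (q : ℝ≥0∞) (f g : Euc N → ℝ) :
    wn b q (fun x => ‖f x - g x‖ₑ) = wn b q (fun x => ‖g x - f x‖ₑ) := by
  refine congrArg _ (funext fun x => ?_)
  rw [← enorm_neg, neg_sub]

theorem wn_diff {N : ℕ} (b : ℝ) {q : ℝ≥0∞} (hq : 1 ≤ q) {f g h : Euc N → ℝ}
    (hf : AEStronglyMeasurable f volume) (hg : AEStronglyMeasurable g volume)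
    (hh : AEStronglyMeasurable h volume) :
    wn b q (fun x => ‖f x - g x‖ₑ) ≤ wn b q (fun x => ‖f x - h x‖ₑ) + wn b q (fun x => ‖g x - h x‖ₑ) := by
  have := wn_tri b hq (hf.sub hg) (hh.sub hg)
  simp only [Pi.sub_apply, sub_sub_sub_cancel_right] at this
  rwa [wn_symm b q h g] at this

theorem lim_abs {N : ℕ} {k r : ℕ} {β γ δ : ℝ} {P q : ℝ≥0∞} (hP : 1 ≤ P) (hq : 1 ≤ q) (C : NNReal) (T : Prop)
    (hC : ∀ u : Euc N → ℝ, ContDiff ℝ (⊤ : ℕ∞) u → ∀ A B : ℝ≥0∞, A ≠ ∞ → B ≠ ∞ →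
      wn β P (fun x => ‖u x‖ₑ) ≤ A →
      (∀ l : List (Fin N), l.length = k → wn γ P (fun x => ‖pderivList l u x‖ₑ) ≤ B) →
      ∀ l : List (Fin N), l.length = r →
        wn δ q (fun x => ‖pderivList l u x‖ₑ) ≤ C * (A + B) ∧
        (T → wn δ q (fun x => ‖pderivList l u x‖ₑ) ≤ C * B))
    (U : ℕ → Euc N → ℝ) (hU : ∀ n, ContDiff ℝ (⊤ : ℕ∞) (U n)) (a b : ℕ → ℝ≥0∞)
    (ha : ∀ n, a n ≠ ∞) (hb : ∀ n, b n ≠ ∞) (ha0 : Tendsto a atTop (𝓝 0)) (hb0 : Tendsto b atTop (𝓝 0))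
    {u : Euc N → ℝ} (hu : LocallyIntegrable u volume) 
    (hua : ∀ n, wn β P (fun x => ‖U n x - u x‖ₑ) ≤ a n)
    {A B : ℝ≥0∞} (hA : A ≠ ∞) (hB : B ≠ ∞) (huA : wn β P (fun x => ‖u x‖ₑ) ≤ A)
    (hg : ∀ l : List (Fin N), l.length = k → ∃ g : Euc N → ℝ, AEStronglyMeasurable g volume ∧ 
      (∀ n, wn γ P (fun x => ‖pderivList l (U n) x - g x‖ₑ) ≤ b n) ∧ wn γ P (fun x => ‖g x‖ₑ) ≤ B)
    (l : List (Fin N)) (hl : l.length = r) :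
    ∃ v : Euc N → ℝ, IsWeakDerivList l u v ∧ MemLp (fun x => (1 + ‖x‖) ^ δ * v x) q volume ∧
      wn δ q (fun x => ‖v x‖ₑ) ≤ C * (A + B) ∧ (T → wn δ q (fun x => ‖v x‖ₑ) ≤ C * B) := by
  have hum := hu.aestronglyMeasurable
  have hUm : ∀ n, AEStronglyMeasurable (U n) volume := fun n => (hU n).continuous.aestronglyMeasurable
  have hDm : ∀ n l, AEStronglyMeasurable (pderivList l (U n)) volume := 
    fun n l => (pderivList_contDiff l (hU n)).continuous.aestronglyMeasurable
  have hbd : ∀ n, wn δ q (fun x => ‖pderivList l (U n) x‖ₑ) ≤ C * ((a n + A) + (b n + B)) ∧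
        (T → wn δ q (fun x => ‖pderivList l (U n) x‖ₑ) ≤ C * (b n + B)) := by
    intro n
    refine hC (U n) (hU n) _ _ (ENNReal.add_ne_top.2 ⟨ha n, hA⟩) (ENNReal.add_ne_top.2 ⟨hb n, hB⟩) ?_ ?_ l hl
    · exact (wn_tri β hP (hUm n) hum).trans (add_le_add (hua n) huA)
    · intro l hl
      obtain ⟨g, hgm, h1, h2⟩ := hg l hl
      exact (wn_tri γ hP (hDm n l) hgm).trans (add_le_add (h1 n) h2)
  have hdf : ∀ n m, wn δ q (fun x => ‖pderivList l (U n) x - pderivList l (U m) x‖ₑ) ≤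
      C * ((a n + a m) + (b n + b m)) := by
    intro n m
    have h0 := (hC (fun x => U n x - U m x) ((hU n).sub (hU m)) (a n + a m) (b n + b m)
      (ENNReal.add_ne_top.2 ⟨ha n, ha m⟩) (ENNReal.add_ne_top.2 ⟨hb n, hb m⟩) ?_ ?_ l hl).1
    · rwa [pderivList_sub l (hU n) (hU m)] at h0
    · exact (wn_diff β hP (hUm n) (hUm m) hum).trans (add_le_add (hua n) (hua m))
    · intro l hl
      obtain ⟨g, hgm, h1, h2⟩ := hg l hl
      rw [pderivList_sub l (hU n) (hU m)]
      exact (wn_diff γ hP (hDm n l) (hDm m l) hgm).trans (add_le_add (h1 n) (h1 m))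
  have hab : Tendsto (fun n => C * (a n + b n)) atTop (𝓝 0) := by
    have := ENNReal.Tendsto.const_mul (ha0.add hb0) (Or.inr (ENNReal.coe_ne_top (r := C)))
    simpa using this
  obtain ⟨v, hv, hvt⟩ := cauchy_lim δ hq (fun n => pderivList l (U n)) 
    (fun n => (pderivList_contDiff l (hU n)).continuous)
    (fun n => ((hbd n).1.trans_lt (ENNReal.mul_lt_top (by simp) (by
      rw [lt_top_iff_ne_top]; simp [ha n, hb n, hA, hB]))).ne) (by
    intro ε hε
    obtain ⟨ε', h1, h2⟩ := exists_between hε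
    have hev := (ENNReal.tendsto_nhds_zero.1 hab) (ε' / 2) (ENNReal.half_pos h1.ne')
    obtain ⟨n0, hn0⟩ := eventually_atTop.1 hev
    refine ⟨n0, fun n hn m hm => lt_of_le_of_lt ?_ h2⟩
    refine (hdf n m).trans ?_
    calc (C : ℝ≥0∞) * ((a n + a m) + (b n + b m)) = C * (a n + b n) + C * (a m + b m) := by ring
      _ ≤ ε' / 2 + ε' / 2 := add_le_add (hn0 n hn) (hn0 m hm)
      _ = ε' := ENNReal.add_halves _)
  have hvl : LocallyIntegrable v volume := loc_int_w δ hq hv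
  have hvb : ∀ n, wn δ q (fun x => ‖v x‖ₑ) ≤ wn δ q (fun x => ‖pderivList l (U n) x - v x‖ₑ) + 
      wn δ q (fun x => ‖pderivList l (U n) x‖ₑ) := fun n => by
    rw [wn_symm]
    exact wn_tri δ hq hvl.aestronglyMeasurable (hDm n l)
  refine ⟨v, ⟨hu, hvl, fun φ hφ hφc => ?_⟩, hv, ?_, fun hT => ?_⟩
  · have h1 := int_conv β hP (fun n => (hU n).continuous.locallyIntegrable) hu
      (tendsto_of_tendsto_of_tendsto_of_le_of_le tendsto_const_nhds ha0 (fun n => bot_le) hua)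
      (pderivList_contDiff l hφ).continuous (pderivList_compact l hφc)
    have h2 := int_conv δ hq (fun n => (pderivList_contDiff l (hU n)).continuous.locallyIntegrable) hvl hvt
      hφ.continuous hφc
    refine tendsto_nhds_unique h1 ((h2.const_mul ((-1 : ℝ) ^ l.length)).congr fun n => ?_)
    exact (ibp l (hU n) hφ hφc).symm
  · have ht : Tendsto (fun n => wn δ q (fun x => ‖pderivList l (U n) x - v x‖ₑ) + 
        C * ((a n + A) + (b n + B))) atTop (𝓝 (0 + C * ((0 + A) + (0 + B)))) :=
      hvt.add (ENNReal.Tendsto.const_mul ((ha0.add_const A).add (hb0.add_const B))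
        (Or.inr ENNReal.coe_ne_top))
    rw [zero_add, zero_add, zero_add] at ht
    exact ge_of_tendsto' ht fun n => (hvb n).trans (add_le_add le_rfl (hbd n).1)
  · have ht : Tendsto (fun n => wn δ q (fun x => ‖pderivList l (U n) x - v x‖ₑ) + 
        C * (b n + B)) atTop (𝓝 (0 + C * (0 + B))) :=
      hvt.add (ENNReal.Tendsto.const_mul (hb0.add_const B) (Or.inr ENNReal.coe_ne_top))
    rw [zero_add, zero_add] at ht
    exact ge_of_tendsto' ht fun n => (hvb n).trans (add_le_add le_rfl ((hbd n).2 hT))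

theorem lim_main {N : ℕ} (hN : 1 ≤ N) (k : ℕ) (p s : ℝ) (hp : 1 ≤ p) (j : ℕ) (hj : 1 ≤ j)
    (hjk : j ≤ k) (q : ℝ≥0∞) (hq : q ∈ Ijp N j p) :
    ∃ C : NNReal, ∀ (u : Euc N → ℝ) (g : (Fin k → Fin N) → Euc N → ℝ),
      (∀ m, IsWeakDerivList (List.ofFn m) u (g m)) →
      (∀ m, MemLs N s (ENNReal.ofReal p) (g m)) →
      MemLs N (s + k) (ENNReal.ofReal p) u →
      ∀ B : ℝ≥0∞, B ≠ ∞ → (∀ m, wn (-s - N / p) (ENNReal.ofReal p) (fun x => ‖g m x‖ₑ) ≤ B) →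
      ∀ l : List (Fin N), l.length = k - j → ∃ v : Euc N → ℝ, IsWeakDerivList l u v ∧ 
        MemLs N (s + j) q v ∧
        wn (-(s + j) - N / q.toReal) q (fun x => ‖v x‖ₑ) ≤ 
          C * (wn (-(s + k) - N / p) (ENNReal.ofReal p) (fun x => ‖u x‖ₑ) + B) ∧
        (j ≤ k - kIndex k s → 
          wn (-(s + j) - N / q.toReal) q (fun x => ‖v x‖ₑ) ≤ C * B) := by
  obtain ⟨C, hC⟩ := smooth_main hN k p s hp j hj hjk q hq
  refine ⟨C, fun u g hw hgM huM B hB hgB l hl => ?_⟩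
  have hP : 1 ≤ ENNReal.ofReal p := by rw [ENNReal.one_le_ofReal]; exact hp
  have hPq := (Q_exists hN hj hp hq).1
  have hpr : (ENNReal.ofReal p).toReal = p := ENNReal.toReal_ofReal (by linarith)
  have huM' : MemLp (fun x => (1 + ‖x‖) ^ (-(s + k) - N / p) * u x) (ENNReal.ofReal p) volume := by
    have := huM; unfold MemLs wt at this; rwa [hpr] at this
  have hgM' : ∀ m, MemLp (fun x => (1 + ‖x‖) ^ (-s - N / p) * g m x) (ENNReal.ofReal p) volume := by
    intro m; have := hgM m; unfold MemLs wt at this; rwa [hpr] at this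
  have hul : LocallyIntegrable u volume := loc_int_w _ hP huM'
  have hgl : ∀ m, LocallyIntegrable (g m) volume := fun m => loc_int_w _ hP (hgM' m)
  have ta := moll_conv hP ENNReal.ofReal_ne_top _ hul huM'
  have tb : Tendsto (fun n : ℕ => ∑ m, wn (-s - N / p) (ENNReal.ofReal p) 
      (fun x => ‖cv (mo N n) (g m) x - g m x‖ₑ)) atTop (𝓝 0) := by
    have := tendsto_finset_sum Finset.univ fun m _ => 
      moll_conv hP ENNReal.ofReal_ne_top _ (hgl m) (hgM' m)
    simpa using this
  have ev := (ta.eventually (gt_mem_nhds ENNReal.zero_lt_top)).and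
    (tb.eventually (gt_mem_nhds ENNReal.zero_lt_top))
  obtain ⟨n0, hn0⟩ := eventually_atTop.1 ev
  have hsh : Tendsto (fun n => n + n0) atTop atTop := tendsto_add_atTop_nat n0
  have main := lim_abs hP (hP.trans hPq) C (j ≤ k - kIndex k s) hC (fun n => cv (mo N (n + n0)) u)
    (fun n => cv_contDiff (mo_contDiff _ _) (mo_compact _ _) hul) _ _
    (fun n => (hn0 (n + n0) (by omega)).1.ne) (fun n => (hn0 (n + n0) (by omega)).2.ne)
    (ta.comp hsh) (tb.comp hsh) hul (fun n => le_rfl) 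
    (A := wn (-(s + k) - N / p) (ENNReal.ofReal p) (fun x => ‖u x‖ₑ)) (by rw [wn_eq]; exact huM'.2.ne) hB le_rfl
    (by
      intro l hl
      obtain ⟨m, rfl⟩ : ∃ m : Fin k → Fin N, List.ofFn m = l := by
        subst hl; exact ⟨l.get, List.ofFn_get l⟩
      refine ⟨g m, (hgl m).aestronglyMeasurable, fun n => ?_, hgB m⟩
      rw [cv_weak _ (mo_contDiff _ _) (mo_compact _ _) (hw m)]
      exact Finset.single_le_sum (f := fun m => wn (-s - N / p) (ENNReal.ofReal p) 
        (fun x => ‖cv (mo N (n + n0)) (g m) x - g m x‖ₑ)) (fun _ _ => bot_le) (Finset.mem_univ m)) l hl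
  exact main


theorem gnk_nonneg {N k : ℕ} (v : (Fin k → Fin N) → Euc N → ℝ) (x : Euc N) :
    0 ≤ gradNormK v x := Real.sqrt_nonneg _

theorem gnk_le {N k : ℕ} (v : (Fin k → Fin N) → Euc N → ℝ) (x : Euc N) :
    gradNormK v x ≤ ∑ m, |v m x| := by
  unfold gradNormK
  rw [Real.sqrt_le_left (Finset.sum_nonneg fun _ _ => abs_nonneg _)]
  calc ∑ m, v m x ^ 2 = ∑ m, |v m x| ^ 2 := by simp
    _ ≤ _ := Finset.sum_sq_le_sq_sum_of_nonneg fun _ _ => abs_nonneg _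

theorem le_gnk {N k : ℕ} (v : (Fin k → Fin N) → Euc N → ℝ) (m : Fin k → Fin N) (x : Euc N) :
    |v m x| ≤ gradNormK v x := by
  unfold gradNormK
  rw [← Real.sqrt_sq_eq_abs]
  exact Real.sqrt_le_sqrt (Finset.single_le_sum (f := fun m => v m x ^ 2) (fun _ _ => sq_nonneg _) (Finset.mem_univ m))

theorem gnk_mem {N k : ℕ} (s : ℝ) {q : ℝ≥0∞} (hq : 1 ≤ q) (v : (Fin k → Fin N) → Euc N → ℝ)
    (hm : ∀ m, AEStronglyMeasurable (v m) volume) (hv : ∀ m, MemLs N s q (v m)) :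
    MemLs N s q (gradNormK v) ∧ eLpNorm (fun x => wt N s q x * gradNormK v x) q volume
      ≤ ∑ m, eLpNorm (fun x => wt N s q x * v m x) q volume := by
  have hwm : AEStronglyMeasurable (wt N s q) volume := (wcont _).aestronglyMeasurable
  have hgm : AEStronglyMeasurable (gradNormK v) volume := by
    have h1 : AEMeasurable (fun x => ∑ m, v m x ^ 2) volume :=
      Finset.aemeasurable_fun_sum _ fun m _ => (hm m).aemeasurable.pow_const 2
    exact (h1.sqrt).aestronglyMeasurable
  have hle : eLpNorm (fun x => wt N s q x * gradNormK v x) q volume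
      ≤ ∑ m, eLpNorm (fun x => wt N s q x * v m x) q volume := by
    have h2 := eLpNorm_sum_le (μ := (volume : Measure (Euc N))) (p := q) (s := Finset.univ)
      (f := fun m x => ‖wt N s q x * v m x‖) (fun m _ => (hwm.mul (hm m)).norm) hq
    simp only [eLpNorm_norm] at h2
    refine le_trans (eLpNorm_mono_real fun x => ?_) h2
    have hw : 0 < wt N s q x := wpos _ x
    rw [Finset.sum_apply, norm_mul, Real.norm_of_nonneg hw.le, 
      Real.norm_of_nonneg (gnk_nonneg v x)]
    simp only [norm_mul, Real.norm_of_nonneg hw.le, ← Finset.mul_sum]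
    exact mul_le_mul_of_nonneg_left (gnk_le v x) hw.le
  exact ⟨⟨hwm.mul hgm, hle.trans_lt (ENNReal.sum_lt_top.2 fun m _ => (hv m).2)⟩, hle⟩

theorem le_gnk_norm {N k : ℕ} (s : ℝ) (q : ℝ≥0∞) (v : (Fin k → Fin N) → Euc N → ℝ) (m : Fin k → Fin N) :
    eLpNorm (fun x => wt N s q x * v m x) q volume ≤ 
      eLpNorm (fun x => wt N s q x * gradNormK v x) q volume := by
  refine eLpNorm_mono fun x => ?_
  rw [norm_mul, norm_mul, Real.norm_of_nonneg (gnk_nonneg v x)]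
  exact mul_le_mul_of_nonneg_left (le_gnk v m x) (norm_nonneg _)

theorem toReal_bd {x y : ℝ≥0∞} {c : NNReal} (d : ℕ) (hy : y ≠ ∞) (h : x ≤ d * (c * y)) :
    x.toReal ≤ ((d * c : NNReal) + 1 : ℝ) * y.toReal := by
  have h1 := ENNReal.toReal_mono (ENNReal.mul_ne_top (ENNReal.natCast_ne_top d) 
    (ENNReal.mul_ne_top ENNReal.coe_ne_top hy)) h
  rw [ENNReal.toReal_mul, ENNReal.toReal_mul, ENNReal.toReal_natCast, ENNReal.coe_toReal] at h1
  have := ENNReal.toReal_nonneg (a := y)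
  push_cast
  nlinarith


/-- Theorem 12(ii). For `k ≥ 1`, `1 ≤ p < ∞`, `s ∉ {-k,…,-1}`:
if `u ∈ W^{k,p,p}_s` then `∇^{k-j}u ∈ (L^q_{s+j})^{ν(k-j,N)}` for all `1 ≤ j ≤ k` and
`q ∈ I_{j,p}`, with `‖|∇^{k-j}u|‖_{L^q_{s+j}} ≤ C ‖|∇^k u|‖_{L^p_s}` when
`1 ≤ j ≤ k - k_s`, and `‖|∇^{k-j}u|‖_{L^q_{s+j}} ≤ C(‖u‖_{L^p_{s+k}} + ‖|∇^k u|‖_{L^p_s})`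
when `1 ≤ j ≤ k`, the constant being independent of `u`. -/
theorem stmt_17 {N : ℕ} (hN : 1 ≤ N) (k : ℕ) (hk : 1 ≤ k) (p s : ℝ) (hp : 1 ≤ p)
    (hs : ∀ m : ℕ, 1 ≤ m → m ≤ k → s ≠ -(m : ℝ)) :
    ∀ j : ℕ, 1 ≤ j → j ≤ k →
    ∀ q ∈ Ijp N j p,
      ∃ C : ℝ, 0 < C ∧
        ∀ (u : Euc N → ℝ) (g : (Fin k → Fin N) → Euc N → ℝ),
          (∀ m, IsWeakDerivList (List.ofFn m) u (g m)) →
          (∀ m, MemLs N s (ENNReal.ofReal p) (g m)) →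
          MemLs N (s + k) (ENNReal.ofReal p) u →
          ∃ v : (Fin (k - j) → Fin N) → Euc N → ℝ,
            (∀ m, IsWeakDerivList (List.ofFn m) u (v m)) ∧
            MemLs N (s + j) q (gradNormK v) ∧
            (j ≤ k - kIndex k s →
              LsNorm N (s + j) q (gradNormK v)
                ≤ C * LsNorm N s (ENNReal.ofReal p) (gradNormK g)) ∧
            LsNorm N (s + j) q (gradNormK v)
              ≤ C * (LsNorm N (s + k) (ENNReal.ofReal p) u
                + LsNorm N s (ENNReal.ofReal p) (gradNormK g)) := by
  intro j hj hjk q hq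
  obtain ⟨C, hC⟩ := lim_main hN k p s hp j hj hjk q hq
  set d : ℕ := Fintype.card (Fin (k - j) → Fin N) with hd
  refine ⟨((d * C : NNReal) + 1 : ℝ), by positivity, fun u g hw hg hu => ?_⟩
  have hP : 1 ≤ ENNReal.ofReal p := by rw [ENNReal.one_le_ofReal]; exact hp
  have hq1 : 1 ≤ q := hP.trans (Q_exists hN hj hp hq).1
  have hpr : (ENNReal.ofReal p).toReal = p := ENNReal.toReal_ofReal (by linarith)
  obtain ⟨hgM, -⟩ := gnk_mem s hP g (fun m => (hw m).2.1.aestronglyMeasurable) hg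
  have key := hC u g hw hg hu (eLpNorm (fun x => wt N s (ENNReal.ofReal p) x * gradNormK g x) 
    (ENNReal.ofReal p) volume) hgM.2.ne (fun m => by
      have h1 := le_gnk_norm s (ENNReal.ofReal p) g m
      rwa [nrm_eq _ _ (g m), hpr] at h1)
  have hA : wn (-(s + k) - N / p) (ENNReal.ofReal p) (fun x => ‖u x‖ₑ) = 
      eLpNorm (fun x => wt N (s + k) (ENNReal.ofReal p) x * u x) (ENNReal.ofReal p) volume := by
    rw [nrm_eq, hpr]
  rw [hA] at key
  choose v hv1 hv2 hv3 hv4 using fun m : Fin (k - j) → Fin N => key (List.ofFn m) (List.length_ofFn)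
  obtain ⟨hvM, hvle⟩ := gnk_mem (s + j) hq1 v (fun m => (hv1 m).2.1.aestronglyMeasurable) hv2
  refine ⟨v, hv1, hvM, fun hT => ?_, ?_⟩
  · refine toReal_bd d hgM.2.ne (hvle.trans ?_)
    refine (Finset.sum_le_card_nsmul _ _ _ fun m _ => le_of_eq_of_le (nrm_eq _ _ _) (hv4 m hT)).trans_eq ?_
    rw [nsmul_eq_mul, Finset.card_univ]
  · unfold LsNorm
    rw [← ENNReal.toReal_add hu.2.ne hgM.2.ne]
    refine toReal_bd d (ENNReal.add_ne_top.2 ⟨hu.2.ne, hgM.2.ne⟩) (hvle.trans ?_)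
    refine (Finset.sum_le_card_nsmul _ _ _ fun m _ => le_of_eq_of_le (nrm_eq _ _ _) (hv3 m)).trans_eq ?_
    rw [nsmul_eq_mul, Finset.card_univ]

end
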